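/- arXiv:2309.05011 — 3 statements merged into one kernel-verified Lean document; each statement's English description precedes it below -/
import Mathlib

section
/- Let k be a field, d ≥ 5 an integer, S = k[x_1,…,x_d,y_1,…,y_d], and fix an integer a with 2 ≤ a ≤ d − 1. Let G_{d,a} be the bipartite graph whose edge ideal is I(G_{d,a}) = x_1(y_1,…,y_d) + (x_i y_j : 2 ≤ i ≤ j ≤ a) + (x_i y_j : a+1 ≤ i ≤ j ≤ d). Then depth(S/I(G_{d,a})^t) equals d if t = 1, equals min(a, d − a + 1) if t = 2, and equals 1 if t ≥ 3. In particular, G_{d,a} is a connected Cohen-Macaulay bipartite graph whose depth sequence of powers has two drops (a drop at k means depth S/I^k − depth S/I^{k+1} > 1). -/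
open MvPolynomial

/-- The maximal homogeneous ideal of the polynomial ring, generated by all variables. -/
noncomputable def maxHomIdeal (k : Type) [Field k] (V : Type) : Ideal (MvPolynomial V k) :=
  Ideal.span (Set.range (X : V → MvPolynomial V k))

/-- `depthQuot k I` is the depth of `S/I` where `S = k[x_v : v ∈ V]`, defined as
`min {i : H^i_m(S/I) ≠ 0}` where `m` is the maximal homogeneous ideal and `H^i_m` is
local cohomology. -/
noncomputable def depthQuot (k : Type) [Field k] {V : Type} (I : Ideal (MvPolynomial V k)) : ℕ :=
  sInf {i : ℕ |
    Nontrivial ((localCohomology (maxHomIdeal k V) i).obj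
      (ModuleCat.of (MvPolynomial V k) (MvPolynomial V k ⧸ I)))}

/-- The edge ideal of a simple graph `G`, generated by the monomials `x_i x_j` for
edges `{i, j}` of `G`. -/
noncomputable def edgeIdeal (k : Type) [Field k] {V : Type} (G : SimpleGraph V) :
    Ideal (MvPolynomial V k) :=
  Ideal.span {p | ∃ i j, G.Adj i j ∧ p = X i * X j}

section LocalCohomologyCochains

open CategoryTheory Limits

variable {R : Type} [CommRing R]

/-- A linear map `K_i → M` vanishing on boundaries. -/
def IsCocycle (K : ChainComplex (ModuleCat.{0} R) ℕ) (i : ℕ) {M : Type} [AddCommGroup M]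
    [Module R M] (φ : K.X i →ₗ[R] M) : Prop :=
  φ ∘ₗ (K.d (i + 1) i).hom = 0

/-- A linear map `K_i → M` factoring through the differential `K_i → K_{i-1}`. -/
def IsCoboundary (K : ChainComplex (ModuleCat.{0} R) ℕ) (i : ℕ) {M : Type} [AddCommGroup M]
    [Module R M] (φ : K.X i →ₗ[R] M) : Prop :=
  ∃ ψ : K.X (i - 1) →ₗ[R] M, φ = ψ ∘ₗ (K.d i (i - 1)).hom

/-- A chosen projective resolution of `R ⧸ m ^ s`. -/
noncomputable def quotPowRes (m : Ideal R) (s : ℕ) :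
    ProjectiveResolution (ModuleCat.of R (R ⧸ m ^ s)) :=
  projectiveResolution _

/-- A chain map between the chosen resolutions lifting `R ⧸ m ^ s' → R ⧸ m ^ s`. -/
noncomputable def quotPowResMap (m : Ideal R) {s s' : ℕ} (h : s ≤ s') :
    (quotPowRes m s').complex ⟶ (quotPowRes m s).complex :=
  ProjectiveResolution.lift
    (ModuleCat.ofHom (Submodule.mapQ (m ^ s') (m ^ s) LinearMap.id (Ideal.pow_le_pow_right h)))
    (quotPowRes m s') (quotPowRes m s)

/-- `Ext^i(R/m^s, M) = 0` for all `i < n` and all `s`. -/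
def ExtVanishesBelow (m : Ideal R) (n : ℕ) (M : Type) [AddCommGroup M] [Module R M] : Prop :=
  ∀ i < n, ∀ s, ∀ φ : (quotPowRes m s).complex.X i →ₗ[R] M,
    IsCocycle _ i φ → IsCoboundary _ i φ

/-- Some class in `Ext^i(R/m^s, M)` survives in `Ext^i(R/m^s', M)` for all `s' ≥ s`. -/
def ExtSurvives (m : Ideal R) (i : ℕ) (M : Type) [AddCommGroup M] [Module R M] : Prop :=
  ∃ s, ∃ φ : (quotPowRes m s).complex.X i →ₗ[R] M, IsCocycle _ i φ ∧
    ∀ s' (h : s ≤ s'), ¬ IsCoboundary _ i (φ ∘ₗ ((quotPowResMap m h).f i).hom)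

/-- The augmentation of the chosen resolution of `R ⧸ m ^ s`. -/
noncomputable def quotPowAug (m : Ideal R) (s : ℕ) :
    (quotPowRes m s).complex.X 0 →ₗ[R] (R ⧸ m ^ s) :=
  ((quotPowRes m s).π.f 0).hom

lemma quotPowAug_surjective (m : Ideal R) (s : ℕ) : Function.Surjective (quotPowAug m s) :=
  (ModuleCat.epi_iff_surjective ((quotPowRes m s).π.f 0)).1 inferInstance

lemma quotPowAug_comp_d (m : Ideal R) (s : ℕ) :
    quotPowAug m s ∘ₗ ((quotPowRes m s).complex.d 1 0).hom = 0 :=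
  congrArg ModuleCat.Hom.hom (quotPowRes m s).complex_d_comp_π_f_zero

lemma quotPowAug_comp_map (m : Ideal R) {s s' : ℕ} (h : s ≤ s') :
    quotPowAug m s ∘ₗ ((quotPowResMap m h).f 0).hom =
      Submodule.mapQ (m ^ s') (m ^ s) LinearMap.id (Ideal.pow_le_pow_right h) ∘ₗ
        quotPowAug m s' := by
  have := ProjectiveResolution.lift_commutes_zero
    (ModuleCat.ofHom (Submodule.mapQ (m ^ s') (m ^ s) LinearMap.id (Ideal.pow_le_pow_right h)))
    (quotPowRes m s') (quotPowRes m s)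
  exact congrArg ModuleCat.Hom.hom this

lemma quotPow_smul_eq_zero {m : Ideal R} {v : R} (hv : v ∈ m) {s : ℕ} (x : R ⧸ m ^ s) :
    v ^ s • x = 0 := by
  obtain ⟨x, rfl⟩ := Ideal.Quotient.mk_surjective x
  exact Ideal.Quotient.eq_zero_iff_mem.2 (Ideal.mul_mem_right _ _ (Ideal.pow_mem_pow hv s))

lemma quotPowRes_projective (m : Ideal R) (s i : ℕ) :
    Module.Projective R ((quotPowRes m s).complex.X i) :=
  (IsProjective.iff_projective _).2 ((quotPowRes m s).projective i)

section

variable {K L : ChainComplex (ModuleCat.{0} R) ℕ}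
  {M N A B C : Type} [AddCommGroup M] [Module R M] [AddCommGroup N] [Module R N]
  [AddCommGroup A] [Module R A] [AddCommGroup B] [Module R B] [AddCommGroup C] [Module R C]

lemma chain_d_comp_d (K : ChainComplex (ModuleCat.{0} R) ℕ) (i j l : ℕ) :
    (K.d j l).hom ∘ₗ (K.d i j).hom = 0 := by
  rw [← ModuleCat.hom_comp, K.d_comp_d]; rfl

lemma chainMap_comm (f : K ⟶ L) (i j : ℕ) :
    (f.f j).hom ∘ₗ (K.d i j).hom = (L.d i j).hom ∘ₗ (f.f i).hom := by
  rw [← ModuleCat.hom_comp, ← ModuleCat.hom_comp, f.comm]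

lemma isCoboundary_succ_iff {i : ℕ} {φ : K.X (i + 1) →ₗ[R] M} :
    IsCoboundary K (i + 1) φ ↔ ∃ ψ : K.X i →ₗ[R] M, φ = ψ ∘ₗ (K.d (i + 1) i).hom :=
  Iff.rfl

lemma isCoboundary_zero_iff {φ : K.X 0 →ₗ[R] M} : IsCoboundary K 0 φ ↔ φ = 0 := by
  simp [IsCoboundary]

lemma IsCocycle.comp {i : ℕ} {φ : K.X i →ₗ[R] M} (h : IsCocycle K i φ) (f : M →ₗ[R] N) :
    IsCocycle K i (f ∘ₗ φ) := by
  unfold IsCocycle at *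
  rw [LinearMap.comp_assoc, h, LinearMap.comp_zero]

lemma IsCoboundary.comp {i : ℕ} {φ : K.X i →ₗ[R] M} (h : IsCoboundary K i φ) (f : M →ₗ[R] N) :
    IsCoboundary K i (f ∘ₗ φ) := by
  obtain ⟨ψ, rfl⟩ := h
  exact ⟨f ∘ₗ ψ, by rw [LinearMap.comp_assoc]⟩

lemma IsCocycle.comp_map {i : ℕ} {φ : L.X i →ₗ[R] M} (h : IsCocycle L i φ) (f : K ⟶ L) :
    IsCocycle K i (φ ∘ₗ (f.f i).hom) := by
  unfold IsCocycle at *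
  rw [LinearMap.comp_assoc, chainMap_comm, ← LinearMap.comp_assoc, h, LinearMap.zero_comp]

lemma IsCoboundary.add {i : ℕ} {φ φ' : K.X i →ₗ[R] M} (h : IsCoboundary K i φ)
    (h' : IsCoboundary K i φ') : IsCoboundary K i (φ + φ') := by
  obtain ⟨ψ, rfl⟩ := h
  obtain ⟨ψ', rfl⟩ := h'
  exact ⟨ψ + ψ', by rw [LinearMap.add_comp]⟩

lemma IsCocycle.comp_of_homotopy {i : ℕ} {φ : L.X i →ₗ[R] M} (hφ : IsCocycle L i φ)
    {f : K ⟶ L} (h : Homotopy f 0) : IsCoboundary K i (φ ∘ₗ (f.f i).hom) := by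
  have hc : f.f i = _ := h.comm i
  rw [Homotopy.prevD_chainComplex, HomologicalComplex.zero_f, add_zero] at hc
  have h2 : φ ∘ₗ (h.hom i (i + 1) ≫ L.d (i + 1) i).hom = 0 := by
    rw [ModuleCat.hom_comp, ← LinearMap.comp_assoc, hφ, LinearMap.zero_comp]
  rcases i with _ | i
  · rw [Homotopy.dNext_zero_chainComplex, zero_add] at hc
    rw [isCoboundary_zero_iff, hc, h2]
  · rw [Homotopy.dNext_succ_chainComplex] at hc
    refine isCoboundary_succ_iff.2 ⟨φ ∘ₗ (h.hom i (i + 1)).hom, ?_⟩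
    rw [hc, ModuleCat.hom_add, LinearMap.comp_add, h2, add_zero]
    rfl

lemma isCoboundary_pow_smul {m : Ideal R} {v : R} (hv : v ∈ m) {i s : ℕ}
    (φ : (quotPowRes m s).complex.X i →ₗ[R] M) (hφ : IsCocycle _ i φ) :
    IsCoboundary _ i (v ^ s • φ) := by
  have h := hφ.comp_of_homotopy (f := v ^ s • 𝟙 (quotPowRes m s).complex)
    (ProjectiveResolution.liftHomotopyZero _ (by
      refine HomologicalComplex.to_single_hom_ext ?_
      ext x
      exact ((quotPowAug m s).map_smul (v ^ s) x).trans
        (quotPow_smul_eq_zero hv (quotPowAug m s x))))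
  convert h using 1
  ext x
  simp

lemma exists_factor_of_exact {P : Type} [AddCommGroup P] [Module R P] (f : A →ₗ[R] B)
    (g : B →ₗ[R] C)
    (hf : Function.Injective f) (hfg : ∀ b, g b = 0 → ∃ a, f a = b)
    (φ : P →ₗ[R] B) (h : g ∘ₗ φ = 0) : ∃ α : P →ₗ[R] A, φ = f ∘ₗ α := by
  have hr : ∀ p, φ p ∈ LinearMap.range f := fun p => hfg _ (LinearMap.congr_fun h p)
  refine ⟨(LinearEquiv.ofInjective f hf).symm.toLinearMap ∘ₗ φ.codRestrict _ hr, ?_⟩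
  ext p
  have := (LinearEquiv.ofInjective f hf).apply_symm_apply (φ.codRestrict _ hr p)
  exact (congrArg Subtype.val this).symm

end

section ShortExact

variable {m : Ideal R} {A B C : Type} [AddCommGroup A] [Module R A]
  [AddCommGroup B] [Module R B] [AddCommGroup C] [Module R C]
  {f : A →ₗ[R] B} {g : B →ₗ[R] C}

lemma ExtVanishesBelow.mono {n n' : ℕ} (h : ExtVanishesBelow m n A) (hn : n' ≤ n) :
    ExtVanishesBelow m n' A :=
  fun i hi => h i (hi.trans_le hn)

variable (hf : Function.Injective f) (hg : Function.Surjective g)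
  (hgf : g ∘ₗ f = 0) (hfg : ∀ b, g b = 0 → ∃ a, f a = b)

include hf hg hfg

/-- If `g ∘ φ` is a coboundary then `φ` is cohomologous to a cocycle with values in `A`. -/
lemma exists_cocycle_lift {i s : ℕ} (φ : (quotPowRes m s).complex.X i →ₗ[R] B)
    (hφ : IsCocycle _ i φ) (hb : IsCoboundary _ i (g ∘ₗ φ)) :
    ∃ α : (quotPowRes m s).complex.X i →ₗ[R] A, IsCocycle _ i α ∧
      IsCoboundary _ i (φ - f ∘ₗ α) := by
  have := quotPowRes_projective m s (i - 1)
  obtain ⟨ψ, hψ⟩ := hb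
  obtain ⟨χ, rfl⟩ := Module.projective_lifting_property g ψ hg
  obtain ⟨α, hα⟩ := exists_factor_of_exact f g hf hfg
    (φ - χ ∘ₗ ((quotPowRes m s).complex.d i (i - 1)).hom) (by
      rw [LinearMap.comp_sub, hψ, LinearMap.comp_assoc, sub_self])
  refine ⟨α, ?_, χ, by rw [← hα]; abel⟩
  have h : IsCocycle _ i (f ∘ₗ α) := by
    rw [← hα]
    unfold IsCocycle at *
    rw [LinearMap.sub_comp, hφ, LinearMap.comp_assoc, chain_d_comp_d]; simp
  unfold IsCocycle at *
  rw [LinearMap.comp_assoc] at h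
  exact LinearMap.ext fun x => hf (by simpa using LinearMap.congr_fun h x)

/-- The connecting homomorphism on cochains. -/
lemma exists_connecting {i s : ℕ} (γ : (quotPowRes m s).complex.X i →ₗ[R] C)
    (hγ : IsCocycle _ i γ) :
    ∃ (β : (quotPowRes m s).complex.X i →ₗ[R] B)
      (α : (quotPowRes m s).complex.X (i + 1) →ₗ[R] A), g ∘ₗ β = γ ∧
      f ∘ₗ α = β ∘ₗ ((quotPowRes m s).complex.d (i + 1) i).hom ∧ IsCocycle _ (i + 1) α := by
  have := quotPowRes_projective m s i
  obtain ⟨β, rfl⟩ := Module.projective_lifting_property g γ hg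
  obtain ⟨α, hα⟩ := exists_factor_of_exact f g hf hfg
    (β ∘ₗ ((quotPowRes m s).complex.d (i + 1) i).hom) (by
      rw [← LinearMap.comp_assoc]; exact hγ)
  refine ⟨β, α, rfl, hα.symm, ?_⟩
  have h : f ∘ₗ (α ∘ₗ ((quotPowRes m s).complex.d (i + 1 + 1) (i + 1)).hom) = 0 := by
    rw [← LinearMap.comp_assoc, ← hα, LinearMap.comp_assoc, chain_d_comp_d, LinearMap.comp_zero]
  exact LinearMap.ext fun x => hf (by simpa using LinearMap.congr_fun h x)

lemma ExtVanishesBelow.middle {n : ℕ} (hA : ExtVanishesBelow m n A)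
    (hC : ExtVanishesBelow m n C) : ExtVanishesBelow m n B := by
  intro i hi s φ hφ
  obtain ⟨α, hα, hb⟩ := exists_cocycle_lift hf hg hfg φ hφ (hC i hi s _ (hφ.comp g))
  simpa using hb.add ((hA i hi s α hα).comp f)

include hgf

lemma IsCoboundary.of_comp_injective {n s : ℕ} (hC : ExtVanishesBelow m n C)
    (α : (quotPowRes m s).complex.X n →ₗ[R] A) (hb : IsCoboundary _ n (f ∘ₗ α)) :
    IsCoboundary _ n α := by
  rcases n with _ | j
  · rw [isCoboundary_zero_iff] at hb ⊢
    exact LinearMap.ext fun x => hf (by simpa using LinearMap.congr_fun hb x)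
  obtain ⟨ψ, hψ⟩ := isCoboundary_succ_iff.1 hb
  obtain ⟨χ, hχ⟩ := hC j (by omega) s (g ∘ₗ ψ) (by
    unfold IsCocycle
    rw [LinearMap.comp_assoc, ← hψ, ← LinearMap.comp_assoc, hgf, LinearMap.zero_comp])
  have := quotPowRes_projective m s (j - 1)
  obtain ⟨ω, rfl⟩ := Module.projective_lifting_property g χ hg
  obtain ⟨τ, hτ⟩ := exists_factor_of_exact f g hf hfg
    (ψ - ω ∘ₗ ((quotPowRes m s).complex.d j (j - 1)).hom) (by
      rw [LinearMap.comp_sub, hχ, LinearMap.comp_assoc, sub_self])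
  refine isCoboundary_succ_iff.2 ⟨τ, LinearMap.ext fun x => hf ?_⟩
  have h1 : f ∘ₗ (τ ∘ₗ ((quotPowRes m s).complex.d (j + 1) j).hom) = f ∘ₗ α := by
    rw [← LinearMap.comp_assoc, ← hτ, hψ, LinearMap.sub_comp, LinearMap.comp_assoc,
      chain_d_comp_d]; simp
  exact (LinearMap.congr_fun h1 x).symm

lemma ExtVanishesBelow.left {n : ℕ} (hB : ExtVanishesBelow m (n + 1) B)
    (hC : ExtVanishesBelow m n C) : ExtVanishesBelow m (n + 1) A := fun i hi s α hα =>
  IsCoboundary.of_comp_injective hf hg hgf hfg (hC.mono (by omega)) α (hB i hi s _ (hα.comp f))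

lemma ExtSurvives.middle {n : ℕ} (hC : ExtVanishesBelow m n C) (hA : ExtSurvives m n A) :
    ExtSurvives m n B := by
  obtain ⟨s, α, hα, hs⟩ := hA
  exact ⟨s, f ∘ₗ α, hα.comp f, fun s' h hb => hs s' h
    (IsCoboundary.of_comp_injective hf hg hgf hfg hC _ hb)⟩

lemma ExtSurvives.left {n : ℕ} (hB : ExtVanishesBelow m (n + 1) B) (hC : ExtSurvives m n C) :
    ExtSurvives m (n + 1) A := by
  obtain ⟨s, γ, hγ, hs⟩ := hC
  obtain ⟨β, α, rfl, hα, hαc⟩ := exists_connecting hf hg hfg γ hγ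
  refine ⟨s, α, hαc, fun s' h hb => hs s' h ?_⟩
  obtain ⟨ψ, hψ⟩ := isCoboundary_succ_iff.1 hb
  have h1 : IsCocycle _ n (β ∘ₗ ((quotPowResMap m h).f n).hom - f ∘ₗ ψ) := by
    unfold IsCocycle
    rw [LinearMap.sub_comp, LinearMap.comp_assoc, chainMap_comm, ← LinearMap.comp_assoc, ← hα,
      LinearMap.comp_assoc, LinearMap.comp_assoc, ← hψ, sub_self]
  have h2 := (hB n (by omega) s' _ h1).comp g
  rwa [LinearMap.comp_sub, ← LinearMap.comp_assoc, ← LinearMap.comp_assoc ψ f g, hgf,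
    LinearMap.zero_comp, sub_zero] at h2

end ShortExact

/-- If `v ∈ m` is `A`-regular, passing from `A` to `A ⧸ vA` lowers the vanishing range by at most
one. -/
lemma ExtVanishesBelow.of_regular {m : Ideal R} {A C : Type} [AddCommGroup A]
    [Module R A] [AddCommGroup C] [Module R C] {n : ℕ} {v : R} (hv : v ∈ m) {f : A →ₗ[R] A}
    {g : A →ₗ[R] C}
    (hf : Function.Injective f) (hg : Function.Surjective g) (hgf : g ∘ₗ f = 0)
    (hfg : ∀ b, g b = 0 → ∃ a, f a = b) (hfv : ∀ a, f a = v • a)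
    (hC : ExtVanishesBelow m n C) : ExtVanishesBelow m (n + 1) A := by
  intro i hi s α hα
  have key : ∀ t : ℕ, IsCoboundary _ i (v ^ t • α) → IsCoboundary _ i α := by
    intro t
    induction t with
    | zero => simp
    | succ t ih =>
      intro h
      refine ih (IsCoboundary.of_comp_injective hf hg hgf hfg (hC.mono (by omega)) _ ?_)
      convert h using 1
      ext x
      simp [hfv, pow_succ', mul_smul]
  exact key s (isCoboundary_pow_smul hv α hα)


lemma ExtSurvives.zero {m : Ideal R} {M : Type} [AddCommGroup M] [Module R M] (x : M) (hx : x ≠ 0)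
    (hm : ∀ r ∈ m, r • x = 0) : ExtSurvives m 0 M := by
  let e : (R ⧸ m ^ 1) →ₗ[R] M := Submodule.liftQ _ (LinearMap.toSpanSingleton R M x) (by
    rw [pow_one]
    exact fun r hr => hm r hr)
  refine ⟨1, e ∘ₗ quotPowAug m 1, ?_, fun s' h hb => hx ?_⟩
  · unfold IsCocycle
    rw [LinearMap.comp_assoc, quotPowAug_comp_d, LinearMap.comp_zero]
  · rw [isCoboundary_zero_iff, LinearMap.comp_assoc, quotPowAug_comp_map] at hb
    obtain ⟨p, hp⟩ := quotPowAug_surjective m s' (Submodule.Quotient.mk 1)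
    have := LinearMap.congr_fun hb p
    rw [LinearMap.comp_apply, LinearMap.comp_apply, hp] at this
    exact (one_smul R x).symm.trans this

section ExtBridge

variable (M : Type) [AddCommGroup M] [Module R M]

/-- The contravariant functor `Hom(-, M)`, valued in the opposite category. -/
noncomputable abbrev homToOp : ModuleCat.{0} R ⥤ (ModuleCat.{0} R)ᵒᵖ :=
  ((linearYoneda R (ModuleCat.{0} R)).obj (ModuleCat.of R M)).rightOp

/-- The complex `Hom(K, M)`, as a complex in the opposite category. -/
noncomputable abbrev homToOpComplex (K : ChainComplex (ModuleCat.{0} R) ℕ) :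
    ChainComplex (ModuleCat.{0} R)ᵒᵖ ℕ :=
  ((homToOp M).mapHomologicalComplex _).obj K

variable {M}

/-- A cochain viewed as a morphism to `R` in the opposite category. -/
noncomputable def cochainHom {K : ChainComplex (ModuleCat.{0} R) ℕ} {i : ℕ}
    (φ : K.X i →ₗ[R] M) : (homToOpComplex M K).X i ⟶ Opposite.op (ModuleCat.of R R) :=
  Quiver.Hom.op (X := ModuleCat.of R R)
    (ModuleCat.ofHom (LinearMap.toSpanSingleton R (K.X i ⟶ ModuleCat.of R M)
      (ModuleCat.ofHom φ)))

lemma chain_next (i : ℕ) : (ComplexShape.down ℕ).next i = i - 1 := by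
  cases i <;> simp

lemma cochainHom_injective {K : ChainComplex (ModuleCat.{0} R) ℕ} {i : ℕ}
    {φ φ' : K.X i →ₗ[R] M} (h : cochainHom φ = cochainHom φ') : φ = φ' := by
  have h1 := congrArg ModuleCat.Hom.hom (Quiver.Hom.op_inj h)
  have h2 := LinearMap.congr_fun h1 1
  have h3 : (1 : R) • (ModuleCat.ofHom φ) = (1 : R) • ModuleCat.ofHom φ' := h2
  rw [one_smul, one_smul] at h3
  exact congrArg ModuleCat.Hom.hom h3

lemma cochainHom_zero {K : ChainComplex (ModuleCat.{0} R) ℕ} {i : ℕ} :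
    cochainHom (0 : K.X i →ₗ[R] M) = 0 := by
  apply Quiver.Hom.unop_inj
  ext
  exact one_smul R (0 : K.X i ⟶ ModuleCat.of R M)

lemma map_comp_cochainHom {K L : ChainComplex (ModuleCat.{0} R) ℕ} {i j : ℕ}
    (φ : L.X i →ₗ[R] M) (f : K.X j ⟶ L.X i) :
    (homToOp M).map f ≫ cochainHom φ = cochainHom (φ ∘ₗ f.hom) := by
  apply Quiver.Hom.unop_inj
  ext
  rfl

lemma exists_eq_cochainHom {K : ChainComplex (ModuleCat.{0} R) ℕ} {i : ℕ}
    (χ : (homToOpComplex M K).X i ⟶ Opposite.op (ModuleCat.of R R)) :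
    ∃ φ : K.X i →ₗ[R] M, χ = cochainHom φ := by
  let x : K.X i ⟶ ModuleCat.of R M := χ.unop.hom (1 : R)
  refine ⟨x.hom, ?_⟩
  apply Quiver.Hom.unop_inj
  ext
  exact (one_smul R x).symm

lemma IsCocycle.d_comp_cochainHom {K : ChainComplex (ModuleCat.{0} R) ℕ} {i : ℕ}
    {φ : K.X i →ₗ[R] M} (h : IsCocycle K i φ) :
    (homToOpComplex M K).d (i + 1) i ≫ cochainHom φ = 0 :=
  (map_comp_cochainHom φ (K.d (i + 1) i)).trans ((congrArg cochainHom h).trans cochainHom_zero)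

/-- The functional on homology in the opposite category represented by a cocycle. -/
noncomputable def cocycleClass {K : ChainComplex (ModuleCat.{0} R) ℕ} {i : ℕ}
    (φ : K.X i →ₗ[R] M) (h : IsCocycle K i φ) :
    (homToOpComplex M K).homology i ⟶ Opposite.op (ModuleCat.of R R) :=
  (homToOpComplex M K).homologyι i ≫
    (homToOpComplex M K).descOpcycles (cochainHom φ) (i + 1) (by simp) h.d_comp_cochainHom

lemma homologyMap_comp_cocycleClass {K L : ChainComplex (ModuleCat.{0} R) ℕ} {i : ℕ}
    (φ : L.X i →ₗ[R] M) (h : IsCocycle L i φ) (f : K ⟶ L) :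
    HomologicalComplex.homologyMap (((homToOp M).mapHomologicalComplex _).map f) i ≫
      cocycleClass φ h = cocycleClass _ (h.comp_map f) := by
  unfold cocycleClass
  rw [HomologicalComplex.homologyι_naturality_assoc]
  congr 1
  rw [← cancel_epi (HomologicalComplex.pOpcycles _ _)]
  simp
  exact map_comp_cochainHom φ (f.f i)

lemma isCoboundary_of_cocycleClass_eq_zero {K : ChainComplex (ModuleCat.{0} R) ℕ} {i : ℕ}
    (φ : K.X i →ₗ[R] M) (h : IsCocycle K i φ) (h0 : cocycleClass φ h = 0) :
    IsCoboundary K i φ := by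
  have hker := (homToOpComplex M K).homologyIsKernel i (i - 1) (chain_next i)
  have hex := ShortComplex.exact_of_f_is_kernel
    (ShortComplex.mk ((homToOpComplex M K).homologyι i)
      ((homToOpComplex M K).fromOpcycles i (i - 1)) (by simp)) hker
  have : Injective (Opposite.op (ModuleCat.of R R)) := inferInstance
  obtain ⟨ψ, hψ⟩ := exists_eq_cochainHom (hex.descToInjective
    ((homToOpComplex M K).descOpcycles (cochainHom φ) (i + 1) (by simp) h.d_comp_cochainHom) h0)
  have h1 := hex.comp_descToInjective
    ((homToOpComplex M K).descOpcycles (cochainHom φ) (i + 1) (by simp) h.d_comp_cochainHom) h0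
  rw [hψ] at h1
  refine ⟨ψ, cochainHom_injective ?_⟩
  have h2 := congrArg ((homToOpComplex M K).pOpcycles i ≫ ·) h1
  simp at h2
  exact h2.symm.trans (map_comp_cochainHom ψ (K.d i (i - 1)))

lemma isZero_ext_of_vanishes {m : Ideal R} {i s : ℕ}
    (h : ∀ φ : (quotPowRes m s).complex.X i →ₗ[R] M, IsCocycle _ i φ → IsCoboundary _ i φ) :
    IsZero (((Ext R (ModuleCat.{0} R) i).obj
      (Opposite.op (ModuleCat.of R (R ⧸ m ^ s)))).obj (ModuleCat.of R M)) := by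
  refine IsZero.of_iso ?_ ((quotPowRes m s).isoExt i (ModuleCat.of R M))
  rw [← HomologicalComplex.exactAt_iff_isZero_homology,
    HomologicalComplex.exactAt_iff' _ (i - 1) i (i + 1) (by cases i <;> simp) (by simp),
    ShortComplex.moduleCat_exact_iff]
  intro x hx
  let φ : (quotPowRes m s).complex.X i ⟶ ModuleCat.of R M := x
  obtain ⟨ψ, hψ⟩ := h φ.hom (congrArg ModuleCat.Hom.hom hx)
  exact ⟨ModuleCat.ofHom ψ, (ModuleCat.hom_ext hψ).symm⟩

/-- The element of `Ext` represented by a cocycle. -/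
noncomputable def cocycleExt {m : Ideal R} {i s : ℕ}
    (φ : (quotPowRes m s).complex.X i →ₗ[R] M) (h : IsCocycle _ i φ) :
    ((Ext R (ModuleCat.{0} R) i).obj
      (Opposite.op (ModuleCat.of R (R ⧸ m ^ s)))).obj (ModuleCat.of R M) :=
  (((quotPowRes m s).isoLeftDerivedObj (homToOp M) i).hom ≫ cocycleClass φ h).unop.hom (1 : R)

lemma isCoboundary_of_cocycleExt_eq_zero {m : Ideal R} {i s : ℕ}
    (φ : (quotPowRes m s).complex.X i →ₗ[R] M) (h : IsCocycle _ i φ)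
    (h0 : cocycleExt φ h = 0) : IsCoboundary _ i φ := by
  refine isCoboundary_of_cocycleClass_eq_zero φ h ?_
  refine (cancel_epi ((quotPowRes m s).isoLeftDerivedObj (homToOp M) i).hom).1 ?_
  refine Eq.trans ?_ comp_zero.symm
  apply Quiver.Hom.unop_inj
  ext
  exact h0

lemma ext_map_cocycleExt {m : Ideal R} {i s s' : ℕ} (hs : s ≤ s')
    (φ : (quotPowRes m s).complex.X i →ₗ[R] M) (h : IsCocycle _ i φ) :
    (((Ext R (ModuleCat.{0} R) i).map (Quiver.Hom.op (ModuleCat.ofHom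
      (Submodule.mapQ (m ^ s') (m ^ s) LinearMap.id (Ideal.pow_le_pow_right hs))))).app
        (ModuleCat.of R M)).hom (cocycleExt φ h) =
      cocycleExt _ (h.comp_map (quotPowResMap m hs)) := by
  have h1 := ProjectiveResolution.isoLeftDerivedObj_hom_naturality (ModuleCat.ofHom
      (Submodule.mapQ (m ^ s') (m ^ s) LinearMap.id (Ideal.pow_le_pow_right hs)))
      (quotPowRes m s') (quotPowRes m s) (quotPowResMap m hs)
      (ProjectiveResolution.lift_commutes_zero _ _ _) (homToOp M) i
  have h2 := congrArg (· ≫ cocycleClass φ h) h1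
  have h3 := homologyMap_comp_cocycleClass φ h (quotPowResMap m hs)
  have h4 := ((Category.assoc _ _ _).symm.trans (h2.trans (Category.assoc _ _ _))).trans (congrArg
    (((quotPowRes m s').isoLeftDerivedObj (homToOp M) i).hom ≫ ·) h3)
  have h5 := congrArg (fun z => (Quiver.Hom.unop
    (Y := Opposite.op (ModuleCat.of R R)) z).hom (1 : R)) h4
  exact h5

end ExtBridge

lemma not_nontrivial_localCohomology {m : Ideal R} {M : Type} [AddCommGroup M] [Module R M]
    {n i : ℕ} (h : ExtVanishesBelow m n M) (hi : i < n) :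
    ¬ Nontrivial ((localCohomology m i).obj (ModuleCat.of R M)) := by
  rw [not_nontrivial_iff_subsingleton]
  have hz : IsZero ((localCohomology m i).obj (ModuleCat.of R M)) := by
    refine IsZero.of_iso ?_ (colimitObjIsoColimitCompEvaluation
      (localCohomology.diagram (localCohomology.idealPowersDiagram m) i) (ModuleCat.of R M))
    rw [IsZero.iff_id_eq_zero]
    refine colimit.hom_ext fun j => ?_
    refine IsZero.eq_of_src ?_ _ _
    exact isZero_ext_of_vanishes (h i hi j.unop.unop)
  exact ModuleCat.subsingleton_of_isZero hz

lemma nontrivial_localCohomology {m : Ideal R} {M : Type} [AddCommGroup M] [Module R M]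
    {i : ℕ} (h : ExtSurvives m i M) :
    Nontrivial ((localCohomology m i).obj (ModuleCat.of R M)) := by
  obtain ⟨s, φ, hφ, hs⟩ := h
  let D := localCohomology.diagram (localCohomology.idealPowersDiagram m) i ⋙
    (evaluation _ _).obj (ModuleCat.of R M)
  let e : (localCohomology m i).obj (ModuleCat.of R M) ≅ colimit D :=
    colimitObjIsoColimitCompEvaluation
      (localCohomology.diagram (localCohomology.idealPowersDiagram m) i) (ModuleCat.of R M)
  have : Nontrivial (colimit D : ModuleCat.{0} R) := by
    refine ⟨(colimit.ι D (Opposite.op (Opposite.op s))).hom (cocycleExt φ hφ), 0, fun h0 => ?_⟩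
    obtain ⟨j, f, hj⟩ := Concrete.colimit_rep_eq_zero R D _ _ h0
    have hle : s ≤ j.unop.unop := f.unop.unop.down.down
    refine hs j.unop.unop hle (isCoboundary_of_cocycleExt_eq_zero _ (hφ.comp_map _) ?_)
    rw [← ext_map_cocycleExt hle φ hφ]
    exact hj
  exact e.toLinearEquiv.toEquiv.nontrivial

end LocalCohomologyCochains

lemma depthQuot_eq {k : Type} [Field k] {V : Type} {I : Ideal (MvPolynomial V k)} {n : ℕ}
    (h : ExtVanishesBelow (maxHomIdeal k V) n (MvPolynomial V k ⧸ I))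
    (h' : ExtSurvives (maxHomIdeal k V) n (MvPolynomial V k ⧸ I)) : depthQuot k I = n := by
  refine le_antisymm (Nat.sInf_le (nontrivial_localCohomology h')) ?_
  refine le_csInf ⟨n, nontrivial_localCohomology h'⟩ fun i hi => ?_
  by_contra! hlt
  exact not_nontrivial_localCohomology h hlt hi

section MonomialIdeals

variable {k : Type} [Field k] {V : Type}

/-- The ideal spanned by the monomials with exponents in `U`. -/
noncomputable def monoIdeal (k : Type) [Field k] {V : Type} (U : Set (V →₀ ℕ)) :
    Ideal (MvPolynomial V k) :=
  Ideal.span ((fun s => monomial s 1) '' U)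

lemma mem_monoIdeal {U : Set (V →₀ ℕ)} (hU : IsUpperSet U) {p : MvPolynomial V k} :
    p ∈ monoIdeal k U ↔ ∀ m ∈ p.support, m ∈ U := by
  rw [monoIdeal, mem_ideal_span_monomial_image]
  exact ⟨fun h m hm => let ⟨s, hs, hsm⟩ := h m hm; hU hsm hs, fun h m hm => ⟨m, h m hm, le_rfl⟩⟩

lemma isUpperSet_shift {U : Set (V →₀ ℕ)} (hU : IsUpperSet U) (f : V →₀ ℕ) :
    IsUpperSet {m | m + f ∈ U} :=
  fun _ _ h hm => hU (by gcongr) hm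

lemma monomial_mul_mem_monoIdeal {U : Set (V →₀ ℕ)} (hU : IsUpperSet U) (f : V →₀ ℕ)
    (p : MvPolynomial V k) :
    monomial f 1 * p ∈ monoIdeal k U ↔ p ∈ monoIdeal k {m | m + f ∈ U} := by
  rw [mem_monoIdeal hU, mem_monoIdeal (isUpperSet_shift hU f)]
  constructor
  · intro h m hm
    refine h (m + f) ?_
    rw [mem_support_iff, add_comm, coeff_monomial_mul, one_mul]
    exact mem_support_iff.1 hm
  · intro h m hm
    rw [mem_support_iff, coeff_monomial_mul', one_mul] at hm
    split_ifs at hm with hfm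
    · have := h (m - f) (mem_support_iff.2 hm)
      rwa [Set.mem_ofPred_eq, tsub_add_cancel_of_le hfm] at this
    · exact absurd rfl hm

lemma mem_monoIdeal_union_iff {U : Set (V →₀ ℕ)} (hU : IsUpperSet U) (f : V →₀ ℕ)
    (p : MvPolynomial V k) :
    p ∈ monoIdeal k (U ∪ {m | f ≤ m}) ↔ ∃ q, p - monomial f 1 * q ∈ monoIdeal k U := by
  have hU' : IsUpperSet (U ∪ {m | f ≤ m}) := hU.union fun _ _ h hm => le_trans hm h
  constructor
  · intro h
    refine ⟨p.divMonomial f, ?_⟩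
    have h1 : p - monomial f 1 * (p.divMonomial f) = p.modMonomial f := by
      rw [sub_eq_iff_eq_add', divMonomial_add_modMonomial]
    rw [h1, mem_monoIdeal hU]
    intro m hm
    rw [mem_support_iff] at hm
    by_cases hfm : f ≤ m
    · exact absurd (coeff_modMonomial_of_le p hfm) hm
    · rw [coeff_modMonomial_of_not_le _ hfm] at hm
      exact (((mem_monoIdeal hU').1 h) m (mem_support_iff.2 hm)).resolve_right hfm
  · rintro ⟨q, hq⟩
    rw [← sub_add_cancel p (monomial f 1 * q)]
    refine Ideal.add_mem _ (Ideal.span_mono (Set.image_mono Set.subset_union_left) hq)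
      (Ideal.mul_mem_right _ _ (Ideal.subset_span ⟨f, Or.inr (le_refl f), rfl⟩))

/-- `H^i` of `S ⧸ J_U` vanishes for `i < n`. -/
def MonoVanishes (k : Type) [Field k] {V : Type} (n : ℕ) (U : Set (V →₀ ℕ)) : Prop :=
  ExtVanishesBelow (maxHomIdeal k V) n (MvPolynomial V k ⧸ monoIdeal k U)

/-- `H^n` of `S ⧸ J_U` does not vanish. -/
def MonoSurvives (k : Type) [Field k] {V : Type} (n : ℕ) (U : Set (V →₀ ℕ)) : Prop :=
  ExtSurvives (maxHomIdeal k V) n (MvPolynomial V k ⧸ monoIdeal k U)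

lemma MonoVanishes.mono {n n' : ℕ} {U : Set (V →₀ ℕ)} (h : MonoVanishes k n U) (hn : n' ≤ n) :
    MonoVanishes k n' U :=
  ExtVanishesBelow.mono h hn

lemma monoVanishes_zero (U : Set (V →₀ ℕ)) : MonoVanishes k 0 U :=
  fun i hi => absurd hi (by omega)

section ColonSequence

variable {S : Type} [CommRing S] {A J C : Ideal S} {r : S}

/-- Multiplication by `r` as a map `S ⧸ (J : r) → S ⧸ J`. -/
noncomputable def colonMul (r : S) (hA : ∀ p, r * p ∈ J ↔ p ∈ A) : (S ⧸ A) →ₗ[S] (S ⧸ J) :=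
  Submodule.mapQ A J (LinearMap.mulLeft S r) fun p hp => (hA p).2 hp

/-- The projection `S ⧸ J → S ⧸ (J + r)`. -/
noncomputable def colonProj (hC : ∀ p, p ∈ C ↔ ∃ q, p - r * q ∈ J) : (S ⧸ J) →ₗ[S] (S ⧸ C) :=
  Submodule.mapQ J C LinearMap.id fun p hp => (hC p).2 ⟨0, by simpa using hp⟩

variable (hA : ∀ p, r * p ∈ J ↔ p ∈ A) (hC : ∀ p, p ∈ C ↔ ∃ q, p - r * q ∈ J)

lemma colonMul_injective : Function.Injective (colonMul r hA) := by
  rw [injective_iff_map_eq_zero]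
  intro x
  obtain ⟨p, rfl⟩ := Submodule.Quotient.mk_surjective _ x
  intro h
  exact (Submodule.Quotient.mk_eq_zero _).2
    ((hA p).1 ((Submodule.Quotient.mk_eq_zero J (x := r * p)).1 h))

lemma colonProj_surjective : Function.Surjective (colonProj hC) := by
  intro x
  obtain ⟨p, rfl⟩ := Submodule.Quotient.mk_surjective _ x
  exact ⟨Submodule.Quotient.mk p, rfl⟩

lemma colonProj_comp_colonMul : colonProj hC ∘ₗ colonMul r hA = 0 := by
  refine LinearMap.ext fun x => ?_
  obtain ⟨p, rfl⟩ := Submodule.Quotient.mk_surjective _ x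
  exact (Submodule.Quotient.mk_eq_zero C (x := r * p)).2 ((hC _).2 ⟨p, by simp⟩)

lemma colon_exact (b : S ⧸ J) (hb : colonProj hC b = 0) : ∃ a, colonMul r hA a = b := by
  obtain ⟨p, rfl⟩ := Submodule.Quotient.mk_surjective _ b
  obtain ⟨q, hq⟩ := (hC p).1 ((Submodule.Quotient.mk_eq_zero C (x := p)).1 hb)
  refine ⟨Submodule.Quotient.mk q, Eq.symm ?_⟩
  exact (Submodule.Quotient.eq J).2 hq

end ColonSequence

section Rules

variable {n : ℕ} {U U' U'' : Set (V →₀ ℕ)}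

lemma MonoVanishes.of_colon (hU : IsUpperSet U) (f : V →₀ ℕ) (h' : ∀ m, m ∈ U' ↔ m + f ∈ U)
    (h'' : ∀ m, m ∈ U'' ↔ m ∈ U ∨ f ≤ m) (h1 : MonoVanishes k n U')
    (h2 : MonoVanishes k n U'') : MonoVanishes k n U := by
  obtain rfl : U' = {m | m + f ∈ U} := Set.ext h'
  obtain rfl : U'' = U ∪ {m | f ≤ m} := Set.ext h''
  exact ExtVanishesBelow.middle (colonMul_injective (monomial_mul_mem_monoIdeal hU f))
    (colonProj_surjective (mem_monoIdeal_union_iff hU f)) (colon_exact _ _) h1 h2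

lemma MonoSurvives.of_colon (hU : IsUpperSet U) (f : V →₀ ℕ) (h' : ∀ m, m ∈ U' ↔ m + f ∈ U)
    (h'' : ∀ m, m ∈ U'' ↔ m ∈ U ∨ f ≤ m) (h1 : MonoSurvives k n U')
    (h2 : MonoVanishes k n U'') : MonoSurvives k n U := by
  obtain rfl : U' = {m | m + f ∈ U} := Set.ext h'
  obtain rfl : U'' = U ∪ {m | f ≤ m} := Set.ext h''
  exact ExtSurvives.middle (colonMul_injective (monomial_mul_mem_monoIdeal hU f))
    (colonProj_surjective (mem_monoIdeal_union_iff hU f)) (colonProj_comp_colonMul _ _)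
    (colon_exact _ _) h2 h1

lemma single_le_iff_one_le (v : V) (m : V →₀ ℕ) : Finsupp.single v 1 ≤ m ↔ 1 ≤ m v := by
  simp

lemma MonoVanishes.of_free_var (hU : IsUpperSet U) (v : V)
    (hv : ∀ m, m + Finsupp.single v 1 ∈ U → m ∈ U) (h'' : ∀ m, m ∈ U'' ↔ m ∈ U ∨ 1 ≤ m v)
    (h : MonoVanishes k n U'') : MonoVanishes k (n + 1) U := by
  obtain rfl : U'' = U ∪ {m | Finsupp.single v 1 ≤ m} :=
    Set.ext fun m => by simp [h'']
  have h1 : {m | m + Finsupp.single v 1 ∈ U} = U :=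
    Set.ext fun m => ⟨hv m, fun hm => hU le_self_add hm⟩
  have h2 := monomial_mul_mem_monoIdeal (k := k) hU (Finsupp.single v 1)
  rw [h1] at h2
  refine ExtVanishesBelow.of_regular (v := X v) (Ideal.subset_span ⟨v, rfl⟩)
    (colonMul_injective h2) (colonProj_surjective (mem_monoIdeal_union_iff hU _))
    (colonProj_comp_colonMul _ _) (colon_exact _ _) (fun a => ?_) h
  obtain ⟨p, rfl⟩ := Submodule.Quotient.mk_surjective _ a
  rfl

lemma MonoSurvives.of_free_var (hU : IsUpperSet U) (v : V)
    (hv : ∀ m, m + Finsupp.single v 1 ∈ U → m ∈ U) (h'' : ∀ m, m ∈ U'' ↔ m ∈ U ∨ 1 ≤ m v)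
    (hn : MonoVanishes k (n + 1) U) (h : MonoSurvives k n U'') : MonoSurvives k (n + 1) U := by
  obtain rfl : U'' = U ∪ {m | Finsupp.single v 1 ≤ m} :=
    Set.ext fun m => by simp [h'']
  have h1 : {m | m + Finsupp.single v 1 ∈ U} = U :=
    Set.ext fun m => ⟨hv m, fun hm => hU le_self_add hm⟩
  have h2 := monomial_mul_mem_monoIdeal (k := k) hU (Finsupp.single v 1)
  rw [h1] at h2
  exact ExtSurvives.left
    (colonMul_injective h2) (colonProj_surjective (mem_monoIdeal_union_iff hU _))
    (colonProj_comp_colonMul _ _) (colon_exact _ _) hn h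

lemma monoIdeal_inter (hU : IsUpperSet U) (hU' : IsUpperSet U') :
    monoIdeal k (U ∩ U') = monoIdeal k U ⊓ monoIdeal k U' := by
  ext p
  rw [Ideal.mem_inf, mem_monoIdeal hU, mem_monoIdeal hU', mem_monoIdeal (hU.inter hU')]
  exact ⟨fun h => ⟨fun m hm => (h m hm).1, fun m hm => (h m hm).2⟩,
    fun h m hm => ⟨h.1 m hm, h.2 m hm⟩⟩

lemma monoIdeal_union : monoIdeal k (U ∪ U') = monoIdeal k U ⊔ monoIdeal k U' := by
  rw [monoIdeal, Set.image_union, Ideal.span_union]; rfl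

lemma ExtVanishesBelow.prod {R : Type} [CommRing R] {m : Ideal R} {A B : Type} [AddCommGroup A]
    [Module R A] [AddCommGroup B] [Module R B] {n : ℕ} (hA : ExtVanishesBelow m n A)
    (hB : ExtVanishesBelow m n B) : ExtVanishesBelow m n (A × B) :=
  ExtVanishesBelow.middle (f := LinearMap.inl R A B) (g := LinearMap.snd R A B)
    LinearMap.inl_injective LinearMap.snd_surjective
    (fun b hb => ⟨b.1, Prod.ext rfl hb.symm⟩) hA hB

section MayerVietoris

variable {S : Type} [CommRing S] (I J : Ideal S)

/-- The diagonal map `S ⧸ (I ∩ J) → S ⧸ I × S ⧸ J`. -/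
noncomputable def mvDiag : (S ⧸ (I ⊓ J)) →ₗ[S] (S ⧸ I) × (S ⧸ J) :=
  (Submodule.mapQ (I ⊓ J) I LinearMap.id inf_le_left).prod
    (Submodule.mapQ (I ⊓ J) J LinearMap.id inf_le_right)

/-- The difference map `S ⧸ I × S ⧸ J → S ⧸ (I + J)`. -/
noncomputable def mvDiff : ((S ⧸ I) × (S ⧸ J)) →ₗ[S] (S ⧸ (I ⊔ J)) :=
  (Submodule.mapQ I (I ⊔ J) LinearMap.id le_sup_left) ∘ₗ LinearMap.fst S _ _ -
    (Submodule.mapQ J (I ⊔ J) LinearMap.id le_sup_right) ∘ₗ LinearMap.snd S _ _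

lemma mvDiag_injective : Function.Injective (mvDiag I J) := by
  rw [injective_iff_map_eq_zero]
  intro x
  obtain ⟨p, rfl⟩ := Submodule.Quotient.mk_surjective _ x
  intro h
  exact (Submodule.Quotient.mk_eq_zero _).2
    ⟨(Submodule.Quotient.mk_eq_zero I (x := p)).1 (congrArg Prod.fst h),
      (Submodule.Quotient.mk_eq_zero J (x := p)).1 (congrArg Prod.snd h)⟩

lemma mvDiff_surjective : Function.Surjective (mvDiff I J) := by
  intro x
  obtain ⟨p, rfl⟩ := Submodule.Quotient.mk_surjective _ x
  exact ⟨(Submodule.Quotient.mk p, 0), by simp [mvDiff]⟩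

lemma mvDiff_comp_mvDiag : mvDiff I J ∘ₗ mvDiag I J = 0 := by
  refine LinearMap.ext fun x => ?_
  obtain ⟨p, rfl⟩ := Submodule.Quotient.mk_surjective _ x
  exact sub_self (Submodule.Quotient.mk p : S ⧸ (I ⊔ J))

lemma mv_exact (b : (S ⧸ I) × (S ⧸ J)) (hb : mvDiff I J b = 0) : ∃ a, mvDiag I J a = b := by
  obtain ⟨x, y⟩ := b
  obtain ⟨p, rfl⟩ := Submodule.Quotient.mk_surjective _ x
  obtain ⟨q, rfl⟩ := Submodule.Quotient.mk_surjective _ y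
  obtain ⟨i, hi, j, hj, hij⟩ := Submodule.mem_sup.1
    ((Submodule.Quotient.mk_eq_zero (I ⊔ J) (x := p - q)).1 hb)
  refine ⟨Submodule.Quotient.mk (p - i), Prod.ext ?_ ?_⟩
  · refine (Submodule.Quotient.eq I).2 ?_
    simpa using hi
  · refine (Submodule.Quotient.eq J).2 ?_
    have : p - i - q = j := by rw [sub_right_comm, ← hij]; ring
    change p - i - q ∈ J
    rwa [this]

end MayerVietoris

lemma MonoVanishes.inter (hU : IsUpperSet U) (hU' : IsUpperSet U')
    (h : MonoVanishes k (n + 1) U) (h' : MonoVanishes k (n + 1) U')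
    (h2 : MonoVanishes k n (U ∪ U')) : MonoVanishes k (n + 1) (U ∩ U') := by
  unfold MonoVanishes at *
  rw [monoIdeal_inter hU hU']
  rw [monoIdeal_union] at h2
  exact ExtVanishesBelow.left (mvDiag_injective _ _) (mvDiff_surjective _ _)
    (mvDiff_comp_mvDiag _ _) (mv_exact _ _) (h.prod h') h2

lemma MonoSurvives.inter (hU : IsUpperSet U) (hU' : IsUpperSet U')
    (h : MonoVanishes k (n + 1) U) (h' : MonoVanishes k (n + 1) U')
    (h2 : MonoSurvives k n (U ∪ U')) : MonoSurvives k (n + 1) (U ∩ U') := by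
  unfold MonoVanishes at *
  unfold MonoSurvives at *
  rw [monoIdeal_inter hU hU']
  rw [monoIdeal_union] at h2
  exact ExtSurvives.left (mvDiag_injective _ _) (mvDiff_surjective _ _)
    (mvDiff_comp_mvDiag _ _) (mv_exact _ _) (h.prod h') h2

/-- A socle monomial gives nonzero zeroth local cohomology. -/
lemma monoSurvives_zero (hU : IsUpperSet U) (f : V →₀ ℕ) (hf : f ∉ U)
    (h : ∀ v, f + Finsupp.single v 1 ∈ U) : MonoSurvives k 0 U := by
  refine ExtSurvives.zero (Submodule.Quotient.mk (monomial f 1)) ?_ ?_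
  · rw [Ne, Submodule.Quotient.mk_eq_zero, mem_monoIdeal hU]
    intro h
    exact hf (h f (by classical simp))
  · intro r hr
    refine (Submodule.Quotient.mk_eq_zero _ (x := r * monomial f 1)).2 ?_
    induction hr using Submodule.span_induction with
    | mem x hx =>
      obtain ⟨v, rfl⟩ := hx
      rw [X, monomial_mul, one_mul, add_comm]
      exact Ideal.subset_span ⟨_, h v, rfl⟩
    | zero => simp
    | add x y _ _ hx hy => rw [add_mul]; exact Ideal.add_mem _ hx hy
    | smul a x _ hx => rw [smul_eq_mul, mul_assoc]; exact Ideal.mul_mem_left _ _ hx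

/-- If every successive colon ideal vanishes below `n`, so does the base of the filtration. -/
lemma MonoVanishes.of_filtration (hU : IsUpperSet U) (G : Finset (V →₀ ℕ))
    (h : MonoVanishes k n {m | m ∈ U ∨ ∃ g ∈ G, g ≤ m})
    (hc : ∀ F ⊆ G, ∀ g ∈ G, g ∉ F →
      MonoVanishes k n {m | m + g ∈ U ∨ ∃ f ∈ F, f ≤ m + g}) : MonoVanishes k n U := by
  classical
  induction G using Finset.induction_on with
  | empty => simpa using h
  | insert g G hg ih =>
    refine ih (MonoVanishes.of_colon ?_ g (fun m => Iff.rfl) (fun m => ?_)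
      (hc G (Finset.subset_insert _ _) g (Finset.mem_insert_self _ _) hg) h)
      fun F hF g' hg' =>
        hc F (hF.trans (Finset.subset_insert _ _)) g' (Finset.mem_insert_of_mem hg')
    · rintro a b hab (ha | ⟨g, hg, hga⟩)
      · exact Or.inl (hU hab ha)
      · exact Or.inr ⟨g, hg, hga.trans hab⟩
    · simp only [Set.mem_ofPred_eq, Finset.mem_insert, exists_eq_or_imp]
      rw [or_comm (a := g ≤ m), or_assoc]

end Rules

/-- Membership in `U` does not depend on the variables in `W`. -/
def FreeOn (W : Finset V) (U : Set (V →₀ ℕ)) : Prop :=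
  ∀ m m' : V →₀ ℕ, (∀ v, v ∉ W → m v ≤ m' v) → m ∈ U → m' ∈ U

lemma FreeOn.isUpperSet {W : Finset V} {U : Set (V →₀ ℕ)} (h : FreeOn W U) : IsUpperSet U :=
  fun _ _ hm => h _ _ fun v _ => hm v

lemma FreeOn.monoVanishes {W : Finset V} {U : Set (V →₀ ℕ)} (h : FreeOn W U) :
    MonoVanishes k W.card U := by
  classical
  induction W using Finset.induction_on generalizing U with
  | empty => exact monoVanishes_zero U
  | insert v W hv ih =>
    rw [Finset.card_insert_of_notMem hv]
    refine MonoVanishes.of_free_var (U'' := {m | m ∈ U ∨ 1 ≤ m v}) h.isUpperSet v ?_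
      (fun _ => Iff.rfl) (ih ?_)
    · refine fun m => h _ _ fun w hw => ?_
      have : v ≠ w := by rintro rfl; exact hw (Finset.mem_insert_self _ _)
      simp [this]
    · rintro m m' hm (hm1 | hm1)
      · by_cases hv' : 1 ≤ m v
        · exact Or.inr (hv'.trans (hm v hv))
        · refine Or.inl (h m m' (fun w hw => hm w fun h' => hw (Finset.mem_insert_of_mem h')) hm1)
      · exact Or.inr (hm1.trans (hm v hv))

lemma monoSurvives_vars (W : Finset V) :
    MonoSurvives k W.card {m | ∃ v, v ∉ W ∧ 1 ≤ m v} := by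
  classical
  induction W using Finset.induction_on with
  | empty =>
    refine monoSurvives_zero ?_ 0 (by simp) fun v => ⟨v, by simp, by simp⟩
    rintro a b hab ⟨v, hv, h⟩
    exact ⟨v, hv, h.trans (hab v)⟩
  | insert v W hv ih =>
    have hfree : FreeOn (insert v W) {m : V →₀ ℕ | ∃ v', v' ∉ insert v W ∧ 1 ≤ m v'} := by
      rintro m m' hm ⟨w, hw, h⟩
      exact ⟨w, hw, h.trans (hm w hw)⟩
    have hvan := hfree.monoVanishes (k := k)
    rw [Finset.card_insert_of_notMem hv] at hvan ⊢
    refine MonoSurvives.of_free_var hfree.isUpperSet v ?_ (fun m => ?_) hvan ih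
    · refine fun m => hfree _ _ fun w hw => ?_
      have : v ≠ w := by rintro rfl; exact hw (Finset.mem_insert_self _ _)
      simp [this]
    · simp only [Set.mem_ofPred_eq, Finset.mem_insert, not_or]
      constructor
      · rintro ⟨w, hw, h⟩
        by_cases hwv : w = v
        · subst hwv; exact Or.inr h
        · exact Or.inl ⟨w, ⟨hwv, hw⟩, h⟩
      · rintro (⟨w, hw, h⟩ | h)
        · exact ⟨w, hw.2, h⟩
        · exact ⟨v, hv, h⟩

end MonomialIdeals

section BipartitePosets

open Finset

variable {k : Type} [Field k] {ι : Type} {R : ι → ι → Prop}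

lemma MonoVanishes.of_poset [LinearOrder ι] (hrefl : ∀ i, R i i)
    (htrans : ∀ i j l, R i j → R j l → R i l)
    (hle : ∀ i j, R i j → i ≤ j) (B P Q : Finset ι) (U U' : Set (ι ⊕ ι →₀ ℕ))
    (hP : Disjoint P B) (hQ : Disjoint Q B) (hU : FreeOn ((P ∪ B).disjSum (Q ∪ B)) U)
    (hU' : ∀ m, m ∈ U' ↔ m ∈ U ∨
      ∃ i ∈ B, ∃ j ∈ B, R i j ∧ 1 ≤ m (Sum.inl i) ∧ 1 ≤ m (Sum.inr j)) :
    MonoVanishes k (P.card + Q.card + B.card) U' := by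
  classical
  induction hn : B.card using Nat.strong_induction_on generalizing B P Q U U' with
  | _ n ih =>
  subst hn
  rcases B.eq_empty_or_nonempty with rfl | hB
  · obtain rfl : U' = U := Set.ext fun m => by simp [hU']
    simpa using hU.monoVanishes (k := k)
  set b := B.min' hB with hb
  have hbB : b ∈ B := B.min'_mem hB
  have hbmin : ∀ i ∈ B, b ≤ i := fun i hi => B.min'_le i hi
  have hbP : b ∉ P := fun h => disjoint_left.1 hP h hbB
  have hbQ : b ∉ Q := fun h => disjoint_left.1 hQ h hbB
  have hup : IsUpperSet U' := by
    intro m m' hm h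
    rw [hU'] at h ⊢
    rcases h with h | ⟨i, hi, j, hj, hij, h1, h2⟩
    · exact Or.inl (hU.isUpperSet hm h)
    · exact Or.inr ⟨i, hi, j, hj, hij, h1.trans (hm _), h2.trans (hm _)⟩
  have hUb : ∀ m, m + Finsupp.single (Sum.inl b) 1 ∈ U ↔ m ∈ U := by
    refine fun m => ⟨hU _ _ fun v hv => ?_, hU.isUpperSet le_self_add⟩
    have : Sum.inl b ≠ v := by
      rintro rfl
      exact hv (by simp [hbB])
    simp [this]
  refine MonoVanishes.of_colon hup (Finsupp.single (Sum.inl b) 1)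
    (U' := {m | m + Finsupp.single (Sum.inl b) 1 ∈ U'})
    (U'' := {m | m ∈ U' ∨ Finsupp.single (Sum.inl b) 1 ≤ m}) (fun _ => Iff.rfl)
    (fun _ => Iff.rfl) ?_ ?_
  · have h := ih (B.filter fun j => ¬ R b j).card
      (card_lt_card (filter_ssubset.2 ⟨b, hbB, by simp [hrefl]⟩))
      (B.filter fun j => ¬ R b j) (P ∪ B.filter fun j => R b j) Q
      {m | m ∈ U ∨ ∃ j ∈ B, R b j ∧ 1 ≤ m (Sum.inr j)}
      {m | m + Finsupp.single (Sum.inl b) 1 ∈ U'} ?_ ?_ ?_ ?_ rfl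
    · have h1 : (P ∪ B.filter fun j => R b j).card = P.card + (B.filter fun j => R b j).card :=
        card_union_of_disjoint (hP.mono_right (filter_subset _ _))
      have h2 := card_filter_add_card_filter_not (s := B) (fun j => R b j)
      refine h.mono ?_
      omega
    · rw [disjoint_union_left]
      exact ⟨hP.mono_right (filter_subset _ _), disjoint_filter_filter_not _ _ _⟩
    · exact hQ.mono_right (filter_subset _ _)
    · rintro m m' hm (h | ⟨j, hj, hbj, h⟩)
      · refine Or.inl (hU m m' (fun v hv => hm v ?_) h)
        rcases v with v | v <;> simp at hv ⊢ <;> tauto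
      · refine Or.inr ⟨j, hj, hbj, h.trans (hm _ ?_)⟩
        have := disjoint_right.1 hQ hj
        simp [this, hbj]
    · intro m
      simp only [Set.mem_ofPred_eq, hU', hUb, mem_filter, Finsupp.add_apply]
      constructor
      · rintro (h | ⟨i, hi, j, hj, hij, h1, h2⟩)
        · exact Or.inl (Or.inl h)
        · simp only [Finsupp.single_apply, reduceCtorEq, if_false, add_zero] at h2
          by_cases hbj : R b j
          · exact Or.inl (Or.inr ⟨j, hj, hbj, h2⟩)
          · have hbi : ¬ R b i := fun h => hbj (htrans _ _ _ h hij)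
            have hne : b ≠ i := by rintro h; exact hbi (h ▸ hrefl b)
            simp [hne] at h1
            exact Or.inr ⟨i, ⟨hi, hbi⟩, j, ⟨hj, hbj⟩, hij, h1, h2⟩
      · rintro ((h | ⟨j, hj, hbj, h⟩) | ⟨i, hi, j, hj, hij, h1, h2⟩)
        · exact Or.inl h
        · exact Or.inr ⟨b, hbB, j, hj, hbj, by simp, by simp; omega⟩
        · exact Or.inr ⟨i, hi.1, j, hj.1, hij, by omega, by omega⟩
  · have h := ih (B.erase b).card (card_erase_lt_of_mem hbB) (B.erase b) P (insert b Q)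
      {m | m ∈ U ∨ 1 ≤ m (Sum.inl b)}
      {m | m ∈ U' ∨ Finsupp.single (Sum.inl b) 1 ≤ m} ?_ ?_ ?_ ?_ rfl
    · have h1 := card_erase_add_one hbB
      rw [card_insert_of_notMem hbQ] at h
      refine h.mono ?_
      omega
    · exact hP.mono_right (erase_subset _ _)
    · rw [disjoint_insert_left]
      exact ⟨notMem_erase _ _, hQ.mono_right (erase_subset _ _)⟩
    · rintro m m' hm (h | h)
      · by_cases hmb : 1 ≤ m (Sum.inl b)
        · exact Or.inr (hmb.trans (hm _ (by simp [hbP])))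
        · refine Or.inl (hU m m' (fun v hv => hm v ?_) h)
          rcases v with v | v <;> simp at hv ⊢ <;> grind
      · exact Or.inr (h.trans (hm _ (by simp [hbP])))
    · intro m
      simp only [Set.mem_ofPred_eq, hU', single_le_iff_one_le, mem_erase]
      constructor
      · rintro ((h | ⟨i, hi, j, hj, hij, h1, h2⟩) | h)
        · exact Or.inl (Or.inl h)
        · by_cases hib : i = b
          · subst hib
            exact Or.inl (Or.inr h1)
          · have hjb : j ≠ b := by
              rintro rfl
              exact hib (le_antisymm (hle _ _ hij) (hbmin i hi))
            exact Or.inr ⟨i, ⟨hib, hi⟩, j, ⟨hjb, hj⟩, hij, h1, h2⟩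
        · exact Or.inl (Or.inr h)
      · rintro ((h | h) | ⟨i, hi, j, hj, hij, h1, h2⟩)
        · exact Or.inl (Or.inl h)
        · exact Or.inr h
        · exact Or.inl (Or.inr ⟨i, hi.2, j, hj.2, hij, h1, h2⟩)

/-- The exponent of the monomial `x_i y_j`. -/
noncomputable def edgeExp (i j : ι) : ι ⊕ ι →₀ ℕ :=
  Finsupp.single (Sum.inl i) 1 + Finsupp.single (Sum.inr j) 1

lemma edgeExp_le_iff {i j : ι} {m : ι ⊕ ι →₀ ℕ} :
    edgeExp i j ≤ m ↔ 1 ≤ m (Sum.inl i) ∧ 1 ≤ m (Sum.inr j) := by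
  constructor
  · intro h
    have h1 := h (Sum.inl i)
    have h2 := h (Sum.inr j)
    simp [edgeExp] at h1 h2
    omega
  · rintro ⟨h1, h2⟩ (v | v)
    · by_cases h : i = v
      · subst h; simpa [edgeExp] using h1
      · simp [edgeExp, h]
    · by_cases h : j = v
      · subst h; simpa [edgeExp] using h2
      · simp [edgeExp, h]

lemma edgeExp_inl [DecidableEq ι] (i j a : ι) :
    edgeExp i j (Sum.inl a) = if i = a then 1 else 0 := by
  simp [edgeExp, Finsupp.single_apply]

lemma edgeExp_inr [DecidableEq ι] (i j a : ι) :
    edgeExp i j (Sum.inr a) = if j = a then 1 else 0 := by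
  simp [edgeExp, Finsupp.single_apply]

/-- Exponents of the monomials in the `t`-th power of the edge ideal with edges `x_i y_j`,
`R i j`. -/
def edgePow (R : ι → ι → Prop) : ℕ → Set (ι ⊕ ι →₀ ℕ)
  | 0 => Set.univ
  | t + 1 => {m | ∃ i j m', R i j ∧ m' ∈ edgePow R t ∧ m' + edgeExp i j ≤ m}

lemma isUpperSet_edgePow (t : ℕ) : IsUpperSet (edgePow R t) := by
  cases t with
  | zero => exact isUpperSet_univ
  | succ t => exact fun m m' hm ⟨i, j, n, hij, hn, h⟩ => ⟨i, j, n, hij, hn, h.trans hm⟩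

lemma monoIdeal_edgePow (t : ℕ) :
    monoIdeal k (edgePow R t) =
      (Ideal.span {p : MvPolynomial (ι ⊕ ι) k |
        ∃ i j, R i j ∧ p = X (Sum.inl i) * X (Sum.inr j)}) ^ t := by
  have hX : ∀ i j : ι, (X (Sum.inl i) * X (Sum.inr j) : MvPolynomial (ι ⊕ ι) k) =
      monomial (edgeExp i j) 1 := fun i j => by
    rw [X, X, monomial_mul, one_mul, edgeExp]
  induction t with
  | zero =>
    rw [pow_zero, Ideal.one_eq_top, Ideal.eq_top_iff_one]
    exact Ideal.subset_span ⟨0, trivial, rfl⟩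
  | succ t ih =>
    rw [pow_succ, ← ih, monoIdeal, monoIdeal, Ideal.span_mul_span']
    apply le_antisymm
    · rw [Ideal.span_le]
      rintro _ ⟨m, ⟨i, j, n, hij, hn, h⟩, rfl⟩
      have h1 : (monomial m 1 : MvPolynomial (ι ⊕ ι) k) =
          monomial (m - (n + edgeExp i j)) 1 *
            (monomial n 1 * (X (Sum.inl i) * X (Sum.inr j))) := by
        rw [hX, monomial_mul, monomial_mul, tsub_add_cancel_of_le h, one_mul, one_mul]
      change monomial m 1 ∈ _
      rw [h1]
      exact Ideal.mul_mem_left _ _ (Ideal.subset_span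
        (Set.mul_mem_mul ⟨n, hn, rfl⟩ ⟨i, j, hij, rfl⟩))
    · rw [Ideal.span_le]
      rintro _ ⟨_, ⟨n, hn, rfl⟩, _, ⟨i, j, hij, rfl⟩, rfl⟩
      refine Ideal.subset_span ⟨n + edgeExp i j, ⟨i, j, n, hij, hn, le_rfl⟩, ?_⟩
      change _ = monomial n 1 * _
      rw [hX, monomial_mul, one_mul]

lemma mem_edgePow_one {m : ι ⊕ ι →₀ ℕ} :
    m ∈ edgePow R 1 ↔ ∃ i j, R i j ∧ edgeExp i j ≤ m := by
  constructor
  · rintro ⟨i, j, n, hij, -, h⟩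
    exact ⟨i, j, hij, le_trans (by simp) h⟩
  · rintro ⟨i, j, hij, h⟩
    exact ⟨i, j, 0, hij, trivial, by simpa using h⟩

lemma mem_edgePow_two {m : ι ⊕ ι →₀ ℕ} :
    m ∈ edgePow R 2 ↔ ∃ i j i' j', R i j ∧ R i' j' ∧ edgeExp i j + edgeExp i' j' ≤ m := by
  constructor
  · rintro ⟨i, j, n, hij, hn, h⟩
    obtain ⟨i', j', hij', h'⟩ := mem_edgePow_one.1 hn
    exact ⟨i', j', i, j, hij', hij, le_trans (by gcongr) h⟩
  · rintro ⟨i, j, i', j', hij, hij', h⟩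
    exact ⟨i', j', edgeExp i j, hij', mem_edgePow_one.2 ⟨i, j, hij, le_rfl⟩, h⟩

section FirstPower

variable [LinearOrder ι] [Fintype ι] (hrefl : ∀ i, R i i) (htrans : ∀ i j l, R i j → R j l → R i l)
    (hle : ∀ i j, R i j → i ≤ j)

include hrefl htrans hle

lemma monoVanishes_edgePow_one : MonoVanishes k (Fintype.card ι) (edgePow R 1) := by
  have := MonoVanishes.of_poset (k := k) hrefl htrans hle univ ∅ ∅ ∅ (edgePow R 1)
    (by simp) (by simp) (fun _ _ _ h => h.elim) (fun m => by
      simp [mem_edgePow_one, edgeExp_le_iff])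
  simpa using this

lemma monoSurvives_edgePow_one {z : ι} (hz : ∀ j, R z j) :
    MonoSurvives k (Fintype.card ι) (edgePow R 1) := by
  have h1 := monoSurvives_vars (k := k) ((univ : Finset ι).disjSum (∅ : Finset ι))
  rw [card_disjSum, card_empty, add_zero, card_univ] at h1
  have h2 := MonoVanishes.of_poset (k := k) hrefl htrans hle (univ.erase z) ∅ {z}
    {m | 1 ≤ m (Sum.inl z)} {m | m ∈ edgePow R 1 ∨ Finsupp.single (Sum.inl z) 1 ≤ m}
    (by simp) (by simp) (fun m m' hm h => le_trans h (hm _ (by simp))) (fun m => by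
      simp only [Set.mem_ofPred_eq, mem_edgePow_one, edgeExp_le_iff, single_le_iff_one_le,
        mem_erase, mem_univ, and_true]
      constructor
      · rintro (⟨i, j, hij, h1, h2⟩ | h)
        · by_cases hi : i = z
          · subst hi; exact Or.inl h1
          · refine Or.inr ⟨i, hi, j, ?_, hij, h1, h2⟩
            rintro rfl
            exact hi (le_antisymm (hle _ _ hij) (hle _ _ (hz i)))
        · exact Or.inl h
      · rintro (h | ⟨i, -, j, -, hij, h1, h2⟩)
        · exact Or.inr h
        · exact Or.inl ⟨i, j, hij, h1, h2⟩)
  refine MonoSurvives.of_colon (isUpperSet_edgePow 1) (Finsupp.single (Sum.inl z) 1) ?_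
    (fun m => Iff.rfl) h1 (h2.mono ?_)
  · intro m
    simp only [Set.mem_ofPred_eq, mem_edgePow_one, edgeExp_le_iff]
    constructor
    · rintro ⟨v | v, hv, h⟩
      · simp at hv
      · exact ⟨z, v, hz v, by simp, by simp; omega⟩
    · rintro ⟨i, j, hij, h1, h2⟩
      exact ⟨Sum.inr j, by simp, by simpa using h2⟩
  · have := card_erase_add_one (mem_univ z)
    rw [card_univ] at this
    simp
    omega

end FirstPower

section SecondPower

/-- The exponents of the colon ideal of the squared edge ideal by `x_z`, where `z` is adjacent to
all `y_l`. -/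
def rootColon (R : ι → ι → Prop) : Set (ι ⊕ ι →₀ ℕ) :=
  {m | ∃ l i j, R i j ∧ Finsupp.single (Sum.inr l) 1 + edgeExp i j ≤ m}

lemma isUpperSet_rootColon : IsUpperSet (rootColon R) :=
  fun _ _ hm ⟨l, i, j, hij, h⟩ => ⟨l, i, j, hij, h.trans hm⟩

lemma mem_rootColon_iff {z : ι} (hz : ∀ j, R z j) (m : ι ⊕ ι →₀ ℕ) :
    m ∈ rootColon R ↔ m + Finsupp.single (Sum.inl z) 1 ∈ edgePow R 2 := by
  classical
  have key : ∀ j (e : ι ⊕ ι →₀ ℕ), edgeExp z j + e =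
      (Finsupp.single (Sum.inr j) 1 + e) + Finsupp.single (Sum.inl z) 1 := fun j e => by
    rw [edgeExp]; abel
  rw [mem_edgePow_two]
  constructor
  · rintro ⟨l, i, j, hij, h⟩
    refine ⟨z, l, i, j, hz l, hij, ?_⟩
    rw [key]
    gcongr
  · rintro ⟨i, j, i', j', hij, hij', h⟩
    by_cases hi : i = z
    · subst hi
      rw [key] at h
      exact ⟨j, i', j', hij', le_of_add_le_add_right h⟩
    by_cases hi' : i' = z
    · subst hi'
      rw [add_comm, key] at h
      exact ⟨j', i, j, hij, le_of_add_le_add_right h⟩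
    refine ⟨j, i', j', hij', le_trans ?_ (b := edgeExp i j + edgeExp i' j') ?_⟩
    · gcongr
      simp [edgeExp_inr]
    · intro v
      have hv := h v
      rcases v with v | v
      · by_cases hvz : v = z
        · subst hvz
          simp [edgeExp_inl, hi, hi']
        · simpa [Ne.symm hvz] using hv
      · simpa using hv

/-- `C` is a union of connected components of the graph away from the root `z`. -/
structure IsComponent (R : ι → ι → Prop) (z : ι) (C : Finset ι) : Prop where
  root_notMem : z ∉ C
  mem_iff : ∀ i j, i ≠ z → R i j → (i ∈ C ↔ j ∈ C)

lemma le_add_of_agree {V : Type} {W : Finset V} {m m' g e : V →₀ ℕ} (hm : ∀ v, v ∉ W → m v ≤ m' v)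
    (he : ∀ v ∈ W, e v = 0) (h : e ≤ m + g) : e ≤ m' + g := by
  intro v
  by_cases hv : v ∈ W
  · rw [he v hv]; exact Nat.zero_le _
  · exact (h v).trans (by simpa using hm v hv)

section EdgeColon

variable [LinearOrder ι]

lemma IsComponent.edgeExp_eq_zero {z : ι} {C D : Finset ι} (hC : IsComponent R z C)
    (hCD : Disjoint C D) {i j : ι} (hi : i ∈ C) (hij : R i j) :
    ∀ v ∈ (∅ ∪ D).disjSum ({z} ∪ D), edgeExp i j v = 0 := by
  have hiz : i ≠ z := by rintro rfl; exact hC.root_notMem hi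
  have hj : j ∈ C := (hC.mem_iff i j hiz hij).1 hi
  have hjz : j ≠ z := by rintro rfl; exact hC.root_notMem hj
  rintro (v | v) hv
  · have : i ≠ v := by
      rintro rfl
      exact disjoint_left.1 hCD hi (by simpa using hv)
    simp [edgeExp_inl, this]
  · have : j ≠ v := by
      rintro rfl
      have : j ∈ D := by simpa [hjz] using hv
      exact disjoint_left.1 hCD hj this
    simp [edgeExp_inr, this]

variable (hrefl : ∀ i, R i i) (htrans : ∀ i j l, R i j → R j l → R i l)
    (hle : ∀ i j, R i j → i ≤ j)

include hrefl htrans hle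

lemma monoVanishes_edge_colon {z : ι} {C D : Finset ι} (hC : IsComponent R z C)
    (hD : IsComponent R z D) (hCD : Disjoint C D) (hcover : ∀ i, i = z ∨ i ∈ C ∨ i ∈ D)
    {T : Set (ι ⊕ ι →₀ ℕ)} {c : Prop} (hT : ∀ m, m ∈ T ↔ m ∈ edgePow R 2 ∨ 1 ≤ m (Sum.inl z) ∨
      (c ∧ ∃ i ∈ D, ∃ j, R i j ∧ edgeExp i j ≤ m))
    (F : Finset (ι ⊕ ι →₀ ℕ)) (hF : ∀ f ∈ F, ∃ i ∈ C, ∃ j, R i j ∧ f = edgeExp i j)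
    (g : ι ⊕ ι →₀ ℕ) (hg : ∃ i ∈ C, ∃ j, R i j ∧ g = edgeExp i j) :
    MonoVanishes k (D.card + 1) {m | m + g ∈ T ∨ ∃ f ∈ F, f ≤ m + g} := by
  have hzD := hD.root_notMem
  obtain ⟨i₀, hi₀, j₀, hij₀, rfl⟩ := hg
  have hi₀z : i₀ ≠ z := by rintro rfl; exact hC.root_notMem hi₀
  have hg0 := hC.edgeExp_eq_zero hCD hi₀ hij₀
  have hgD : ∀ i ∈ D, ∀ j, R i j → ∀ m, edgeExp i j ≤ m + edgeExp i₀ j₀ → edgeExp i j ≤ m := by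
    intro i hi j hij m h
    have hiz : i ≠ z := by rintro rfl; exact hzD hi
    have hj := (hD.mem_iff i j hiz hij).1 hi
    rw [edgeExp_le_iff, Finsupp.add_apply, Finsupp.add_apply, hg0 (Sum.inl i) (by simp [hi]),
      hg0 (Sum.inr j) (by simp [hj])] at h
    exact edgeExp_le_iff.2 h
  have := MonoVanishes.of_poset (k := k) hrefl htrans hle D ∅ {z}
    {m | 1 ≤ m (Sum.inl z) ∨ (∃ i ∈ C, ∃ j, R i j ∧ ∃ i' ∈ C, ∃ j', R i' j' ∧
      edgeExp i j + edgeExp i' j' ≤ m + edgeExp i₀ j₀) ∨ ∃ f ∈ F, f ≤ m + edgeExp i₀ j₀}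
    {m | m + edgeExp i₀ j₀ ∈ T ∨ ∃ f ∈ F, f ≤ m + edgeExp i₀ j₀} (by simp) (by simp [hzD]) ?_ ?_
  · simpa [add_comm] using this
  · rintro m m' hm (h | ⟨i, hi, j, hij, i', hi', j', hij', h⟩ | ⟨f, hf, h⟩)
    · exact Or.inl (h.trans (hm _ (by simp [hzD])))
    · refine Or.inr (Or.inl ⟨i, hi, j, hij, i', hi', j', hij', le_add_of_agree hm ?_ h⟩)
      intro v hv
      rw [Finsupp.add_apply, hC.edgeExp_eq_zero hCD hi hij v hv,
        hC.edgeExp_eq_zero hCD hi' hij' v hv]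
    · refine Or.inr (Or.inr ⟨f, hf, le_add_of_agree hm ?_ h⟩)
      obtain ⟨i, hi, j, hij, rfl⟩ := hF f hf
      exact hC.edgeExp_eq_zero hCD hi hij
  · intro m
    simp only [Set.mem_ofPred_eq, hT]
    have hmz : (m + edgeExp i₀ j₀) (Sum.inl z) = m (Sum.inl z) := by
      simp [edgeExp_inl, hi₀z]
    rw [hmz, mem_edgePow_two]
    have hDE : ∀ i ∈ D, ∀ j, R i j → edgeExp i j ≤ m →
        ∃ i ∈ D, ∃ j ∈ D, R i j ∧ 1 ≤ m (Sum.inl i) ∧ 1 ≤ m (Sum.inr j) := by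
      intro i hi j hij h
      have hiz : i ≠ z := by rintro rfl; exact hzD hi
      exact ⟨i, hi, j, (hD.mem_iff i j hiz hij).1 hi, hij, edgeExp_le_iff.1 h⟩
    constructor
    · rintro ((⟨i, j, i', j', hij, hij', h⟩ | h | ⟨-, i, hi, j, hij, h⟩) | h)
      · have h1 : edgeExp i j ≤ m + edgeExp i₀ j₀ := le_trans (by simp) h
        have h2 : edgeExp i' j' ≤ m + edgeExp i₀ j₀ := le_trans (by simp) h
        rcases hcover i with rfl | hi | hi
        · rw [edgeExp_le_iff, hmz] at h1
          exact Or.inl (Or.inl h1.1)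
        · rcases hcover i' with rfl | hi' | hi'
          · rw [edgeExp_le_iff, hmz] at h2
            exact Or.inl (Or.inl h2.1)
          · exact Or.inl (Or.inr (Or.inl ⟨i, hi, j, hij, i', hi', j', hij', h⟩))
          · exact Or.inr (hDE i' hi' j' hij' (hgD i' hi' j' hij' m h2))
        · exact Or.inr (hDE i hi j hij (hgD i hi j hij m h1))
      · exact Or.inl (Or.inl h)
      · exact Or.inr (hDE i hi j hij (hgD i hi j hij m h))
      · exact Or.inl (Or.inr (Or.inr h))
    · rintro ((h | ⟨i, -, j, hij, i', -, j', hij', h⟩ | h) | ⟨i, -, j, -, hij, h⟩)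
      · exact Or.inl (Or.inr (Or.inl h))
      · exact Or.inl (Or.inl ⟨i, j, i', j', hij, hij', h⟩)
      · exact Or.inr h
      · refine Or.inl (Or.inl ⟨i, j, i₀, j₀, hij, hij₀, ?_⟩)
        have := edgeExp_le_iff.2 h
        gcongr

variable [Fintype ι]

lemma monoVanishes_two_add_root {z : ι} {A B : Finset ι} (hA : IsComponent R z A)
    (hB : IsComponent R z B) (hAB : Disjoint A B) (hcover : ∀ i, i = z ∨ i ∈ A ∨ i ∈ B)
    (hcard : B.card ≤ A.card) :
    MonoVanishes k (B.card + 1) {m | m ∈ edgePow R 2 ∨ 1 ≤ m (Sum.inl z)} := by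
  classical
  let G : Finset ι → Finset (ι ⊕ ι →₀ ℕ) := fun C =>
    ((C ×ˢ univ).filter fun p => R p.1 p.2).image fun p => edgeExp p.1 p.2
  have hG : ∀ C f, f ∈ G C ↔ ∃ i ∈ C, ∃ j, R i j ∧ f = edgeExp i j := by
    intro C f
    simp only [G, mem_image, mem_filter, mem_product, mem_univ, and_true, Prod.exists]
    constructor
    · rintro ⟨i, j, ⟨hi, hij⟩, rfl⟩; exact ⟨i, hi, j, hij, rfl⟩
    · rintro ⟨i, hi, j, hij, rfl⟩; exact ⟨i, j, ⟨hi, hij⟩, rfl⟩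
  have hup : IsUpperSet {m | m ∈ edgePow R 2 ∨ 1 ≤ m (Sum.inl z)} := by
    rintro m m' hm (h | h)
    · exact Or.inl (isUpperSet_edgePow 2 hm h)
    · exact Or.inr (h.trans (hm _))
  have hex : ∀ C (m : ι ⊕ ι →₀ ℕ), (∃ g ∈ G C, g ≤ m) ↔ ∃ i ∈ C, ∃ j, R i j ∧ edgeExp i j ≤ m := by
    intro C m
    constructor
    · rintro ⟨g, hg, h⟩
      obtain ⟨i, hi, j, hij, rfl⟩ := (hG C g).1 hg
      exact ⟨i, hi, j, hij, h⟩
    · rintro ⟨i, hi, j, hij, h⟩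
      exact ⟨_, (hG C _).2 ⟨i, hi, j, hij, rfl⟩, h⟩
  refine MonoVanishes.of_filtration hup (G A) ?_ fun F hF g hg _ =>
    monoVanishes_edge_colon hrefl htrans hle hA hB hAB hcover (c := False) (fun m => by simp)
      F (fun f hf => (hG A f).1 (hF hf)) g ((hG A g).1 hg)
  refine MonoVanishes.of_filtration ?_ (G B) ?_ fun F hF g hg _ =>
    (monoVanishes_edge_colon hrefl htrans hle hB hA hAB.symm
      (fun i => (hcover i).imp_right Or.symm) (c := True) (fun m => by
        rw [true_and, ← hex, ← or_assoc]; rfl)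
      F (fun f hf => (hG B f).1 (hF hf)) g ((hG B g).1 hg)).mono (by omega)
  · rintro m m' hm (h | ⟨g, hg, h⟩)
    · exact Or.inl (hup hm h)
    · exact Or.inr ⟨g, hg, h.trans hm⟩
  · have hzAB : z ∉ A ∪ B := by simp [hA.root_notMem, hB.root_notMem]
    have := MonoVanishes.of_poset (k := k) hrefl htrans hle (A ∪ B) ∅ {z}
      {m | 1 ≤ m (Sum.inl z)} {m | m ∈ {m | m ∈ {m | m ∈ edgePow R 2 ∨ 1 ≤ m (Sum.inl z)} ∨
        ∃ g ∈ G A, g ≤ m} ∨ ∃ g ∈ G B, g ≤ m} (by simp) (by simpa using hzAB) ?_ ?_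
    · refine this.mono ?_
      rw [card_union_of_disjoint hAB]
      simp
      omega
    · intro m m' hm h
      exact le_trans h (hm _ (by simpa using hzAB))
    · intro m
      simp only [Set.mem_ofPred_eq, hex]
      have hE : ∀ i j, R i j → edgeExp i j ≤ m → 1 ≤ m (Sum.inl z) ∨
          ∃ i ∈ A ∪ B, ∃ j ∈ A ∪ B, R i j ∧ 1 ≤ m (Sum.inl i) ∧ 1 ≤ m (Sum.inr j) := by
        intro i j hij h
        have h' := edgeExp_le_iff.1 h
        by_cases hiz : i = z
        · subst hiz
          exact Or.inl h'.1
        · refine Or.inr ⟨i, ?_, j, ?_, hij, h'⟩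
          · simpa [hiz] using hcover i
          · have := hcover i
            rw [hA.mem_iff i j hiz hij, hB.mem_iff i j hiz hij] at this
            simpa [hiz] using this
      constructor
      · rintro (((h | h) | ⟨i, -, j, hij, h⟩) | ⟨i, -, j, hij, h⟩)
        · obtain ⟨i, j, i', j', hij, -, h⟩ := mem_edgePow_two.1 h
          exact hE i j hij (le_trans (by simp) h)
        · exact Or.inl h
        · exact hE i j hij h
        · exact hE i j hij h
      · rintro (h | ⟨i, hi, j, hj, hij, h⟩)
        · exact Or.inl (Or.inl (Or.inr h))
        · have h' := edgeExp_le_iff.2 h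
          rcases mem_union.1 hi with hi | hi
          · exact Or.inl (Or.inr ⟨i, hi, j, hij, h'⟩)
          · exact Or.inr ⟨i, hi, j, hij, h'⟩

end EdgeColon

section ColonByTarget

/-- Exponents divisible by an edge, by `y_l` with `l ∈ F`, or by `x_i` with `R i j`. -/
def targetNbhd (R : ι → ι → Prop) (F : Finset ι) (j : ι) : Set (ι ⊕ ι →₀ ℕ) :=
  {m | (∃ l ∈ F, 1 ≤ m (Sum.inr l)) ∨ (∃ i l, R i l ∧ edgeExp i l ≤ m) ∨
    ∃ i, R i j ∧ 1 ≤ m (Sum.inl i)}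

/-- Exponents divisible by some `y_l`. -/
def someTarget (ι : Type) : Set (ι ⊕ ι →₀ ℕ) := {m | ∃ l, 1 ≤ m (Sum.inr l)}

lemma isUpperSet_targetNbhd (F : Finset ι) (j : ι) : IsUpperSet (targetNbhd R F j) := by
  rintro m m' hm (⟨l, hl, h⟩ | ⟨i, l, hil, h⟩ | ⟨i, hij, h⟩)
  · exact Or.inl ⟨l, hl, h.trans (hm _)⟩
  · exact Or.inr (Or.inl ⟨i, l, hil, h.trans hm⟩)
  · exact Or.inr (Or.inr ⟨i, hij, h.trans (hm _)⟩)

lemma isUpperSet_someTarget : IsUpperSet (someTarget ι) :=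
  fun _ _ hm ⟨l, h⟩ => ⟨l, h.trans (hm _)⟩

lemma monoVanishes_someTarget [Fintype ι] : MonoVanishes k (Fintype.card ι) (someTarget ι) := by
  have h : FreeOn ((univ : Finset ι).disjSum (∅ : Finset ι)) (someTarget ι) :=
    fun m m' hm ⟨l, h⟩ => ⟨l, h.trans (hm _ (by simp))⟩
  simpa using h.monoVanishes (k := k)

/-- The exponents divisible by some `y_l y_{l'} x_i` with `R i l'`, or by `y_l` with `l ∈ F`. -/
def rootColonAdd (R : ι → ι → Prop) (F : Finset ι) : Set (ι ⊕ ι →₀ ℕ) :=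
  {m | m ∈ rootColon R ∨ ∃ l ∈ F, 1 ≤ m (Sum.inr l)}

lemma isUpperSet_rootColonAdd (F : Finset ι) : IsUpperSet (rootColonAdd R F) := by
  rintro m m' hm (h | ⟨l, hl, h⟩)
  · exact Or.inl (isUpperSet_rootColon hm h)
  · exact Or.inr ⟨l, hl, h.trans (hm _)⟩

lemma mem_targetNbhd_inter_iff {F : Finset ι} {j : ι} (hj : j ∉ F) (m : ι ⊕ ι →₀ ℕ) :
    m ∈ targetNbhd R F j ∩ someTarget ι ↔
      m + Finsupp.single (Sum.inr j) 1 ∈ rootColonAdd R F := by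
  classical
  constructor
  · rintro ⟨⟨l, hl, h⟩ | ⟨i, l, hil, h⟩ | ⟨i, hij, h⟩, l', hl'⟩
    · exact Or.inr ⟨l, hl, h.trans (by simp)⟩
    · refine Or.inl ⟨j, i, l, hil, ?_⟩
      rw [add_comm]
      gcongr
    · refine Or.inl ⟨l', i, j, hij, ?_⟩
      rw [edgeExp, ← add_assoc]
      gcongr
      rw [add_comm]
      exact edgeExp_le_iff.2 ⟨h, hl'⟩
  · rintro (⟨l, i, l', hil, h⟩ | ⟨l, hl, h⟩)
    · have hi : 1 ≤ m (Sum.inl i) := by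
        have := h (Sum.inl i)
        simpa [edgeExp_inl] using this
      by_cases hl' : 1 ≤ m (Sum.inr l')
      · exact ⟨Or.inr (Or.inl ⟨i, l', hil, edgeExp_le_iff.2 ⟨hi, hl'⟩⟩), l', hl'⟩
      have hlj : l' = j := by
        by_contra hne
        have := h (Sum.inr l')
        simp [edgeExp_inr, Ne.symm hne] at this
        omega
      subst hlj
      refine ⟨Or.inr (Or.inr ⟨i, hil, hi⟩), l, ?_⟩
      have := h (Sum.inr l)
      by_cases hl : l' = l
      · subst hl
        simp [edgeExp_inr] at this
        omega
      · simpa [edgeExp_inr, hl] using this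
    · have hlj : j ≠ l := by rintro rfl; exact hj hl
      have h' : 1 ≤ m (Sum.inr l) := by simpa [hlj] using h
      exact ⟨Or.inl ⟨l, hl, h'⟩, l, h'⟩

lemma targetNbhd_union_someTarget (F : Finset ι) (j : ι) :
    targetNbhd R F j ∪ someTarget ι =
      {m | (∃ i, R i j ∧ 1 ≤ m (Sum.inl i)) ∨ ∃ l, 1 ≤ m (Sum.inr l)} := by
  ext m
  constructor
  · rintro ((⟨l, -, h⟩ | ⟨i, l, -, h⟩ | h) | h)
    · exact Or.inr ⟨l, h⟩
    · exact Or.inr ⟨l, (edgeExp_le_iff.1 h).2⟩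
    · exact Or.inl h
    · exact Or.inr h
  · rintro (h | h)
    · exact Or.inl (Or.inr (Or.inr h))
    · exact Or.inr h

variable [LinearOrder ι]
  (hrefl : ∀ i, R i i) (htrans : ∀ i j l, R i j → R j l → R i l)
  (hle : ∀ i j, R i j → i ≤ j)

include hle in
lemma IsComponent.ne_root {z : ι} (hz : ∀ j, R z j) {i j : ι} (hi : i ≠ z) (hij : R i j) :
    j ≠ z := by
  rintro rfl
  exact hi (le_antisymm (hle _ _ hij) (hle _ _ (hz i)))

include hrefl htrans hle

lemma monoVanishes_targetNbhd {z : ι} (hz : ∀ j, R z j) {C : Finset ι} (hC : IsComponent R z C)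
    {F : Finset ι} (hF : ∀ i ∈ F, ∀ j, R i j → j ∈ F) {j : ι} (hjF : j ∉ F) (hjC : j ∉ C) :
    MonoVanishes k (C.card + 1) (targetNbhd R F j) := by
  have hzF : z ∉ F := fun h => hjF (hF z h j (hz j))
  have hzC := hC.root_notMem
  have := MonoVanishes.of_poset (k := k) hrefl htrans hle (C \ F) (F ∩ C) {z}
    {m | (∃ l ∈ F, 1 ≤ m (Sum.inr l)) ∨ (∃ i l, i ∉ C ∧ i ≠ z ∧ R i l ∧ edgeExp i l ≤ m) ∨
      ∃ i, R i j ∧ 1 ≤ m (Sum.inl i)} (targetNbhd R F j) ?_ ?_ ?_ ?_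
  · have h1 := card_inter_add_card_sdiff C F
    rw [inter_comm, card_singleton] at this
    exact this.mono (by omega)
  · rw [disjoint_left]
    intro a ha hb
    exact (mem_sdiff.1 hb).2 (mem_inter.1 ha).1
  · simp [hzC]
  · rintro m m' hm (⟨l, hl, h⟩ | ⟨i, l, hi, hiz, hil, h⟩ | ⟨i, hij, h⟩)
    · have hlz : l ≠ z := by rintro rfl; exact hzF hl
      exact Or.inl ⟨l, hl, h.trans (hm _ (by simp [hl, hlz]))⟩
    · have hl : l ∉ C := fun h => hi ((hC.mem_iff i l hiz hil).2 h)
      have hlz := IsComponent.ne_root hle hz hiz hil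
      rw [edgeExp_le_iff] at h
      exact Or.inr (Or.inl ⟨i, l, hi, hiz, hil, edgeExp_le_iff.2
        ⟨h.1.trans (hm _ (by simp [hi])), h.2.trans (hm _ (by simp [hl, hlz]))⟩⟩)
    · have hi : i ∉ C := by
        intro h
        have hiz : i ≠ z := by rintro rfl; exact hzC h
        exact hjC ((hC.mem_iff i j hiz hij).1 h)
      exact Or.inr (Or.inr ⟨i, hij, h.trans (hm _ (by simp [hi]))⟩)
  · intro m
    constructor
    · rintro (h | ⟨i, l, hil, h⟩ | h)
      · exact Or.inl (Or.inl h)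
      · have h' := edgeExp_le_iff.1 h
        by_cases hiz : i = z
        · subst hiz
          exact Or.inl (Or.inr (Or.inr ⟨i, hz j, h'.1⟩))
        by_cases hi : i ∈ C
        · by_cases hl : l ∈ F
          · exact Or.inl (Or.inl ⟨l, hl, h'.2⟩)
          · refine Or.inr ⟨i, ?_, l, ?_, hil, h'⟩
            · exact mem_sdiff.2 ⟨hi, fun hi' => hl (hF i hi' l hil)⟩
            · exact mem_sdiff.2 ⟨(hC.mem_iff i l hiz hil).1 hi, hl⟩
        · exact Or.inl (Or.inr (Or.inl ⟨i, l, hi, hiz, hil, h⟩))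
      · exact Or.inl (Or.inr (Or.inr h))
    · rintro ((h | ⟨i, l, -, -, hil, h⟩ | h) | ⟨i, -, l, -, hil, h⟩)
      · exact Or.inl h
      · exact Or.inr (Or.inl ⟨i, l, hil, h⟩)
      · exact Or.inr (Or.inr h)
      · exact Or.inr (Or.inl ⟨i, l, hil, edgeExp_le_iff.2 h⟩)

lemma monoVanishes_targetNbhd_inter [Fintype ι] {z : ι} (hz : ∀ j, R z j) {C : Finset ι}
    (hC : IsComponent R z C) {F : Finset ι} (hF : ∀ i ∈ F, ∀ j, R i j → j ∈ F) {j : ι}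
    (hjF : j ∉ F) (hjC : j ∉ C) :
    MonoVanishes k (C.card + 1) (targetNbhd R F j ∩ someTarget ι) := by
  have hcard : C.card + 1 ≤ Fintype.card ι := by
    rw [← card_insert_of_notMem hC.root_notMem]
    exact card_le_univ _
  refine MonoVanishes.inter (isUpperSet_targetNbhd F j) isUpperSet_someTarget
    (monoVanishes_targetNbhd hrefl htrans hle hz hC hF hjF hjC)
    (monoVanishes_someTarget.mono hcard) ?_
  rw [targetNbhd_union_someTarget]
  have h : FreeOn (C.disjSum ∅)
      {m : ι ⊕ ι →₀ ℕ | (∃ i, R i j ∧ 1 ≤ m (Sum.inl i)) ∨ ∃ l, 1 ≤ m (Sum.inr l)} := by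
    rintro m m' hm (⟨i, hij, h⟩ | ⟨l, h⟩)
    · have hi : i ∉ C := by
        intro h
        have hiz : i ≠ z := by rintro rfl; exact hC.root_notMem h
        exact hjC ((hC.mem_iff i j hiz hij).1 h)
      exact Or.inl ⟨i, hij, h.trans (hm _ (by simp [hi]))⟩
    · exact Or.inr ⟨l, h.trans (hm _ (by simp))⟩
  simpa using h.monoVanishes (k := k)

lemma monoVanishes_rootColonAdd [Fintype ι] {z : ι} (hz : ∀ j, R z j) {A B : Finset ι}
    (hA : IsComponent R z A) (hB : IsComponent R z B) (hAB : Disjoint A B)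
    (hcard : B.card ≤ A.card) (F : Finset ι) (hF : ∀ i ∈ F, ∀ j, R i j → j ∈ F) :
    MonoVanishes k (B.card + 1) (rootColonAdd R F) := by
  induction hn : (Fᶜ).card generalizing F with
  | zero =>
    have hF' : F = univ := by simpa using hn
    have h : rootColonAdd R F = someTarget ι := by
      ext m
      constructor
      · rintro (⟨l, i, j, -, h⟩ | ⟨l, -, h⟩)
        · refine ⟨l, le_trans ?_ (h (Sum.inr l))⟩
          simp
        · exact ⟨l, h⟩
      · rintro ⟨l, h⟩
        exact Or.inr ⟨l, by simp [hF'], h⟩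
    rw [h]
    refine monoVanishes_someTarget.mono ?_
    rw [← card_insert_of_notMem hB.root_notMem]
    exact card_le_univ _
  | succ n ih =>
    have hne : Fᶜ.Nonempty := card_pos.1 (by omega)
    set j := Fᶜ.max' hne with hj
    have hjF : j ∉ F := mem_compl.1 (Fᶜ.max'_mem hne)
    have hmax : ∀ l, l ∉ F → l ≤ j := fun l hl => Fᶜ.le_max' l (mem_compl.2 hl)
    have hF' : ∀ i ∈ insert j F, ∀ l, R i l → l ∈ insert j F := by
      intro i hi l hil
      rcases mem_insert.1 hi with hij | hi
      · by_cases hl : l ∈ F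
        · exact mem_insert_of_mem hl
        · exact mem_insert.2 (Or.inl (le_antisymm (hmax l hl) (hij ▸ hle i l hil)))
      · exact mem_insert_of_mem (hF i hi l hil)
    have hcol : MonoVanishes k (B.card + 1) (targetNbhd R F j ∩ someTarget ι) := by
      by_cases hjB : j ∈ B
      · exact (monoVanishes_targetNbhd_inter hrefl htrans hle hz hA hF hjF
          (disjoint_right.1 hAB hjB)).mono (by omega)
      · exact monoVanishes_targetNbhd_inter hrefl htrans hle hz hB hF hjF hjB
    refine MonoVanishes.of_colon (isUpperSet_rootColonAdd F) (Finsupp.single (Sum.inr j) 1)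
      (mem_targetNbhd_inter_iff hjF) (fun m => ?_) hcol (ih (insert j F) hF' ?_)
    · simp only [rootColonAdd, Set.mem_ofPred_eq, mem_insert, exists_eq_or_imp,
        single_le_iff_one_le]
      rw [or_assoc, or_comm (a := 1 ≤ m (Sum.inr j))]
    · rw [compl_insert, card_erase_of_mem (mem_compl.2 hjF), hn, Nat.add_sub_cancel]

end ColonByTarget

section DepthTwo

variable [LinearOrder ι] [Fintype ι]
  (hrefl : ∀ i, R i i) (htrans : ∀ i j l, R i j → R j l → R i l)
  (hle : ∀ i j, R i j → i ≤ j) {z : ι} (hz : ∀ j, R z j) {A B : Finset ι}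
  (hA : IsComponent R z A) (hB : IsComponent R z B) (hAB : Disjoint A B)
  (hcover : ∀ i, i = z ∨ i ∈ A ∨ i ∈ B) (hcard : B.card ≤ A.card)

include hrefl htrans hle hz hA hB hAB hcover hcard

lemma monoVanishes_edgePow_two : MonoVanishes k (B.card + 1) (edgePow R 2) := by
  have h1 := monoVanishes_rootColonAdd (k := k) hrefl htrans hle hz hA hB hAB hcard ∅ (by simp)
  have h2 := monoVanishes_two_add_root (k := k) hrefl htrans hle hA hB hAB hcover hcard
  refine MonoVanishes.of_colon (isUpperSet_edgePow 2) (Finsupp.single (Sum.inl z) 1)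
    (fun m => ?_) (fun m => ?_) h1 h2
  · rw [← mem_rootColon_iff hz]
    simp [rootColonAdd]
  · rw [single_le_iff_one_le]; rfl

lemma monoSurvives_edgePow_two {α : ι} (hαB : ∀ i, R i α ↔ i ∉ B) (hα : ∀ l, R α l → l = α) :
    MonoSurvives k (B.card + 1) (edgePow R 2) := by
  have hB' : α ∉ B := (hαB α).1 (hrefl α)
  have hcard' : B.card + 1 ≤ Fintype.card ι := by
    rw [← card_insert_of_notMem hB.root_notMem]
    exact card_le_univ _
  have h1 : MonoSurvives k (B.card + 1) (targetNbhd R ∅ α ∩ someTarget ι) := by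
    refine MonoSurvives.inter (isUpperSet_targetNbhd ∅ α) isUpperSet_someTarget
      (monoVanishes_targetNbhd hrefl htrans hle hz hB (by simp) (by simp) hB')
      (monoVanishes_someTarget.mono hcard') ?_
    rw [targetNbhd_union_someTarget]
    have h := monoSurvives_vars (k := k) (B.disjSum (∅ : Finset ι))
    rw [card_disjSum, card_empty, add_zero] at h
    convert h using 1
    ext m
    simp only [Set.mem_ofPred_eq, hαB, Sum.exists, inl_mem_disjSum, inr_mem_disjSum, notMem_empty,
      not_false_eq_true, true_and]
  have h2 := monoVanishes_rootColonAdd (k := k) hrefl htrans hle hz hA hB hAB hcard {α}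
    (fun i hi j hij => by
      rw [mem_singleton] at hi ⊢
      subst hi
      exact hα j hij)
  have h3 : MonoSurvives k (B.card + 1) (rootColonAdd R ∅) := by
    refine MonoSurvives.of_colon (isUpperSet_rootColonAdd ∅) (Finsupp.single (Sum.inr α) 1)
      (mem_targetNbhd_inter_iff (by simp)) (fun m => ?_) h1 h2
    simp [rootColonAdd]
  have h4 := monoVanishes_two_add_root (k := k) hrefl htrans hle hA hB hAB hcover hcard
  refine MonoSurvives.of_colon (isUpperSet_edgePow 2) (Finsupp.single (Sum.inl z) 1)
    (fun m => ?_) (fun m => ?_) h3 h4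
  · rw [← mem_rootColon_iff hz]
    simp [rootColonAdd]
  · rw [single_le_iff_one_le]; rfl

end DepthTwo

end SecondPower

section HighPowers

lemma edgePow_add_mem {s : ℕ} {m : ι ⊕ ι →₀ ℕ} (hm : m ∈ edgePow R s) {i j : ι} (hij : R i j) :
    m + edgeExp i j ∈ edgePow R (s + 1) :=
  ⟨i, j, m, hij, hm, le_rfl⟩

lemma nsmul_edgeExp_mem {i j : ι} (hij : R i j) (s : ℕ) : s • edgeExp i j ∈ edgePow R s := by
  induction s with
  | zero => trivial
  | succ s ih => rw [succ_nsmul]; exact edgePow_add_mem ih hij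

/-- The exponents that enter `edgePow R t` after multiplication by a power of the variable `v`. -/
def edgePowSat (R : ι → ι → Prop) (t : ℕ) (v : ι ⊕ ι) : Set (ι ⊕ ι →₀ ℕ) :=
  {m | ∃ N : ℕ, m + N • Finsupp.single v 1 ∈ edgePow R t}

lemma isUpperSet_edgePowSat (t : ℕ) (v : ι ⊕ ι) : IsUpperSet (edgePowSat R t v) :=
  fun _ _ hm ⟨N, h⟩ => ⟨N, isUpperSet_edgePow t (by gcongr) h⟩

lemma edgePow_subset_edgePowSat (t : ℕ) (v : ι ⊕ ι) : edgePow R t ⊆ edgePowSat R t v :=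
  fun m hm => ⟨0, by simpa using hm⟩

lemma monoVanishes_edgePowSat (t : ℕ) (v : ι ⊕ ι) : MonoVanishes k 1 (edgePowSat R t v) := by
  refine MonoVanishes.of_free_var (n := 0) (isUpperSet_edgePowSat t v) v
    (U'' := {m | m ∈ edgePowSat R t v ∨ 1 ≤ m v}) ?_ (fun _ => Iff.rfl) (monoVanishes_zero _)
  rintro m ⟨N, h⟩
  refine ⟨N + 1, ?_⟩
  rwa [add_assoc, ← succ_nsmul'] at h

/-- If `y_z` is only adjacent to `x_z`, then powers of `y_z` can be traded for powers of `x_z`. -/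
lemma exists_of_mem_edgePowSat {z : ι} (hz' : ∀ i, R i z → i = z) {t : ℕ} {m : ι ⊕ ι →₀ ℕ}
    (hm : m ∈ edgePowSat R t (Sum.inr z)) : ∃ c s m', s + c = t ∧ m' ∈ edgePow R s ∧
      m' + c • Finsupp.single (Sum.inl z) 1 ≤ m := by
  classical
  induction t generalizing m with
  | zero => exact ⟨0, 0, 0, rfl, trivial, by simp⟩
  | succ t ih =>
    obtain ⟨N, i, j, n, hij, hn, h⟩ := hm
    obtain ⟨c, s, m', rfl, hm', h'⟩ := ih (m := n.erase (Sum.inr z)) ⟨n (Sum.inr z), by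
      convert hn using 1
      rw [Finsupp.smul_single_one, add_comm, Finsupp.single_add_erase]⟩
    have hle : ∀ v, v ≠ Sum.inr z → n v + edgeExp i j v ≤ m v := fun v hv => by
      simpa [hv.symm] using h v
    have hle' : ∀ v, m' v + c * (Finsupp.single (Sum.inl z) 1 : ι ⊕ ι →₀ ℕ) v ≤
        n.erase (Sum.inr z) v := h'
    by_cases hj : j = z
    · subst hj
      obtain rfl := hz' i hij
      refine ⟨c + 1, s, m', by ring, hm', fun v => ?_⟩
      have h1 := hle' v
      by_cases hv : v = Sum.inr i
      · subst hv
        simp at h1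
        simp [h1]
      · have h2 := hle v hv
        rw [Finsupp.erase_ne hv] at h1
        simp only [edgeExp, Finsupp.add_apply, Finsupp.smul_apply, smul_eq_mul, add_mul,
          one_mul] at h1 h2 ⊢
        lia
    · refine ⟨c, s + 1, m' + edgeExp i j, by ring, edgePow_add_mem hm' hij, fun v => ?_⟩
      have h1 := hle' v
      by_cases hv : v = Sum.inr z
      · subst hv
        simp at h1
        simp [h1, edgeExp, hj]
      · have h2 := hle v hv
        rw [Finsupp.erase_ne hv] at h1
        simp only [Finsupp.add_apply, Finsupp.smul_apply, smul_eq_mul]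
        lia

variable [Fintype ι]

lemma sum_inl_edgeExp (i j : ι) : ∑ l, edgeExp i j (Sum.inl l) = 1 := by
  classical simp [edgeExp_inl]

lemma sum_inr_edgeExp (i j : ι) : ∑ l, edgeExp i j (Sum.inr l) = 1 := by
  classical simp [edgeExp_inr]

lemma le_sum_inl_of_mem_edgePow {t : ℕ} {m : ι ⊕ ι →₀ ℕ} (hm : m ∈ edgePow R t) :
    t ≤ ∑ l, m (Sum.inl l) := by
  induction t generalizing m with
  | zero => exact Nat.zero_le _
  | succ t ih =>
    obtain ⟨i, j, n, -, hn, h⟩ := hm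
    calc t + 1 ≤ ∑ l, (n + edgeExp i j) (Sum.inl l) := by
          simpa [sum_add_distrib, sum_inl_edgeExp] using ih hn
      _ ≤ _ := sum_le_sum fun l _ => h _

lemma exists_le_sum_inr_eq {t : ℕ} {m : ι ⊕ ι →₀ ℕ} (hm : m ∈ edgePow R t) :
    ∃ n ∈ edgePow R t, n ≤ m ∧ ∑ l, n (Sum.inr l) = t := by
  induction t generalizing m with
  | zero => exact ⟨0, trivial, by simp, by simp⟩
  | succ t ih =>
    obtain ⟨i, j, n, hij, hn, h⟩ := hm
    obtain ⟨n', hn', hle, hsum⟩ := ih hn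
    exact ⟨n' + edgeExp i j, edgePow_add_mem hn' hij, le_trans (by gcongr) h, by
      simp [sum_add_distrib, sum_inr_edgeExp, hsum]⟩

lemma le_sum_inr_of_mem_edgePow {t : ℕ} {m : ι ⊕ ι →₀ ℕ} (hm : m ∈ edgePow R t) :
    t ≤ ∑ l, m (Sum.inr l) := by
  obtain ⟨n, -, hle, rfl⟩ := exists_le_sum_inr_eq hm
  exact sum_le_sum fun l _ => hle _

lemma add_nsmul_root_mem {z : ι} (hz : ∀ j, R z j) {s : ℕ} {n m : ι ⊕ ι →₀ ℕ} (c : ℕ)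
    (hn : n ∈ edgePow R s) (hnm : n ≤ m)
    (h : ∑ l, n (Sum.inr l) + c ≤ ∑ l, m (Sum.inr l)) :
    m + c • Finsupp.single (Sum.inl z) 1 ∈ edgePow R (s + c) := by
  classical
  induction c generalizing s n m with
  | zero => simpa using isUpperSet_edgePow s hnm hn
  | succ c ih =>
    obtain ⟨j, -, hj⟩ := exists_lt_of_sum_lt (show ∑ l, n (Sum.inr l) < ∑ l, m (Sum.inr l) by lia)
    have hle : n + edgeExp z j ≤ m + Finsupp.single (Sum.inl z) 1 := by
      intro v
      have hv := hnm v
      rcases v with v | v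
      · simpa [edgeExp] using hv
      · by_cases hvj : j = v
        · subst hvj
          simpa [edgeExp] using hj
        · simpa [edgeExp, hvj] using hv
    have h' := ih (edgePow_add_mem hn (hz j)) hle (by
      simp [sum_add_distrib, sum_inr_edgeExp]
      lia)
    rwa [add_assoc m, ← succ_nsmul', add_right_comm s, add_assoc s] at h'

lemma edgePow_eq_inter {z : ι} (hz : ∀ j, R z j) (hz' : ∀ i, R i z → i = z) (t : ℕ) :
    edgePow R t = edgePowSat R t (Sum.inl z) ∩ edgePowSat R t (Sum.inr z) := by
  refine Set.Subset.antisymm (fun m hm => ⟨edgePow_subset_edgePowSat _ _ hm,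
    edgePow_subset_edgePowSat _ _ hm⟩) ?_
  rintro m ⟨⟨N, hN⟩, hm⟩
  obtain ⟨c, s, m', rfl, hm', hle⟩ := exists_of_mem_edgePowSat hz' hm
  obtain ⟨n, hn, hnm, hsum⟩ := exists_le_sum_inr_eq hm'
  have hdeg : s + c ≤ ∑ l, m (Sum.inr l) := by simpa using le_sum_inr_of_mem_edgePow hN
  obtain ⟨m₀, rfl⟩ := exists_add_of_le hle
  have h := add_nsmul_root_mem (m := m' + m₀) hz c hn (hnm.trans le_self_add)
    (by simpa [hsum] using hdeg)
  rwa [add_right_comm] at h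

lemma monoVanishes_edgePow {z : ι} (hz : ∀ j, R z j) (hz' : ∀ i, R i z → i = z) (t : ℕ) :
    MonoVanishes k 1 (edgePow R t) := by
  rw [edgePow_eq_inter hz hz']
  exact MonoVanishes.inter (n := 0) (isUpperSet_edgePowSat _ _) (isUpperSet_edgePowSat _ _)
    (monoVanishes_edgePowSat _ _) (monoVanishes_edgePowSat _ _) (monoVanishes_zero _)

lemma monoSurvives_edgePow {z α β : ι} (hz : ∀ j, R z j) (hz' : ∀ i, R i z → i = z)
    (hαβ : ∀ i, R i α ∨ R i β) (s : ℕ) : MonoSurvives k 1 (edgePow R (s + 3)) := by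
  rw [edgePow_eq_inter hz hz']
  refine MonoSurvives.inter (n := 0) (isUpperSet_edgePowSat _ _) (isUpperSet_edgePowSat _ _)
    (monoVanishes_edgePowSat _ _) (monoVanishes_edgePowSat _ _) ?_
  have key : ∀ i j, s • edgeExp z z + edgeExp z α + edgeExp z β + Finsupp.single (Sum.inl i) 1 +
      Finsupp.single (Sum.inr j) 1 ∈ edgePow R (s + 3) := by
    intro i j
    rcases hαβ i with h | h
    · convert edgePow_add_mem (edgePow_add_mem (edgePow_add_mem
        (nsmul_edgeExp_mem (hz z) s) h) (hz j)) (hz β) using 1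
      simp only [edgeExp]
      abel
    · convert edgePow_add_mem (edgePow_add_mem (edgePow_add_mem
        (nsmul_edgeExp_mem (hz z) s) h) (hz j)) (hz α) using 1
      simp only [edgeExp]
      abel
  refine monoSurvives_zero ((isUpperSet_edgePowSat _ _).union (isUpperSet_edgePowSat _ _))
    (s • edgeExp z z + edgeExp z α + edgeExp z β) ?_ ?_
  · rintro (⟨N, h⟩ | ⟨N, h⟩)
    · have := le_sum_inr_of_mem_edgePow h
      simp [sum_add_distrib, sum_inr_edgeExp, ← mul_sum] at this
    · have := le_sum_inl_of_mem_edgePow h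
      simp [sum_add_distrib, sum_inl_edgeExp, ← mul_sum] at this
  · rintro (i | j)
    · exact Or.inr ⟨1, by simpa using key i z⟩
    · refine Or.inl ⟨1, ?_⟩
      have h := key z j
      rw [add_right_comm] at h
      simpa using h

end HighPowers

end BipartitePosets

section TwoBlocks

/-- The edge relation of `G_{d,a}`: the root `0` followed by the chains `1, …, a - 1` and
`a, …, d - 1`. -/
def TwoBlockRel (d a : ℕ) (i j : Fin d) : Prop :=
  (i : ℕ) = 0 ∨ (1 ≤ (i : ℕ) ∧ i ≤ j ∧ (j : ℕ) < a) ∨ (a ≤ (i : ℕ) ∧ i ≤ j)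

variable {d a : ℕ}

lemma twoBlockRel_refl (i : Fin d) : TwoBlockRel d a i i := by
  simp only [TwoBlockRel, Fin.le_def]
  omega

lemma TwoBlockRel.trans (i j l : Fin d) (h : TwoBlockRel d a i j) (h' : TwoBlockRel d a j l) :
    TwoBlockRel d a i l := by
  simp only [TwoBlockRel, Fin.le_def] at *
  omega

lemma TwoBlockRel.le (i j : Fin d) (h : TwoBlockRel d a i j) : i ≤ j := by
  simp only [TwoBlockRel, Fin.le_def] at *
  omega

/-- The chain `1, …, a - 1`. -/
def lowerBlock (d a : ℕ) : Finset (Fin d) := {i | 1 ≤ (i : ℕ) ∧ (i : ℕ) < a}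

/-- The chain `a, …, d - 1`. -/
def upperBlock (d a : ℕ) : Finset (Fin d) := {i | a ≤ (i : ℕ)}

lemma card_lowerBlock (h : a ≤ d) : (lowerBlock d a).card = a - 1 := by
  rw [← Nat.card_Ico, ← Finset.card_map Fin.valEmbedding]
  congr 1
  ext n
  simp only [lowerBlock, Finset.mem_map, Finset.mem_filter, Finset.mem_univ, true_and,
    Fin.valEmbedding_apply, Finset.mem_Ico]
  exact ⟨fun ⟨i, hi, hin⟩ => hin ▸ hi, fun hn => ⟨⟨n, by omega⟩, hn, rfl⟩⟩

lemma card_upperBlock : (upperBlock d a).card = d - a := by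
  rw [← Nat.card_Ico, ← Finset.card_map Fin.valEmbedding]
  congr 1
  ext n
  simp only [upperBlock, Finset.mem_map, Finset.mem_filter, Finset.mem_univ, true_and,
    Fin.valEmbedding_apply, Finset.mem_Ico]
  exact ⟨fun ⟨i, hi, hin⟩ => hin ▸ ⟨hi, i.2⟩, fun hn => ⟨⟨n, hn.2⟩, hn.1, rfl⟩⟩

lemma isComponent_lowerBlock (hd : 0 < d) :
    IsComponent (TwoBlockRel d a) ⟨0, hd⟩ (lowerBlock d a) where
  root_notMem := by simp [lowerBlock]
  mem_iff i j hi h := by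
    simp only [TwoBlockRel, lowerBlock, Finset.mem_filter, Finset.mem_univ, true_and, Fin.le_def,
      ne_eq, Fin.ext_iff] at *
    omega

lemma isComponent_upperBlock (hd : 0 < d) (ha : 0 < a) :
    IsComponent (TwoBlockRel d a) ⟨0, hd⟩ (upperBlock d a) where
  root_notMem := by simp [upperBlock]; omega
  mem_iff i j hi h := by
    simp only [TwoBlockRel, upperBlock, Finset.mem_filter, Finset.mem_univ, true_and, Fin.le_def,
      ne_eq, Fin.ext_iff] at *
    omega

lemma disjoint_lowerBlock_upperBlock : Disjoint (lowerBlock d a) (upperBlock d a) := by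
  rw [Finset.disjoint_left]
  intro i
  simp only [lowerBlock, upperBlock, Finset.mem_filter, Finset.mem_univ, true_and]
  omega

lemma eq_zero_or_mem_block (hd : 0 < d) (i : Fin d) :
    i = ⟨0, hd⟩ ∨ i ∈ lowerBlock d a ∨ i ∈ upperBlock d a := by
  simp only [lowerBlock, upperBlock, Finset.mem_filter, Finset.mem_univ, true_and, Fin.ext_iff]
  omega

lemma twoBlockRel_last_lower (ha : 2 ≤ a) (had : a < d) (i : Fin d) :
    TwoBlockRel d a i ⟨a - 1, by omega⟩ ↔ i ∉ upperBlock d a := by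
  simp only [TwoBlockRel, upperBlock, Finset.mem_filter, Finset.mem_univ, true_and, Fin.le_def]
  omega

lemma twoBlockRel_last_upper (ha : 2 ≤ a) (had : a < d) (i : Fin d) :
    TwoBlockRel d a i ⟨d - 1, by omega⟩ ↔ i ∉ lowerBlock d a := by
  simp only [TwoBlockRel, lowerBlock, Finset.mem_filter, Finset.mem_univ, true_and, Fin.le_def]
  omega

lemma depthQuot_pow_eq {k : Type} [Field k] {ι : Type} {R : ι → ι → Prop} {n t : ℕ}
    (h : MonoVanishes k n (edgePow R t)) (h' : MonoSurvives k n (edgePow R t)) :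
    depthQuot k ((Ideal.span {p : MvPolynomial (ι ⊕ ι) k |
      ∃ i j, R i j ∧ p = X (Sum.inl i) * X (Sum.inr j)}) ^ t) = n := by
  rw [← monoIdeal_edgePow]
  exact depthQuot_eq h h'

lemma depthQuot_twoBlock_sq {k : Type} [Field k] (ha : 2 ≤ a) (had : a < d) :
    depthQuot k ((Ideal.span {p : MvPolynomial (Fin d ⊕ Fin d) k |
      ∃ i j, TwoBlockRel d a i j ∧ p = X (Sum.inl i) * X (Sum.inr j)}) ^ 2) =
      min a (d - a + 1) := by
  have hd : 0 < d := by omega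
  have hz : ∀ j, TwoBlockRel d a ⟨0, hd⟩ j := fun j => Or.inl rfl
  have hL := isComponent_lowerBlock (a := a) hd
  have hU := isComponent_upperBlock (a := a) hd (by omega)
  have hLU := disjoint_lowerBlock_upperBlock (d := d) (a := a)
  have hcover := eq_zero_or_mem_block (a := a) hd
  have hcover' := fun i => (hcover i).imp_right Or.symm
  have hcL := card_lowerBlock had.le
  have hcU := card_upperBlock (d := d) (a := a)
  rcases le_total (d - a) (a - 1) with h | h
  · have hn : min a (d - a + 1) = (upperBlock d a).card + 1 := by omega
    have hcard : (upperBlock d a).card ≤ (lowerBlock d a).card := by omega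
    rw [hn]
    refine depthQuot_pow_eq
      (monoVanishes_edgePow_two twoBlockRel_refl TwoBlockRel.trans TwoBlockRel.le hz hL hU hLU
        hcover hcard)
      (monoSurvives_edgePow_two twoBlockRel_refl TwoBlockRel.trans TwoBlockRel.le hz hL hU hLU
        hcover hcard (twoBlockRel_last_lower ha had) fun l hl => ?_)
    simp only [TwoBlockRel, Fin.le_def, Fin.ext_iff] at *
    omega
  · have hn : min a (d - a + 1) = (lowerBlock d a).card + 1 := by omega
    have hcard : (lowerBlock d a).card ≤ (upperBlock d a).card := by omega
    rw [hn]
    refine depthQuot_pow_eq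
      (monoVanishes_edgePow_two twoBlockRel_refl TwoBlockRel.trans TwoBlockRel.le hz hU hL
        hLU.symm hcover' hcard)
      (monoSurvives_edgePow_two twoBlockRel_refl TwoBlockRel.trans TwoBlockRel.le hz hU hL
        hLU.symm hcover' hcard (twoBlockRel_last_upper ha had) fun l hl => ?_)
    simp only [TwoBlockRel, Fin.le_def, Fin.ext_iff] at *
    omega

end TwoBlocks

/-- Here the ideal `I` is the edge ideal
`I(G_{d,a}) = x_1(y_1, …, y_d) + (x_i y_j : 2 ≤ i ≤ j ≤ a) + (x_i y_j : a+1 ≤ i ≤ j ≤ d)`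
of the bipartite graph `G_{d,a}`, with `x_i = X (inl i)`, `y_i = X (inr i)` and `1`-based
indices translated to `0`-based `Fin d` indices.
Then `depth S/I(G_{d,a})^t` equals `d` for `t = 1`, equals `min (a, d - a + 1)` for `t = 2`,
and equals `1` for all `t ≥ 3`. -/
theorem depth_powers_two_drops_graph (k : Type) [Field k] (d a : ℕ)
    (hd : 5 ≤ d) (ha2 : 2 ≤ a) (had : a ≤ d - 1)
    (I : Ideal (MvPolynomial (Fin d ⊕ Fin d) k))
    (hI : I = Ideal.span
      ({p | ∃ i : Fin d, p = X (Sum.inl (⟨0, by omega⟩ : Fin d)) * X (Sum.inr i)} ∪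
       {p | ∃ i jm : Fin d, 1 ≤ (i : ℕ) ∧ i ≤ jm ∧ (jm : ℕ) < a ∧
          p = X (Sum.inl i) * X (Sum.inr jm)} ∪
       {p | ∃ i jm : Fin d, a ≤ (i : ℕ) ∧ i ≤ jm ∧
          p = X (Sum.inl i) * X (Sum.inr jm)})) :
    depthQuot k (I ^ 1) = d ∧
    depthQuot k (I ^ 2) = min a (d - a + 1) ∧
    ∀ t : ℕ, 3 ≤ t → depthQuot k (I ^ t) = 1 := by
  obtain rfl : I = Ideal.span {p | ∃ i j, TwoBlockRel d a i j ∧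
      p = X (Sum.inl i) * X (Sum.inr j)} := by
    rw [hI]
    congr 1
    ext p
    constructor
    · rintro ((⟨j, rfl⟩ | ⟨i, j, hi, hij, hj, rfl⟩) | ⟨i, j, hi, hij, rfl⟩)
      · exact ⟨_, j, Or.inl rfl, rfl⟩
      · exact ⟨i, j, Or.inr (Or.inl ⟨hi, hij, hj⟩), rfl⟩
      · exact ⟨i, j, Or.inr (Or.inr ⟨hi, hij⟩), rfl⟩
    · rintro ⟨i, j, h | ⟨hi, hij, hj⟩ | ⟨hi, hij⟩, rfl⟩
      · exact Or.inl (Or.inl ⟨j, by rw [show i = ⟨0, by omega⟩ from Fin.ext h]⟩)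
      · exact Or.inl (Or.inr ⟨i, j, hi, hij, hj, rfl⟩)
      · exact Or.inr ⟨i, j, hi, hij, rfl⟩
  have hz : ∀ j, TwoBlockRel d a ⟨0, by omega⟩ j := fun j => Or.inl rfl
  refine ⟨?_, depthQuot_twoBlock_sq ha2 (by omega), fun t ht => ?_⟩
  · refine (depthQuot_pow_eq
      (monoVanishes_edgePow_one twoBlockRel_refl TwoBlockRel.trans TwoBlockRel.le)
      (monoSurvives_edgePow_one twoBlockRel_refl TwoBlockRel.trans TwoBlockRel.le hz)).trans
      (Fintype.card_fin d)
  · obtain ⟨s, rfl⟩ := Nat.exists_eq_add_of_le' ht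
    refine depthQuot_pow_eq (monoVanishes_edgePow hz (fun i hi => ?_) _)
      (monoSurvives_edgePow (α := ⟨a - 1, by omega⟩) (β := ⟨d - 1, by omega⟩) hz
        (fun i hi => ?_) (fun i => ?_) s)
    all_goals
      simp only [TwoBlockRel, Fin.le_def, Fin.ext_iff] at *
      omega
end

section
/- Let k be a field, T a tree on n vertices x_1,…,x_n with {x_1,…,x_d} ⊆ V(T), and let G be the graph obtained from T by adding a whisker at each of x_1,…,x_d: V(G) = V(T) ∪ {y_1,…,y_d} and E(G) = E(T) ∪ {{x_i,y_i} : 1 ≤ i ≤ d}. Let R = k[x_1,…,x_n,y_1,…,y_d]. Then for every integer t with 1 ≤ t ≤ d and every subgraph H of G with E(H) ⊆ {{x_1,y_1},…,{x_d,y_d}}, one has depth(R/(I(G)^t + I(H))) ≥ d − t + 1. -/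
open MvPolynomial

/-- The graph obtained from a graph `T` on `Fin n` by adding a whisker `{x_i, y_i}` at each of
the first `d` vertices `x_1, …, x_d` (where `d ≤ n`): the vertex set is `Fin n ⊕ Fin d` and
the edges are those of `T` together with the whisker edges. -/
def whiskerFirst {n d : ℕ} (T : SimpleGraph (Fin n)) (h : d ≤ n) :
    SimpleGraph (Fin n ⊕ Fin d) :=
  SimpleGraph.fromRel (fun u v =>
    (∃ i j, T.Adj i j ∧ u = Sum.inl i ∧ v = Sum.inl j) ∨
    (∃ m : Fin d, u = Sum.inl (Fin.castLE h m) ∧ v = Sum.inr m))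

namespace LocalCohomologyVanishing
open CategoryTheory Limits Opposite

section Cochains
variable {R : Type} [CommRing R] (J : Ideal R)

/-- The module `R ⧸ J ^ s`. -/
noncomputable abbrev quotPow (s : ℕ) : ModuleCat.{0} R :=
  (localCohomology.ringModIdeals (localCohomology.idealPowersDiagram J)).obj (op s)

/-- The projection `R ⧸ J ^ s' → R ⧸ J ^ s`. -/
noncomputable abbrev quotPowProj {s s' : ℕ} (h : s ≤ s') : quotPow J s' ⟶ quotPow J s :=
  (localCohomology.ringModIdeals (localCohomology.idealPowersDiagram J)).map (homOfLE h).op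

/-- The chosen projective resolution of `R ⧸ J ^ s`. -/
noncomputable abbrev res (s : ℕ) : ProjectiveResolution (quotPow J s) :=
  projectiveResolution (quotPow J s)

/-- A cochain on the resolution of `R ⧸ J ^ s` becomes a coboundary on that of `R ⧸ J ^ s'`. -/
def Dies {M : ModuleCat.{0} R} {s i : ℕ} (f : (res J s).complex.X i ⟶ M) : Prop :=
  ∃ (s' : ℕ) (h : s ≤ s') (φ : (res J s').complex ⟶ (res J s).complex),
    φ ≫ (res J s).π = (res J s').π ≫ (ChainComplex.single₀ _).map (quotPowProj J h) ∧
    ∃ g : (res J s').complex.X (i - 1) ⟶ M, φ.f i ≫ f = (res J s').complex.d i (i - 1) ≫ g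

/-- Every cocycle dies. -/
def Vanishes (i : ℕ) (M : ModuleCat.{0} R) : Prop :=
  ∀ (s : ℕ) (f : (res J s).complex.X i ⟶ M), (res J s).complex.d (i + 1) i ≫ f = 0 → Dies J f

variable {J}

lemma quotPowProj_comp {s s' s'' : ℕ} (h : s ≤ s') (h' : s' ≤ s'') :
    quotPowProj J h' ≫ quotPowProj J h = quotPowProj J (h.trans h') := by
  rw [← Functor.map_comp]; rfl

lemma quotPowProj_refl (s : ℕ) : quotPowProj J (le_refl s) = 𝟙 _ :=
  CategoryTheory.Functor.map_id _ _

lemma Dies.of_coboundary {M : ModuleCat.{0} R} {s i : ℕ} {f : (res J s).complex.X i ⟶ M}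
    (g : (res J s).complex.X (i - 1) ⟶ M) (hg : f = (res J s).complex.d i (i - 1) ≫ g) :
    Dies J f :=
  ⟨s, le_rfl, 𝟙 _, by simp [quotPowProj_refl], g, by simpa using hg⟩

/-- If the pullback of `f` differs from a coboundary by a cochain that dies, then `f` dies. -/
lemma Dies.of_map {M : ModuleCat.{0} R} {s s' i : ℕ} {f : (res J s).complex.X i ⟶ M}
    (h : s ≤ s') (φ : (res J s').complex ⟶ (res J s).complex)
    (hφ : φ ≫ (res J s).π = (res J s').π ≫ (ChainComplex.single₀ _).map (quotPowProj J h))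
    (f' : (res J s').complex.X i ⟶ M) (g : (res J s').complex.X (i - 1) ⟶ M)
    (hf : φ.f i ≫ f = f' + (res J s').complex.d i (i - 1) ≫ g) (hf' : Dies J f') :
    Dies J f := by
  obtain ⟨s'', h', ψ, hψ, g', hg'⟩ := hf'
  refine ⟨s'', h.trans h', ψ ≫ φ, ?_, g' + ψ.f (i - 1) ≫ g, ?_⟩
  · rw [Category.assoc, hφ, reassoc_of% hψ, ← Functor.map_comp, quotPowProj_comp]
  · rw [HomologicalComplex.comp_f, Category.assoc, hf, Preadditive.comp_add, hg',
      Preadditive.comp_add, ψ.comm_assoc]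

lemma Vanishes.mid {S : ShortComplex (ModuleCat.{0} R)} (hS : S.ShortExact) {i : ℕ}
    (h₁ : Vanishes J i S.X₁) (h₃ : Vanishes J i S.X₃) : Vanishes J i S.X₂ := by
  intro s f hf
  have := hS.mono_f
  have := hS.epi_g
  obtain ⟨s', h, φ, hφ, g, hg⟩ := h₃ s (f ≫ S.g) (by rw [reassoc_of% hf, zero_comp])
  let g' := Projective.factorThru g S.g
  have hg' : g' ≫ S.g = g := Projective.factorThru_comp _ _
  let l := hS.exact.lift (φ.f i ≫ f - (res J s').complex.d i (i - 1) ≫ g')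
    (by simp [hg', hg])
  have hl : l ≫ S.f = φ.f i ≫ f - (res J s').complex.d i (i - 1) ≫ g' := hS.exact.lift_f _ _
  obtain ⟨s'', h', ψ, hψ, k, hk⟩ := h₁ s' l (by
    rw [← cancel_mono S.f, Category.assoc, hl]
    simp [← φ.comm_assoc, hf])
  refine Dies.of_map h φ hφ (l ≫ S.f) g' (by rw [hl]; simp) ⟨s'', h', ψ, hψ, k ≫ S.f, ?_⟩
  rw [reassoc_of% hk]

lemma Vanishes.right {S : ShortComplex (ModuleCat.{0} R)} (hS : S.ShortExact) {i : ℕ}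
    (h₂ : Vanishes J i S.X₂) (h₁ : Vanishes J (i + 1) S.X₁) : Vanishes J i S.X₃ := by
  intro s f hf
  have := hS.mono_f
  have := hS.epi_g
  let f' := Projective.factorThru f S.g
  have hf' : f' ≫ S.g = f := Projective.factorThru_comp _ _
  let l := hS.exact.lift ((res J s).complex.d (i + 1) i ≫ f') (by simp [hf', hf])
  have hl : l ≫ S.f = _ := hS.exact.lift_f _ _
  obtain ⟨s', h, φ, hφ, k, hk⟩ := h₁ s l (by
    rw [← cancel_mono S.f, Category.assoc, hl]; simp)
  let k' : (res J s').complex.X i ⟶ S.X₁ := k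
  have hk' : φ.f (i + 1) ≫ l = (res J s').complex.d (i + 1) i ≫ k' := hk
  obtain ⟨s'', h', ψ, hψ, g, hg⟩ := h₂ s' (φ.f i ≫ f' - k' ≫ S.f) (by
    rw [Preadditive.comp_sub, ← φ.comm_assoc, ← hl, reassoc_of% hk', sub_self])
  refine Dies.of_map h φ hφ (φ.f i ≫ f) 0 (by simp) ⟨s'', h', ψ, hψ, g ≫ S.g, ?_⟩
  rw [← reassoc_of% hg]
  simp [hf', S.zero]

/-- An element of `J ^ s` acts on the cohomology of `R ⧸ J ^ s` as zero. -/
lemma smul_eq_coboundary {M : ModuleCat.{0} R} {s i : ℕ} {y : R} (hy : y ∈ J ^ s)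
    (f : (res J s).complex.X i ⟶ M) (hf : (res J s).complex.d (i + 1) i ≫ f = 0) :
    ∃ g, y • f = (res J s).complex.d i (i - 1) ≫ g := by
  have h0 : y • 𝟙 (quotPow J s) = 0 := by
    ext (z : R ⧸ J ^ s)
    obtain ⟨z, rfl⟩ := Ideal.Quotient.mk_surjective z
    change y • Ideal.Quotient.mk (J ^ s) z = 0
    rw [← Ideal.Quotient.mk_eq_mk, ← Submodule.Quotient.mk_smul, Submodule.Quotient.mk_eq_zero]
    exact Ideal.mul_mem_right _ _ hy
  have hπ : (y • 𝟙 (res J s).complex) ≫ (res J s).π = 0 := by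
    have : (y • 𝟙 (res J s).complex) ≫ (res J s).π =
        (res J s).π ≫ (ChainComplex.single₀ _).map (y • 𝟙 (quotPow J s)) := by
      rw [Linear.smul_comp, Category.id_comp]
      apply HomologicalComplex.to_single_hom_ext
      simp only [ChainComplex.single₀_map_f_zero, HomologicalComplex.comp_f,
        HomologicalComplex.smul_f_apply]
      exact ((Linear.comp_smul _ _ _ _ _ _).trans (congrArg _ (Category.comp_id _))).symm
    rw [this, h0, Functor.map_zero, comp_zero]
  let H := ProjectiveResolution.liftHomotopyZero _ hπ
  have := H.comm i
  rw [dNext_nat, prevD_eq _ (show (ComplexShape.down ℕ).Rel (i + 1) i from rfl)] at this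
  refine ⟨H.hom (i - 1) i ≫ f, ?_⟩
  have := congr($this ≫ f)
  simpa [hf] using this

/-- If `x` is regular on `M` with quotient `N`, and degree `i` vanishes on `N`,
then multiplication by `x` is injective on the next degree. -/
lemma Dies.of_smul {M N : ModuleCat.{0} R} {x : R} {p : M ⟶ N} {w}
    (hS : (ShortComplex.mk (x • 𝟙 M) p w).ShortExact) {i : ℕ} (hN : Vanishes J i N)
    {s : ℕ} {f : (res J s).complex.X (i + 1) ⟶ M}
    (hx : Dies J (x • f)) : Dies J f := by
  have : Mono (x • 𝟙 M) := hS.mono_f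
  have : Epi p := hS.epi_g
  have cancel : ∀ {Z : ModuleCat.{0} R} {a b : Z ⟶ M}, x • a = x • b → a = b := by
    intro Z a b hab
    rw [← cancel_mono (x • 𝟙 M)]
    simpa using hab
  have w' : x • p = 0 := by simpa using w
  obtain ⟨s', h, φ, hφ, g, hg⟩ := hx
  let g' : (res J s').complex.X i ⟶ M := g
  have hg' : x • (φ.f (i + 1) ≫ f) = (res J s').complex.d (i + 1) i ≫ g' := by
    rw [← Linear.comp_smul]; exact hg
  obtain ⟨s'', h', ψ, hψ, k, hk⟩ := hN s' (g' ≫ p) (by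
    rw [← Category.assoc, ← hg', Linear.smul_comp, Category.assoc, ← Linear.comp_smul,
      ← Linear.comp_smul, w']
    simp)
  let k' := Projective.factorThru k p
  have hk' : k' ≫ p = k := Projective.factorThru_comp _ _
  let l := hS.exact.lift (ψ.f i ≫ g' - (res J s'').complex.d i (i - 1) ≫ k') (by simp [hk', hk])
  have hl : l ≫ (x • 𝟙 M) = ψ.f i ≫ g' - (res J s'').complex.d i (i - 1) ≫ k' :=
    hS.exact.lift_f _ _
  refine Dies.of_map h φ hφ (φ.f (i + 1) ≫ f) 0 (by simp) ⟨s'', h', ψ, hψ, l, ?_⟩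
  apply cancel
  change _ = x • ((res J s'').complex.d (i + 1) i ≫ l)
  rw [← Linear.comp_smul, hg', ψ.comm_assoc]
  have : x • ((res J s'').complex.d (i + 1) i ≫ l) =
      (res J s'').complex.d (i + 1) i ≫ (l ≫ (x • 𝟙 M)) := by simp
  rw [this, hl]
  simp

lemma Vanishes.succ_of_regular {M N : ModuleCat.{0} R} {x : R} (hx : x ∈ J) {p : M ⟶ N} {w}
    (hS : (ShortComplex.mk (x • 𝟙 M) p w).ShortExact) {i : ℕ} (hN : Vanishes J i N) :
    Vanishes J (i + 1) M := by
  intro s f hf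
  have key : ∀ j : ℕ, Dies J (x ^ j • f) → Dies J f := by
    intro j
    induction j with
    | zero => simp
    | succ j ih =>
      intro h
      refine ih (Dies.of_smul hS hN ?_)
      rwa [smul_smul, ← pow_succ']
  obtain ⟨g, hg⟩ := smul_eq_coboundary (Ideal.pow_mem_pow hx s) f hf
  exact key s (Dies.of_coboundary g hg)

lemma Vanishes.zero_of_mono {M : ModuleCat.{0} R} {x : R} (hx : x ∈ J)
    (hM : Mono (x • 𝟙 M)) : Vanishes J 0 M := by
  intro s f hf
  obtain ⟨g, hg⟩ := smul_eq_coboundary (Ideal.pow_mem_pow hx s) f hf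
  rw [HomologicalComplex.shape _ 0 _ (by simp), zero_comp] at hg
  have : f = 0 := by
    have key : ∀ j : ℕ, x ^ j • f = 0 → f = 0 := by
      intro j
      induction j with
      | zero => simp
      | succ j ih =>
        intro h
        refine ih ?_
        rw [← cancel_mono (x • 𝟙 M)]
        simpa [smul_smul, ← pow_succ'] using h
    exact key s hg
  subst this
  exact Dies.of_coboundary 0 (by simp)

/-- The augmentation of the chosen resolution. -/
noncomputable def aug (J : Ideal R) (s : ℕ) : (res J s).complex.X 0 ⟶ quotPow J s :=
  (res J s).π.f 0

instance (s : ℕ) : Epi (aug J s) := inferInstanceAs (Epi ((res J s).π.f 0))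

/-- An embedding of `R ⧸ J ^ s` obstructs vanishing in degree zero. -/
lemma not_vanishes_zero {M : ModuleCat.{0} R} {s : ℕ} (f : quotPow J s ⟶ M) [Mono f]
    (hJ : J ≠ ⊤) (hs : s ≠ 0) : ¬ Vanishes J 0 M := by
  intro hv
  obtain ⟨s', h, φ, hφ, g, hg⟩ := hv s (aug J s ≫ f) (by
    have : (res J s).complex.d 1 0 ≫ aug J s = 0 := (res J s).complex_d_comp_π_f_zero
    rw [reassoc_of% this, zero_comp])
  rw [HomologicalComplex.shape _ 0 _ (by simp), zero_comp] at hg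
  have h1 : φ.f 0 ≫ aug J s = aug J s' ≫ quotPowProj J h := by
    have := congr(HomologicalComplex.Hom.f $hφ 0)
    simp only [ChainComplex.single₀_map_f_zero, HomologicalComplex.comp_f] at this
    exact this
  rw [reassoc_of% h1] at hg
  have h2 : quotPowProj J h = 0 := by
    rw [← cancel_epi (aug J s'), ← cancel_mono f]
    simpa using hg
  have h3 : (1 : R) ∈ J ^ s := by
    rw [← Ideal.Quotient.eq_zero_iff_mem]
    exact congr($(h2).hom (Ideal.Quotient.mk (J ^ s') 1))
  exact hJ (J.eq_top_iff_one.2 (Ideal.pow_le_self hs h3))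

/-- The map induced by `φ` on the complexes of morphisms to `M`. -/
noncomputable def yonedaMap {A B : ChainComplex (ModuleCat.{0} R) ℕ} (φ : A ⟶ B)
    (M : ModuleCat.{0} R) : B.linearYonedaObj R M ⟶ A.linearYonedaObj R M :=
  (HomologicalComplex.unopFunctor _ _).map
    ((((linearYoneda R (ModuleCat R)).obj M).rightOp.mapHomologicalComplex _).map φ).op

lemma yonedaMap_f {A B : ChainComplex (ModuleCat.{0} R) ℕ} (φ : A ⟶ B)
    (M : ModuleCat.{0} R) (i : ℕ) (f : B.X i ⟶ M) :
    ((yonedaMap φ M).f i).hom f = φ.f i ≫ f := rfl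

lemma ext_map_isoExt {X Y : ModuleCat.{0} R} (g : X ⟶ Y) (P : ProjectiveResolution X)
    (Q : ProjectiveResolution Y) (φ : P.complex ⟶ Q.complex)
    (hφ : φ.f 0 ≫ Q.π.f 0 = P.π.f 0 ≫ g) (i : ℕ) (M : ModuleCat.{0} R) :
    ((Ext R (ModuleCat R) i).map g.op).app M ≫ (P.isoExt i M).hom =
      (Q.isoExt i M).hom ≫ HomologicalComplex.homologyMap (yonedaMap φ M) i := by
  have h1 := ProjectiveResolution.isoLeftDerivedObj_inv_naturality g P Q φ hφ
    ((linearYoneda R (ModuleCat R)).obj M).rightOp i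
  have h2' : (HomologicalComplex.homologyOp (P.complex.linearYonedaObj R M) i).inv ≫
      HomologicalComplex.homologyMap ((HomologicalComplex.opFunctor _ _).map (yonedaMap φ M).op) i =
      (HomologicalComplex.homologyMap (yonedaMap φ M) i).op ≫
        (HomologicalComplex.homologyOp (Q.complex.linearYonedaObj R M) i).inv :=
    (ShortComplex.homologyOpIso_inv_naturality
      ((HomologicalComplex.shortComplexFunctor _ _ i).map (yonedaMap φ M))).symm
  have h1' := congrArg Quiver.Hom.unop h1
  have h2'' := congrArg Quiver.Hom.unop h2'
  refine (Category.assoc _ _ _).symm.trans ?_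
  refine (congrArg (· ≫ (HomologicalComplex.homologyOp (P.complex.linearYonedaObj R M) i).inv.unop)
    h1').trans ?_
  refine (Category.assoc _ _ _).trans ?_
  refine (congrArg ((Q.isoLeftDerivedObj ((linearYoneda R (ModuleCat R)).obj M).rightOp i).inv.unop
     ≫ ·) h2'').trans ?_
  exact (Category.assoc _ _ _).symm

/-- `x` is the class of the cocycle `f`. -/
def IsClass (K : CochainComplex (ModuleCat.{0} R) ℕ) (i : ℕ) (f : K.X i) (x : K.homology i) :
    Prop :=
  ∃ z : K.cycles i, (K.iCycles i).hom z = f ∧ (K.homologyπ i).hom z = x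

lemma exists_isClass_of_class (K : CochainComplex (ModuleCat.{0} R) ℕ) (i : ℕ)
    (x : K.homology i) : ∃ f, (K.d i (i + 1)).hom f = 0 ∧ IsClass K i f x := by
  obtain ⟨z, rfl⟩ := (ModuleCat.epi_iff_surjective (K.homologyπ i)).1 inferInstance x
  exact ⟨_, congr($(K.iCycles_d i (i + 1)).hom z), z, rfl, rfl⟩

lemma exists_isClass_of_cocycle (K : CochainComplex (ModuleCat.{0} R) ℕ) (i : ℕ)
    (f : K.X i) (hf : (K.d i (i + 1)).hom f = 0) : ∃ x, IsClass K i f x := by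
  have := ShortComplex.exact_of_f_is_kernel
    (ShortComplex.mk (K.iCycles i) (K.d i (i + 1)) (K.iCycles_d i (i + 1)))
    (K.cyclesIsKernel i (i + 1) (by simp))
  obtain ⟨z, hz⟩ := (ShortComplex.moduleCat_exact_iff _).1 this f hf
  exact ⟨_, z, hz, rfl⟩

lemma IsClass.map_eq_zero_iff {K L : CochainComplex (ModuleCat.{0} R) ℕ} {i : ℕ} {f : K.X i}
    {x : K.homology i} (h : IsClass K i f x) (ψ : K ⟶ L) :
    (HomologicalComplex.homologyMap ψ i).hom x = 0 ↔
      ∃ g, (ψ.f i).hom f = (L.d (i - 1) i).hom g := by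
  obtain ⟨z, rfl, rfl⟩ := h
  have h1 : (HomologicalComplex.homologyMap ψ i).hom ((K.homologyπ i).hom z) =
      (L.homologyπ i).hom ((HomologicalComplex.cyclesMap ψ i).hom z) :=
    congr($(HomologicalComplex.homologyπ_naturality ψ i).hom z)
  have h2 : (ψ.f i).hom ((K.iCycles i).hom z) =
      (L.iCycles i).hom ((HomologicalComplex.cyclesMap ψ i).hom z) :=
    congr($((HomologicalComplex.cyclesMap_i ψ i).symm).hom z)
  rw [h1, h2]
  generalize (HomologicalComplex.cyclesMap ψ i).hom z = w
  have h3 : ∀ g, (L.d (i - 1) i).hom g = (L.iCycles i).hom ((L.toCycles (i - 1) i).hom g) :=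
    fun g => congr($((L.toCycles_i (i - 1) i).symm).hom g)
  have hprev : (ComplexShape.up ℕ).prev i = i - 1 := by cases i <;> simp
  have hex := ShortComplex.exact_of_g_is_cokernel
    (ShortComplex.mk (L.toCycles (i - 1) i) (L.homologyπ i) (by simp))
    (L.homologyIsCokernel (i - 1) i hprev)
  constructor
  · intro hw
    obtain ⟨g, hg⟩ := (ShortComplex.moduleCat_exact_iff _).1 hex w hw
    exact ⟨g, by rw [h3]; exact congrArg _ hg.symm⟩
  · rintro ⟨g, hg⟩
    rw [h3] at hg
    rw [(ModuleCat.mono_iff_injective (L.iCycles i)).1 inferInstance hg]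
    exact congr($(L.toCycles_comp_homologyπ (i - 1) i).hom g)

variable (J) in
/-- The diagram of the `Ext` modules from `R ⧸ J ^ s` to `M`. -/
noncomputable abbrev extDiagram (i : ℕ) (M : ModuleCat.{0} R) : (ℕᵒᵖ)ᵒᵖ ⥤ ModuleCat.{0} R :=
  localCohomology.diagram (localCohomology.idealPowersDiagram J) i ⋙ (evaluation _ _).obj M

lemma subsingleton_localCohomology_iff_colimit (i : ℕ) (M : ModuleCat.{0} R) :
    Subsingleton ((localCohomology J i).obj M) ↔
      ∀ (s : ℕ) (x : (extDiagram J i M).obj (op (op s))), ∃ (s' : ℕ) (h : s ≤ s'),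
        ((extDiagram J i M).map (homOfLE h).op.op).hom x = 0 := by
  let e : (localCohomology J i).obj M ≅ colimit (extDiagram J i M) :=
    colimitObjIsoColimitCompEvaluation _ _
  rw [e.toLinearEquiv.toEquiv.subsingleton_congr]
  constructor
  · intro hs s x
    obtain ⟨j, k, hk⟩ := Concrete.colimit_rep_eq_zero (R := R) (extDiagram J i M) (op (op s)) x
      (Subsingleton.elim _ _)
    exact ⟨j.unop.unop, leOfHom k.unop.unop, hk⟩
  · intro h
    refine subsingleton_of_forall_eq 0 fun y => ?_
    obtain ⟨j, x, rfl⟩ := Concrete.colimit_exists_rep (extDiagram J i M) y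
    obtain ⟨s', h, hx⟩ := h j.unop.unop x
    have := colimit.w (extDiagram J i M) (homOfLE h).op.op
    rw [← this]
    change (colimit.ι (extDiagram J i M) (op (op s'))).hom
      (((extDiagram J i M).map (homOfLE h).op.op).hom x) = 0
    rw [hx, map_zero]

lemma extDiagram_map_eq_zero_iff {i s s' : ℕ} {M : ModuleCat.{0} R} (h : s ≤ s')
    {φ : (res J s').complex ⟶ (res J s).complex}
    (hφ : φ ≫ (res J s).π = (res J s').π ≫ (ChainComplex.single₀ _).map (quotPowProj J h))
    {f : (res J s).complex.X i ⟶ M} {x : (extDiagram J i M).obj (op (op s))}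
    (hx : IsClass ((res J s).complex.linearYonedaObj R M) i f (((res J s).isoExt i M).hom.hom x)) :
    ((extDiagram J i M).map (homOfLE h).op.op).hom x = 0 ↔
      ∃ g : (res J s').complex.X (i - 1) ⟶ M, φ.f i ≫ f = (res J s').complex.d i (i - 1) ≫ g := by
  have h0 : φ.f 0 ≫ (res J s).π.f 0 = (res J s').π.f 0 ≫ quotPowProj J h := by
    have := congr(HomologicalComplex.Hom.f $hφ 0)
    simp only [ChainComplex.single₀_map_f_zero, HomologicalComplex.comp_f] at this
    exact this
  have h1 := congr($(ext_map_isoExt _ _ _ φ h0 i M).hom x)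
  refine Iff.trans ?_ (hx.map_eq_zero_iff (yonedaMap φ M))
  refine Iff.trans ?_ (Eq.congr_left h1)
  exact ((res J s').isoExt i M).toLinearEquiv.map_eq_zero_iff.symm

theorem subsingleton_localCohomology_iff (i : ℕ) (M : ModuleCat.{0} R) :
    Subsingleton ((localCohomology J i).obj M) ↔ Vanishes J i M := by
  rw [subsingleton_localCohomology_iff_colimit]
  constructor
  · intro H s f hf
    obtain ⟨x, hx⟩ := exists_isClass_of_cocycle ((res J s).complex.linearYonedaObj R M) i f hf
    obtain ⟨x, rfl⟩ := ((res J s).isoExt i M).toLinearEquiv.surjective x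
    obtain ⟨s', h, hs⟩ := H s x
    have hφ := ProjectiveResolution.lift_commutes (quotPowProj J h) (res J s') (res J s)
    exact ⟨s', h, _, hφ, (extDiagram_map_eq_zero_iff h hφ hx).1 hs⟩
  · intro H s x
    obtain ⟨f, hf, hx⟩ := exists_isClass_of_class ((res J s).complex.linearYonedaObj R M) i
      (((res J s).isoExt i M).hom.hom x)
    obtain ⟨s', h, φ, hφ, hs⟩ := H s f hf
    exact ⟨s', h, (extDiagram_map_eq_zero_iff h hφ hx).2 hs⟩

end Cochains

section Quotients
variable {R : Type} [CommRing R] {J : Ideal R}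

/-- Multiplication by `f` as a map `R ⧸ I' → R ⧸ I`. -/
noncomputable def mulQuot (I I' : Ideal R) (f : R) (h : ∀ g ∈ I', f * g ∈ I) :
    (R ⧸ I') →ₗ[R] (R ⧸ I) :=
  Submodule.mapQ I' I (LinearMap.mulLeft R f) h

lemma mulQuot_mk (I I' : Ideal R) (f : R) (h : ∀ g ∈ I', f * g ∈ I) (g : R) :
    mulQuot I I' f h (Ideal.Quotient.mk I' g) = Ideal.Quotient.mk I (f * g) := rfl

/-- The projection `R ⧸ I → R ⧸ (I ⊔ (f))`. -/
noncomputable def projQuot (I : Ideal R) (f : R) : (R ⧸ I) →ₗ[R] (R ⧸ (I ⊔ Ideal.span {f})) :=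
  Submodule.mapQ I _ LinearMap.id (fun _ hx => Ideal.mem_sup_left hx)

lemma projQuot_mk (I : Ideal R) (f g : R) :
    projQuot I f (Ideal.Quotient.mk I g) = Ideal.Quotient.mk _ g := rfl

lemma shortExact_colon {I I' : Ideal R} {f : R} (h : ∀ g, g ∈ I' ↔ f * g ∈ I) (w) :
    (ShortComplex.mk (ModuleCat.ofHom (mulQuot I I' f fun g => (h g).1))
      (ModuleCat.ofHom (projQuot I f)) w).ShortExact := by
  apply ModuleCat.shortComplex_shortExact
  · intro x
    obtain ⟨x, rfl⟩ := Ideal.Quotient.mk_surjective x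
    simp only [projQuot_mk, Set.mem_range, ModuleCat.hom_ofHom]
    rw [Ideal.Quotient.eq_zero_iff_mem, Submodule.mem_sup]
    constructor
    · rintro ⟨y, hy, z, hz, rfl⟩
      obtain ⟨g, rfl⟩ := Ideal.mem_span_singleton'.1 hz
      refine ⟨Ideal.Quotient.mk _ g, ?_⟩
      rw [mulQuot_mk, Ideal.Quotient.eq]
      convert I.neg_mem hy using 1
      ring
    · rintro ⟨y, hy⟩
      obtain ⟨y, rfl⟩ := Ideal.Quotient.mk_surjective y
      rw [mulQuot_mk, Ideal.Quotient.eq] at hy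
      exact ⟨_, I.neg_mem hy, _, Ideal.mem_span_singleton'.2 ⟨y, rfl⟩, by ring⟩
  · rw [injective_iff_map_eq_zero (ModuleCat.Hom.hom _)]
    intro x hx
    obtain ⟨x, rfl⟩ := Ideal.Quotient.mk_surjective x
    simp only [ModuleCat.hom_ofHom, mulQuot_mk] at hx
    rw [Ideal.Quotient.eq_zero_iff_mem] at hx
    rw [Ideal.Quotient.eq_zero_iff_mem]
    exact (h x).2 hx
  · intro x
    obtain ⟨x, rfl⟩ := Ideal.Quotient.mk_surjective x
    exact ⟨Ideal.Quotient.mk _ x, rfl⟩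

lemma colon_comp_eq_zero {I I' : Ideal R} {f : R} (h : ∀ g, g ∈ I' ↔ f * g ∈ I) :
    ModuleCat.ofHom (mulQuot I I' f fun g => (h g).1) ≫ ModuleCat.ofHom (projQuot I f) = 0 := by
  refine ModuleCat.hom_ext (LinearMap.ext fun x => ?_)
  obtain ⟨x, rfl⟩ := Ideal.Quotient.mk_surjective x
  simp only [ModuleCat.hom_comp, ModuleCat.hom_ofHom, LinearMap.comp_apply, mulQuot_mk,
    projQuot_mk, ModuleCat.hom_zero, LinearMap.zero_apply]
  rw [Ideal.Quotient.eq_zero_iff_mem]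
  exact Ideal.mem_sup_right (Ideal.mul_mem_right _ _ (Ideal.mem_span_singleton_self f))

lemma mulQuot_self {I : Ideal R} {f : R} (h : ∀ g ∈ I, f * g ∈ I) :
    ModuleCat.ofHom (mulQuot I I f h) = f • 𝟙 (ModuleCat.of R (R ⧸ I)) := by
  refine ModuleCat.hom_ext (LinearMap.ext fun x => ?_)
  obtain ⟨x, rfl⟩ := Ideal.Quotient.mk_surjective x
  rfl

variable (J) in
/-- All local cohomology of `R ⧸ I` in degrees below `r` vanishes. -/
def DepthGE (r : ℕ) (I : Ideal R) : Prop :=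
  ∀ i < r, Vanishes J i (ModuleCat.of R (R ⧸ I))

lemma DepthGE.zero (I : Ideal R) : DepthGE J 0 I := fun _ h => absurd h (Nat.not_lt_zero _)

lemma DepthGE.mono {r r' : ℕ} {I : Ideal R} (h : DepthGE J r I) (hr : r' ≤ r) :
    DepthGE J r' I := fun i hi => h i (hi.trans_le hr)

lemma DepthGE.top (r : ℕ) : DepthGE J r (⊤ : Ideal R) := by
  intro i _ s f _
  refine Dies.of_coboundary 0 ?_
  have : Subsingleton (R ⧸ (⊤ : Ideal R)) := Ideal.Quotient.subsingleton_iff.2 rfl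
  ext x
  exact Subsingleton.elim (α := R ⧸ (⊤ : Ideal R)) _ _

lemma DepthGE.of_colon {r : ℕ} {I I' : Ideal R} {f : R} (h : ∀ g, g ∈ I' ↔ f * g ∈ I)
    (h₁ : DepthGE J r I') (h₂ : DepthGE J r (I ⊔ Ideal.span {f})) : DepthGE J r I :=
  fun i hi => Vanishes.mid (shortExact_colon h (colon_comp_eq_zero h)) (h₁ i hi) (h₂ i hi)

lemma shortExact_regular {I : Ideal R} {f : R} (h : ∀ g, g ∈ I ↔ f * g ∈ I) :
    ∃ w, (ShortComplex.mk (f • 𝟙 (ModuleCat.of R (R ⧸ I)))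
      (ModuleCat.ofHom (projQuot I f)) w).ShortExact := by
  have := shortExact_colon h (colon_comp_eq_zero h)
  have e := mulQuot_self (I := I) fun g => (h g).1
  rw [← e]
  exact ⟨_, this⟩

lemma DepthGE.succ_of_regular {r : ℕ} {I : Ideal R} {f : R} (hf : f ∈ J)
    (h : ∀ g, g ∈ I ↔ f * g ∈ I) (h₂ : DepthGE J r (I ⊔ Ideal.span {f})) :
    DepthGE J (r + 1) I := by
  obtain ⟨w, hS⟩ := shortExact_regular h
  rintro (_ | i) hi
  · exact Vanishes.zero_of_mono hf hS.mono_f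
  · exact Vanishes.succ_of_regular hf hS (h₂ i (by omega))

/-- Some local cohomology of `R ⧸ I` at a maximal ideal containing `I` does not vanish. -/
lemma exists_not_vanishes [IsNoetherianRing R] [hJ : J.IsMaximal] (I : Ideal R) (hI : I ≤ J) :
    ∃ i, ¬ Vanishes J i (ModuleCat.of R (R ⧸ I)) := by
  induction I using WellFoundedGT.induction with
  | ind I ih =>
  by_cases hreg : ∃ x ∈ J, IsSMulRegular (R ⧸ I) x
  · obtain ⟨x, hxJ, hx⟩ := hreg
    have h : ∀ g, g ∈ I ↔ x * g ∈ I := fun g => by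
      refine ⟨fun hg => I.mul_mem_left _ hg, fun hg => ?_⟩
      rw [← Ideal.Quotient.eq_zero_iff_mem]
      apply hx
      exact (Ideal.Quotient.eq_zero_iff_mem.2 hg).trans (smul_zero x).symm
    have hxI : x ∉ I := fun hxI => by
      have : (1 : R) ∈ I := (h 1).2 (by simpa using hxI)
      exact hJ.ne_top ((Ideal.eq_top_iff_one _).2 (hI this))
    have hlt : I < I ⊔ Ideal.span {x} := lt_of_le_of_ne le_sup_left fun e =>
      hxI (e ▸ Ideal.mem_sup_right (Ideal.mem_span_singleton_self x))
    obtain ⟨i, hi⟩ := ih _ hlt (sup_le hI ((Ideal.span_singleton_le_iff_mem _).2 hxJ))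
    by_contra! hv
    obtain ⟨w, hS⟩ := shortExact_regular h
    exact hi (Vanishes.right hS (hv i) (hv (i + 1)))
  · have h1 : ¬ Subsingleton ((R ⧸ J) →ₗ[R] (R ⧸ I)) := by
      rw [IsSMulRegular.subsingleton_linearMap_iff, Ideal.annihilator_quotient]
      exact hreg
    rw [not_subsingleton_iff_nontrivial] at h1
    obtain ⟨f, hf⟩ := exists_ne (0 : (R ⧸ J) →ₗ[R] (R ⧸ I))
    have : IsSimpleModule R (R ⧸ J) := isSimpleModule_iff_isCoatom.2 hJ.out
    have hinj : Function.Injective f := by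
      rcases LinearMap.injective_or_eq_zero f with h | h
      · exact h
      · exact absurd h hf
    refine ⟨0, ?_⟩
    let e : (R ⧸ J ^ 1) →ₗ[R] (R ⧸ I) :=
      f ∘ₗ (Submodule.quotEquivOfEq _ _ (pow_one J)).toLinearMap
    have he : Function.Injective e := hinj.comp (Submodule.quotEquivOfEq _ _ (pow_one J)).injective
    let e' : quotPow J 1 ⟶ ModuleCat.of R (R ⧸ I) := ModuleCat.ofHom e
    have : Mono e' := (ModuleCat.mono_iff_injective e').2 he
    exact not_vanishes_zero e' hJ.ne_top one_ne_zero

end Quotients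

end LocalCohomologyVanishing

namespace MonomialIdealDepth
open LocalCohomologyVanishing

section Rules
variable (k : Type) [Field k] {V : Type}

/-- The monomial ideal generated by the monomials with exponents in `U`. -/
noncomputable def monIdeal (U : Set (V →₀ ℕ)) : Ideal (MvPolynomial V k) :=
  Ideal.span ((fun s => monomial s 1) '' U)

variable {k}

lemma mem_monIdeal {U : Set (V →₀ ℕ)} (hU : IsUpperSet U) {f : MvPolynomial V k} :
    f ∈ monIdeal k U ↔ ∀ b, coeff b f ≠ 0 → b ∈ U := by
  rw [monIdeal, mem_ideal_span_monomial_image]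
  simp only [mem_support_iff]
  exact forall₂_congr fun b _ => ⟨fun ⟨a, ha, hab⟩ => hU hab ha, fun h => ⟨b, h, le_rfl⟩⟩

lemma monIdeal_sup (U : Set (V →₀ ℕ)) (a : V →₀ ℕ) :
    monIdeal k U ⊔ Ideal.span {monomial a 1} = monIdeal k (U ∪ Set.Ici a) := by
  apply le_antisymm
  · refine sup_le (Ideal.span_mono (Set.image_mono Set.subset_union_left)) ?_
    rw [Ideal.span_singleton_le_iff_mem]
    exact Ideal.subset_span ⟨a, Or.inr (Set.mem_Ici.2 le_rfl), rfl⟩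
  · rw [monIdeal, Ideal.span_le]
    rintro _ ⟨b, hb | hb, rfl⟩
    · exact Ideal.mem_sup_left (Ideal.subset_span ⟨b, hb, rfl⟩)
    · refine Ideal.mem_sup_right (Ideal.mem_span_singleton.2 ?_)
      simpa using (monomial_dvd_monomial (R := k) (r := 1) (s := 1)).2 ⟨Or.inr hb, dvd_rfl⟩

lemma mem_monIdeal_colon {U U' : Set (V →₀ ℕ)} (hU : IsUpperSet U) {a : V →₀ ℕ}
    (h : ∀ b, b + a ∈ U ↔ b ∈ U') (g : MvPolynomial V k) :
    g ∈ monIdeal k U' ↔ monomial a 1 * g ∈ monIdeal k U := by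
  have hU' : IsUpperSet U' := fun b c hbc hb =>
    (h c).1 (hU (add_le_add_left hbc a) ((h b).2 hb))
  rw [mem_monIdeal hU, mem_monIdeal hU']
  constructor
  · intro hg b hb
    rw [coeff_monomial_mul'] at hb
    split_ifs at hb with hab
    · have := (h _).2 (hg (b - a) (by simpa using hb))
      rwa [tsub_add_cancel_of_le hab] at this
    · exact absurd rfl hb
  · intro hg b hb
    refine (h b).1 (hg _ ?_)
    rw [add_comm, coeff_monomial_mul, one_mul]
    exact hb

variable (k) in
/-- `S ⧸ monIdeal U` has no local cohomology in degrees below `r`. -/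
def MonDepthGE (r : ℕ) (U : Set (V →₀ ℕ)) : Prop :=
  DepthGE (maxHomIdeal k V) r (monIdeal k U)

lemma monIdeal_univ : monIdeal k (Set.univ : Set (V →₀ ℕ)) = ⊤ := by
  rw [Ideal.eq_top_iff_one]
  exact Ideal.subset_span ⟨0, trivial, rfl⟩

lemma MonDepthGE.univ (r : ℕ) : MonDepthGE k r (Set.univ : Set (V →₀ ℕ)) := by
  rw [MonDepthGE, monIdeal_univ]
  exact DepthGE.top r

lemma MonDepthGE.of_colon {r : ℕ} {U U₁ U₂ : Set (V →₀ ℕ)} (hU : IsUpperSet U) (a : V →₀ ℕ)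
    (h₁ : ∀ b, b + a ∈ U ↔ b ∈ U₁) (h₂ : ∀ b, b ∈ U ∨ a ≤ b ↔ b ∈ U₂)
    (hd₁ : MonDepthGE k r U₁) (hd₂ : MonDepthGE k r U₂) : MonDepthGE k r U := by
  have e : U ∪ Set.Ici a = U₂ := Set.ext h₂
  refine DepthGE.of_colon (mem_monIdeal_colon hU h₁) hd₁ ?_
  rw [monIdeal_sup, e]
  exact hd₂

lemma MonDepthGE.succ {r : ℕ} {U U₂ : Set (V →₀ ℕ)} (hU : IsUpperSet U) (v : V)
    (h₁ : ∀ b, b + Finsupp.single v 1 ∈ U → b ∈ U)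
    (h₂ : ∀ b, b ∈ U ∨ Finsupp.single v 1 ≤ b ↔ b ∈ U₂)
    (hd₂ : MonDepthGE k r U₂) : MonDepthGE k (r + 1) U := by
  have e : U ∪ Set.Ici (Finsupp.single v 1) = U₂ := Set.ext h₂
  refine DepthGE.succ_of_regular (f := monomial (Finsupp.single v 1) 1)
    (Ideal.subset_span ⟨v, rfl⟩)
    (mem_monIdeal_colon hU fun b => ⟨h₁ b, hU le_self_add⟩) ?_
  rw [monIdeal_sup, e]
  exact hd₂

end Rules

section Graphs
variable {V : Type} (G H : SimpleGraph V) (N : Set V)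

/-- The exponent of the monomial attached to a pair of vertices. -/
noncomputable def pairExp (p : V × V) : V →₀ ℕ := Finsupp.single p.1 1 + Finsupp.single p.2 1

/-- The exponent of the product of the monomials attached to several pairs. -/
noncomputable def pairsExp (L : Multiset (V × V)) : V →₀ ℕ := (L.map pairExp).sum

/-- Exponents of the monomials divisible by a product of `t` edges of `G`. -/
def powExps (t : ℕ) : Set (V →₀ ℕ) :=
  {a | ∃ L : Multiset (V × V), L.card = t ∧ (∀ p ∈ L, G.Adj p.1 p.2) ∧ pairsExp L ≤ a}

/-- Exponents of the monomials divisible by an edge of `H` or a variable in `N`. -/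
def edgeExps : Set (V →₀ ℕ) :=
  {a | (∃ u v, H.Adj u v ∧ a u ≠ 0 ∧ a v ≠ 0) ∨ ∃ v ∈ N, a v ≠ 0}

variable {G H N}

lemma pairExp_le_iff {u v : V} (huv : u ≠ v) {a : V →₀ ℕ} :
    pairExp (u, v) ≤ a ↔ a u ≠ 0 ∧ a v ≠ 0 := by
  classical
  constructor
  · intro h
    have h1 := h u
    have h2 := h v
    simp [pairExp, huv, huv.symm] at h1 h2
    omega
  · rintro ⟨h1, h2⟩ w
    simp only [pairExp, Finsupp.add_apply, Finsupp.single_apply]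
    split_ifs with h3 h4 h4
    · exact absurd (h3.trans h4.symm) huv
    · subst h3; omega
    · subst h4; omega
    · omega

lemma pairsExp_cons (p : V × V) (L : Multiset (V × V)) :
    pairsExp (p ::ₘ L) = pairExp p + pairsExp L := by
  simp [pairsExp]

lemma pairsExp_apply_eq_zero {L : Multiset (V × V)} {v : V}
    (h : ∀ p ∈ L, p.1 ≠ v ∧ p.2 ≠ v) : pairsExp L v = 0 := by
  induction L using Multiset.induction with
  | empty => rfl
  | cons p L ih =>
    rw [pairsExp_cons, Finsupp.add_apply, ih fun q hq => h q (Multiset.mem_cons_of_mem hq)]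
    have := h p (Multiset.mem_cons_self _ _)
    simp [pairExp, this.1, this.2]

lemma isUpperSet_powExps (t : ℕ) : IsUpperSet (powExps G t) :=
  fun _ _ hab ⟨L, h1, h2, h3⟩ => ⟨L, h1, h2, h3.trans hab⟩

lemma ne_zero_of_le {a b : V →₀ ℕ} (h : a ≤ b) {v : V} (ha : a v ≠ 0) : b v ≠ 0 := by
  have := h v
  omega

lemma isUpperSet_edgeExps : IsUpperSet (edgeExps H N) := by
  rintro a b hab (⟨u, v, h, hu, hv⟩ | ⟨v, h, hv⟩)
  · exact Or.inl ⟨u, v, h, ne_zero_of_le hab hu, ne_zero_of_le hab hv⟩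
  · exact Or.inr ⟨v, h, ne_zero_of_le hab hv⟩

lemma powExps_zero : powExps G 0 = Set.univ :=
  Set.eq_univ_of_forall fun _ => ⟨0, rfl, by simp, by simp [pairsExp]⟩

lemma powExps_succ_subset (t : ℕ) {a : V →₀ ℕ} (ha : a ∈ powExps G (t + 1)) :
    ∃ u v, G.Adj u v ∧ a u ≠ 0 ∧ a v ≠ 0 := by
  obtain ⟨L, h1, h2, h3⟩ := ha
  obtain ⟨p, hpL⟩ := Multiset.card_pos_iff_exists_mem.1 (by rw [h1]; exact Nat.succ_pos t)
  obtain ⟨L, rfl⟩ := Multiset.exists_cons_of_mem hpL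
  have hp := h2 p (Multiset.mem_cons_self _ _)
  rw [pairsExp_cons] at h3
  exact ⟨p.1, p.2, hp, (pairExp_le_iff hp.ne).1 (le_self_add.trans h3)⟩

lemma pairExp_swap (p : V × V) : pairExp p.swap = pairExp p := add_comm _ _

lemma add_pairExp_ne_zero {a : V →₀ ℕ} {u v w : V} (h : (a + pairExp (u, v)) w ≠ 0)
    (hu : w ≠ u) (hv : w ≠ v) : a w ≠ 0 := by
  simpa [pairExp, hu.symm, hv.symm, Finsupp.single_apply] using h

lemma mem_powExps_of_add {t : ℕ} {a : V →₀ ℕ} {u v : V} (huv : u ≠ v)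
    (ha : a + pairExp (u, v) ∈ powExps G (t + 1))
    (hv : ∀ w, G.Adj v w → (a + pairExp (u, v)) w ≠ 0 → w = u) : a ∈ powExps G t := by
  classical
  obtain ⟨L, h1, h2, h3⟩ := ha
  have hle : ∀ p ∈ L, (a + pairExp (u, v)) p.1 ≠ 0 ∧ (a + pairExp (u, v)) p.2 ≠ 0 := by
    intro p hp
    rw [← pairExp_le_iff (h2 p hp).ne]
    refine le_trans ?_ h3
    rw [← Multiset.cons_erase hp, pairsExp_cons]
    exact le_self_add
  by_cases hL : ∃ p ∈ L, p.1 = v ∨ p.2 = v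
  · obtain ⟨p, hp, hpv⟩ := hL
    have hpe : pairExp p = pairExp (u, v) := by
      obtain ⟨x, y⟩ := p
      rcases hpv with rfl | rfl
      · have : y = u := hv y (h2 _ hp) (hle _ hp).2
        subst this
        exact (pairExp_swap _).symm
      · have : x = u := hv x (h2 _ hp).symm (hle _ hp).1
        subst this
        rfl
    refine ⟨L.erase p, by rw [Multiset.card_erase_of_mem hp, h1]; rfl,
      fun q hq => h2 q (Multiset.mem_of_mem_erase hq), ?_⟩
    rw [← Multiset.cons_erase hp, pairsExp_cons, hpe, add_comm] at h3
    exact le_of_add_le_add_right h3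
  · push Not at hL
    obtain ⟨p, hp, hpu⟩ : ∃ p ∈ L, (∃ q ∈ L, q.1 = u ∨ q.2 = u) → p.1 = u ∨ p.2 = u := by
      by_cases hq : ∃ q ∈ L, q.1 = u ∨ q.2 = u
      · obtain ⟨q, hq, hqu⟩ := hq
        exact ⟨q, hq, fun _ => hqu⟩
      · obtain ⟨p, hp⟩ := Multiset.card_pos_iff_exists_mem.1 (by rw [h1]; exact Nat.succ_pos t)
        exact ⟨p, hp, fun h => absurd h hq⟩
    refine ⟨L.erase p, by rw [Multiset.card_erase_of_mem hp, h1]; rfl,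
      fun q hq => h2 q (Multiset.mem_of_mem_erase hq), fun w => ?_⟩
    rw [← Multiset.cons_erase hp, pairsExp_cons] at h3
    have h3w := h3 w
    simp only [Finsupp.add_apply] at h3w
    by_cases hwv : w = v
    · subst hwv
      rw [pairsExp_apply_eq_zero fun q hq => hL q (Multiset.mem_of_mem_erase hq)]
      exact Nat.zero_le _
    by_cases hwu : w = u
    · subst hwu
      by_cases hq : ∃ q ∈ L, q.1 = w ∨ q.2 = w
      · have h5 : 1 ≤ pairExp p w := by
          rcases hpu hq with h | h <;> simp [pairExp, h]
        have h6 : pairExp (w, v) w = 1 := by simp [pairExp, huv.symm]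
        omega
      · push Not at hq
        rw [pairsExp_apply_eq_zero fun q hq' => hq q (Multiset.mem_of_mem_erase hq')]
        exact Nat.zero_le _
    · have h6 : pairExp (u, v) w = 0 := by simp [pairExp, Ne.symm hwu, Ne.symm hwv]
      omega

lemma mem_powExps_add {t : ℕ} {a : V →₀ ℕ} {u v : V} (huv : G.Adj u v)
    (ha : a ∈ powExps G t) : a + pairExp (u, v) ∈ powExps G (t + 1) := by
  obtain ⟨L, h1, h2, h3⟩ := ha
  refine ⟨(u, v) ::ₘ L, by simp [h1], ?_, ?_⟩
  · intro p hp
    rcases Multiset.mem_cons.1 hp with rfl | hp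
    · exact huv
    · exact h2 p hp
  · rw [pairsExp_cons, add_comm]
    exact add_le_add_left h3 _

lemma add_pairExp_mem_iff {t : ℕ} {a : V →₀ ℕ} {u v : V} (huv : G.Adj u v) (hH : ¬ H.Adj u v)
    (hu : u ∉ N) (hvN : v ∉ N) (hv : ∀ w, G.Adj v w → ¬ H.Adj v w → w ∉ N → w = u) :
    a + pairExp (u, v) ∈ powExps G (t + 1) ∪ edgeExps H N ↔
      a ∈ powExps G t ∪ edgeExps H (N ∪ {w | H.Adj u w ∨ H.Adj v w}) := by
  have hpos := (pairExp_le_iff huv.ne).1 (le_add_self : pairExp (u, v) ≤ a + pairExp (u, v))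
  have hle : a ≤ a + pairExp (u, v) := le_self_add
  constructor
  · intro h
    by_cases hN : ∃ w ∈ N ∪ {w | H.Adj u w ∨ H.Adj v w}, a w ≠ 0
    · exact Or.inr (Or.inr hN)
    push Not at hN
    have key : ∀ x y, H.Adj x y → (a + pairExp (u, v)) y ≠ 0 → x ≠ u ∧ x ≠ v := by
      intro x y hxy hy
      constructor
      · rintro rfl
        refine add_pairExp_ne_zero hy hxy.ne' ?_ (hN y (Or.inr (Or.inl hxy)))
        rintro rfl
        exact hH hxy
      · rintro rfl
        refine add_pairExp_ne_zero hy ?_ hxy.ne' (hN y (Or.inr (Or.inr hxy)))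
        rintro rfl
        exact hH hxy.symm
    rcases h with h | ⟨x, y, hxy, hx, hy⟩ | ⟨w, hw, hw'⟩
    · refine Or.inl (mem_powExps_of_add huv.ne h fun w hw hw' => ?_)
      by_contra hwu
      have := add_pairExp_ne_zero hw' hwu hw.ne'
      refine hwu (hv w hw (fun h => this (hN w (Or.inr (Or.inr h)))) fun h => this ?_)
      exact hN w (Or.inl h)
    · obtain ⟨h1, h2⟩ := key x y hxy hy
      obtain ⟨h3, h4⟩ := key y x hxy.symm hx
      exact Or.inr (Or.inl ⟨x, y, hxy, add_pairExp_ne_zero hx h1 h2,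
        add_pairExp_ne_zero hy h3 h4⟩)
    · refine absurd (hN w (Or.inl hw)) (add_pairExp_ne_zero hw' ?_ ?_)
      · rintro rfl; exact hu hw
      · rintro rfl; exact hvN hw
  · rintro (h | ⟨x, y, hxy, hx, hy⟩ | ⟨w, hw | hw | hw, hw'⟩)
    · exact Or.inl (mem_powExps_add huv h)
    · exact Or.inr (Or.inl ⟨x, y, hxy, ne_zero_of_le hle hx, ne_zero_of_le hle hy⟩)
    · exact Or.inr (Or.inr ⟨w, hw, ne_zero_of_le hle hw'⟩)
    · exact Or.inr (Or.inl ⟨u, w, hw, hpos.1, ne_zero_of_le hle hw'⟩)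
    · exact Or.inr (Or.inl ⟨v, w, hw, hpos.2, ne_zero_of_le hle hw'⟩)

lemma mem_edgeExps_sup_edge {a : V →₀ ℕ} {u v : V} (huv : u ≠ v) :
    a ∈ edgeExps (H ⊔ SimpleGraph.edge u v) N ↔ a ∈ edgeExps H N ∨ pairExp (u, v) ≤ a := by
  rw [pairExp_le_iff huv]
  constructor
  · rintro (⟨x, y, hxy, hx, hy⟩ | h)
    · rw [SimpleGraph.sup_adj, SimpleGraph.edge_adj] at hxy
      rcases hxy with hxy | ⟨⟨rfl, rfl⟩ | ⟨rfl, rfl⟩, -⟩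
      · exact Or.inl (Or.inl ⟨x, y, hxy, hx, hy⟩)
      · exact Or.inr ⟨hx, hy⟩
      · exact Or.inr ⟨hy, hx⟩
    · exact Or.inl (Or.inr h)
  · rintro ((⟨x, y, hxy, hx, hy⟩ | h) | ⟨hu, hv⟩)
    · exact Or.inl ⟨x, y, Or.inl hxy, hx, hy⟩
    · exact Or.inr h
    · refine Or.inl ⟨u, v, Or.inr ?_, hu, hv⟩
      rw [SimpleGraph.edge_adj]
      exact ⟨Or.inl ⟨rfl, rfl⟩, huv⟩

lemma mem_edgeExps_insert {a : V →₀ ℕ} {v : V} :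
    a ∈ edgeExps H (insert v N) ↔ a ∈ edgeExps H N ∨ Finsupp.single v 1 ≤ a := by
  rw [Finsupp.single_le_iff, Nat.one_le_iff_ne_zero]
  constructor
  · rintro (h | ⟨w, rfl | hw, hw'⟩)
    · exact Or.inl (Or.inl h)
    · exact Or.inr hw'
    · exact Or.inl (Or.inr ⟨w, hw, hw'⟩)
  · rintro ((h | ⟨w, hw, hw'⟩) | h)
    · exact Or.inl h
    · exact Or.inr ⟨w, Or.inr hw, hw'⟩
    · exact Or.inr ⟨v, Or.inl rfl, h⟩

lemma add_single_mem_edgeExps_iff {a : V →₀ ℕ} {u : V} (hu : u ∉ N) :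
    a + Finsupp.single u 1 ∈ edgeExps H N ↔ a ∈ edgeExps H (N ∪ {w | H.Adj u w}) := by
  classical
  have hne : ∀ w, w ≠ u → (a + Finsupp.single u 1 : V →₀ ℕ) w = a w := fun w hw => by
    simp [hw]
  have hle : a ≤ a + Finsupp.single u 1 := le_self_add
  constructor
  · rintro (⟨x, y, hxy, hx, hy⟩ | ⟨w, hw, hw'⟩)
    · by_cases hxu : x = u
      · subst hxu
        rw [hne y hxy.ne'] at hy
        exact Or.inr ⟨y, Or.inr hxy, hy⟩
      rw [hne x hxu] at hx
      by_cases hyu : y = u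
      · subst hyu
        exact Or.inr ⟨x, Or.inr hxy.symm, hx⟩
      rw [hne y hyu] at hy
      exact Or.inl ⟨x, y, hxy, hx, hy⟩
    · rw [hne w (by rintro rfl; exact hu hw)] at hw'
      exact Or.inr ⟨w, Or.inl hw, hw'⟩
  · rintro (⟨x, y, hxy, hx, hy⟩ | ⟨w, hw | hw, hw'⟩)
    · exact Or.inl ⟨x, y, hxy, ne_zero_of_le hle hx, ne_zero_of_le hle hy⟩
    · exact Or.inr ⟨w, hw, ne_zero_of_le hle hw'⟩
    · exact Or.inl ⟨u, w, hw, by simp, ne_zero_of_le hle hw'⟩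

variable (G N) in
/-- `Y` is an independent set of vertices outside `N` such that, outside `N`, every vertex of `Y`
has at most one neighbour and every vertex has at most one neighbour in `Y`. -/
structure IsPendantLike (Y : Finset V) : Prop where
  notMem : ∀ y ∈ Y, y ∉ N
  indep : ∀ y ∈ Y, ∀ z ∈ Y, ¬ G.Adj y z
  eq_of_adj : ∀ y ∈ Y, ∀ w w', G.Adj y w → G.Adj y w' → w ∉ N → w' ∉ N → w = w'
  eq_of_mem : ∀ w, w ∉ N → ∀ y ∈ Y, ∀ z ∈ Y, G.Adj w y → G.Adj w z → y = z

lemma IsPendantLike.mono {Y Y' : Finset V} {N' : Set V} (h : IsPendantLike G N Y) (hY : Y' ⊆ Y)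
    (hN : N ⊆ N') (hd : ∀ y ∈ Y', y ∉ N') : IsPendantLike G N' Y' where
  notMem := hd
  indep y hy z hz := h.indep y (hY hy) z (hY hz)
  eq_of_adj y hy w w' h1 h2 h3 h4 :=
    h.eq_of_adj y (hY hy) w w' h1 h2 (fun e => h3 (hN e)) fun e => h4 (hN e)
  eq_of_mem w hw y hy z hz := h.eq_of_mem w (fun e => hw (hN e)) y (hY hy) z (hY hz)

variable (k : Type) [Field k]

lemma MonDepthGE.edgeExps [Finite V] (N : Set V) (Y : Finset V) (h : IsPendantLike G N Y) :
    MonDepthGE k Y.card (edgeExps G N) := by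
  classical
  induction N using WellFoundedGT.induction generalizing Y with
  | ind N ih =>
  rcases Y.eq_empty_or_nonempty with rfl | ⟨y, hy⟩
  · exact DepthGE.zero _
  have hyN := h.notMem y hy
  by_cases hex : ∃ u, G.Adj y u ∧ u ∉ N
  · obtain ⟨u, hyu, huN⟩ := hex
    have huY : u ∉ Y := fun hu => h.indep y hy u hu hyu
    have hother : ∀ z ∈ Y.erase y, ¬ G.Adj u z := fun z hz huz =>
      Finset.ne_of_mem_erase hz
        (h.eq_of_mem u huN z (Finset.mem_of_mem_erase hz) y hy huz hyu.symm)
    refine MonDepthGE.of_colon isUpperSet_edgeExps (Finsupp.single u 1)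
      (fun b => add_single_mem_edgeExps_iff huN) (fun b => mem_edgeExps_insert.symm) ?_ ?_
    · have hsub : N ⊆ N ∪ {w | G.Adj u w} := Set.subset_union_left
      have hY : IsPendantLike G (N ∪ {w | G.Adj u w}) (insert u (Y.erase y)) := by
        have h0 : IsPendantLike G (N ∪ {w | G.Adj u w}) (Y.erase y) :=
          h.mono (Finset.erase_subset _ _) hsub fun z hz hz' =>
            hz'.elim (h.notMem z (Finset.mem_of_mem_erase hz)) (hother z hz)
        refine ⟨?_, ?_, ?_, ?_⟩
        · intro z hz
          rcases Finset.mem_insert.1 hz with rfl | hz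
          · exact fun h' => h'.elim huN (G.loopless.irrefl _)
          · exact h0.notMem z hz
        · intro z hz z' hz'
          rcases Finset.mem_insert.1 hz with rfl | hz <;>
            rcases Finset.mem_insert.1 hz' with rfl | hz'
          · exact G.loopless.irrefl _
          · exact hother _ hz'
          · exact fun e => hother _ (by assumption) e.symm
          · exact h0.indep z hz z' hz'
        · intro z hz w w' h1 h2 h3 h4
          rcases Finset.mem_insert.1 hz with rfl | hz
          · exact absurd (Or.inr h1) h3
          · exact h0.eq_of_adj z hz w w' h1 h2 h3 h4
        · intro w hw z hz z' hz' h1 h2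
          rcases Finset.mem_insert.1 hz with rfl | hz
          · exact absurd (Or.inr h1.symm) hw
          rcases Finset.mem_insert.1 hz' with rfl | hz'
          · exact absurd (Or.inr h2.symm) hw
          exact h0.eq_of_mem w hw z hz z' hz' h1 h2
      have hcard : (insert u (Y.erase y)).card = Y.card := by
        rw [Finset.card_insert_of_notMem fun e => huY (Finset.mem_of_mem_erase e),
          Finset.card_erase_add_one hy]
      rw [← hcard]
      exact ih _ (Set.ssubset_iff_of_subset hsub |>.2 ⟨y, Or.inr hyu.symm, hyN⟩) _ hY
    · refine ih _ (Set.ssubset_insert huN) _ (h.mono subset_rfl (Set.subset_insert _ _) ?_)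
      rintro z hz (rfl | hz')
      · exact huY hz
      · exact h.notMem z hz hz'
  · push Not at hex
    rw [← Finset.card_erase_add_one hy]
    refine MonDepthGE.succ isUpperSet_edgeExps y (fun b hb => ?_)
      (fun b => mem_edgeExps_insert.symm)
      (ih _ (Set.ssubset_insert hyN) _
        (h.mono (Finset.erase_subset _ _) (Set.subset_insert _ _) ?_))
    · rw [add_single_mem_edgeExps_iff hyN] at hb
      rwa [Set.union_eq_left.2 (fun w hw => hex w hw : {w | G.Adj y w} ⊆ N)] at hb
    · rintro z hz (rfl | hz')
      · exact Finset.notMem_erase _ _ hz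
      · exact h.notMem z (Finset.mem_of_mem_erase hz) hz'

lemma IsPendantLike.exists_of_leaf {Y : Finset V} (h : IsPendantLike G N Y) (hHG : H ≤ G) {u v : V}
    (huv : G.Adj u v) (hH : ¬ H.Adj u v) (hu : u ∉ N) (hvN : v ∉ N)
    (hv : ∀ w, G.Adj v w → ¬ H.Adj v w → w ∉ N → w = u) :
    ∃ Y', IsPendantLike G (N ∪ {w | H.Adj u w ∨ H.Adj v w}) Y' ∧ Y.card ≤ Y'.card + 1 := by
  classical
  have hsub : N ⊆ N ∪ {w | H.Adj u w ∨ H.Adj v w} := Set.subset_union_left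
  by_cases hY : u ∈ Y ∨ v ∈ Y
  · refine ⟨Y, h.mono subset_rfl hsub ?_, Nat.le_succ _⟩
    rintro y hy (hyN | hyu | hyv)
    · exact h.notMem y hy hyN
    · rcases hY with hY | hY
      · exact h.indep u hY y hy (hHG hyu)
      · exact hH (h.eq_of_mem u hu y hy v hY (hHG hyu) huv ▸ hyu)
    · rcases hY with hY | hY
      · exact hH (h.eq_of_mem v hvN y hy u hY (hHG hyv) huv.symm ▸ hyv).symm
      · exact h.indep v hY y hy (hHG hyv)
  · push Not at hY
    set Y₀ := Y.filter fun y => ¬ G.Adj u y ∧ ¬ G.Adj v y with hY₀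
    have hm : ∀ y ∈ Y₀, y ∈ Y ∧ ¬ G.Adj u y ∧ ¬ G.Adj v y := fun y hy => Finset.mem_filter.1 hy
    have h0 : IsPendantLike G (N ∪ {w | H.Adj u w ∨ H.Adj v w}) Y₀ := by
      refine h.mono (Finset.filter_subset _ _) hsub ?_
      rintro y hy (hyN | hyu | hyv)
      · exact h.notMem y (hm y hy).1 hyN
      · exact (hm y hy).2.1 (hHG hyu)
      · exact (hm y hy).2.2 (hHG hyv)
    have hv' : ∀ w, G.Adj v w → w ∉ N ∪ {w | H.Adj u w ∨ H.Adj v w} → w = u := fun w hw hw' =>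
      hv w hw (fun e => hw' (Or.inr (Or.inr e))) fun e => hw' (Or.inl e)
    refine ⟨insert v Y₀, ⟨?_, ?_, ?_, ?_⟩, ?_⟩
    · intro z hz
      rcases Finset.mem_insert.1 hz with rfl | hz
      · rintro (e | e | e)
        · exact hvN e
        · exact hH e
        · exact H.loopless.irrefl _ e
      · exact h0.notMem z hz
    · intro z hz z' hz'
      rcases Finset.mem_insert.1 hz with rfl | hz <;>
        rcases Finset.mem_insert.1 hz' with rfl | hz'
      · exact G.loopless.irrefl _
      · exact (hm _ hz').2.2
      · exact fun e => (hm _ hz).2.2 e.symm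
      · exact h0.indep z hz z' hz'
    · intro z hz w w' h1 h2 h3 h4
      rcases Finset.mem_insert.1 hz with rfl | hz
      · rw [hv' w h1 h3, hv' w' h2 h4]
      · exact h0.eq_of_adj z hz w w' h1 h2 h3 h4
    · intro w hw z hz z' hz' h1 h2
      rcases Finset.mem_insert.1 hz with rfl | hz <;>
        rcases Finset.mem_insert.1 hz' with rfl | hz'
      · rfl
      · exact absurd (hv' w h1.symm hw ▸ h2) (hm _ hz').2.1
      · exact absurd (hv' w h2.symm hw ▸ h1) (hm _ hz).2.1
      · exact h0.eq_of_mem w hw z hz z' hz' h1 h2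
    · have hle : ∀ w, w ∉ N → (Y.filter fun y => G.Adj w y).card ≤ 1 := fun w hw =>
        Finset.card_le_one.2 fun a ha b hb => by
          rw [Finset.mem_filter] at ha hb
          exact h.eq_of_mem w hw a ha.1 b hb.1 ha.2 hb.2
      have hcov : Y ⊆ Y₀ ∪ ((Y.filter fun y => G.Adj u y) ∪ Y.filter fun y => G.Adj v y) := by
        intro y hy
        simp only [hY₀, Finset.mem_union, Finset.mem_filter]
        tauto
      have h1 := Finset.card_le_card hcov
      have h2 := Finset.card_union_le Y₀
        ((Y.filter fun y => G.Adj u y) ∪ Y.filter fun y => G.Adj v y)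
      have h3 := Finset.card_union_le (Y.filter fun y => G.Adj u y) (Y.filter fun y => G.Adj v y)
      have h4 := hle u hu
      have h5 := hle v hvN
      rw [Finset.card_insert_of_notMem fun e => hY.2 (hm _ e).1]
      omega

variable (G) in
/-- Every nonempty spanning subgraph has a leaf. -/
def HasLeaves : Prop :=
  ∀ K ≤ G, K ≠ ⊥ → ∃ v u, K.Adj v u ∧ ∀ w, K.Adj v w → w = u

lemma MonDepthGE.powExps_union_edgeExps [Finite V] (hG : HasLeaves G) (t : ℕ)
    (H : SimpleGraph V) (hHG : H ≤ G) (N : Set V) (Y : Finset V) (h : IsPendantLike G N Y) (r : ℕ)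
    (hr : r + t ≤ Y.card + 1) : MonDepthGE k r (powExps G t ∪ MonomialIdealDepth.edgeExps H N) := by
  classical
  induction t generalizing H N Y with
  | zero =>
    rw [powExps_zero, Set.univ_union]
    exact MonDepthGE.univ r
  | succ t iht =>
  induction H using WellFoundedGT.induction with
  | ind H ihH =>
  let K : SimpleGraph V := SimpleGraph.mk
    (fun x y => G.Adj x y ∧ ¬ H.Adj x y ∧ x ∉ N ∧ y ∉ N)
    ⟨fun x y ⟨h1, h2, h3, h4⟩ => ⟨h1.symm, fun e => h2 e.symm, h4, h3⟩⟩
    ⟨fun x hx => G.loopless.irrefl x hx.1⟩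
  by_cases hK : K = ⊥
  · have e : powExps G (t + 1) ∪ MonomialIdealDepth.edgeExps H N =
        MonomialIdealDepth.edgeExps G N := by
      ext a
      constructor
      · rintro (ha | ⟨x, y, hxy, hx⟩ | ha)
        · exact Or.inl (powExps_succ_subset t ha)
        · exact Or.inl ⟨x, y, hHG hxy, hx⟩
        · exact Or.inr ha
      · rintro (⟨x, y, hxy, hx, hy⟩ | ha)
        · right
          by_cases hH : H.Adj x y
          · exact Or.inl ⟨x, y, hH, hx, hy⟩
          by_cases hxN : x ∈ N
          · exact Or.inr ⟨x, hxN, hx⟩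
          by_cases hyN : y ∈ N
          · exact Or.inr ⟨y, hyN, hy⟩
          have : K.Adj x y := ⟨hxy, hH, hxN, hyN⟩
          rw [hK] at this
          exact this.elim
        · exact Or.inr (Or.inr ha)
    rw [e]
    exact DepthGE.mono (MonDepthGE.edgeExps k N Y h) (by omega)
  · obtain ⟨v, u, ⟨hvu, hH, hvN, huN⟩, hleaf⟩ := hG K (fun _ _ h => h.1) hK
    have hH' : ¬ H.Adj u v := fun e => hH e.symm
    have hv : ∀ w, G.Adj v w → ¬ H.Adj v w → w ∉ N → w = u := fun w h1 h2 h3 =>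
      hleaf w ⟨h1, h2, hvN, h3⟩
    obtain ⟨Y', hY', hcard⟩ := h.exists_of_leaf hHG hvu.symm hH' huN hvN hv
    refine MonDepthGE.of_colon ((isUpperSet_powExps _).union isUpperSet_edgeExps) (pairExp (u, v))
      (fun b => add_pairExp_mem_iff hvu.symm hH' huN hvN hv)
      (U₂ := powExps G (t + 1) ∪ MonomialIdealDepth.edgeExps (H ⊔ SimpleGraph.edge u v) N)
      (fun b => ?_) (iht H hHG _ Y' hY' (by omega)) (ihH _ ?_ ?_)
    · rw [Set.mem_union, Set.mem_union, mem_edgeExps_sup_edge hvu.ne', or_assoc]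
    · refine lt_of_le_of_ne le_sup_left fun e => hH' ?_
      rw [e, SimpleGraph.sup_adj, SimpleGraph.edge_adj]
      exact Or.inr ⟨Or.inl ⟨rfl, rfl⟩, hvu.ne'⟩
    · refine sup_le hHG fun x y hxy => ?_
      rw [SimpleGraph.edge_adj] at hxy
      rcases hxy with ⟨⟨rfl, rfl⟩ | ⟨rfl, rfl⟩, -⟩
      · exact hvu.symm
      · exact hvu

end Graphs

section Depth
variable {k : Type} [Field k] {V : Type}

lemma maxHomIdeal_eq_ker : maxHomIdeal k V = RingHom.ker (constantCoeff (σ := V) (R := k)) := by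
  ext f
  rw [maxHomIdeal, ← Set.image_univ, mem_ideal_span_X_image, RingHom.mem_ker,
    constantCoeff_eq]
  constructor
  · intro h
    by_contra h0
    obtain ⟨i, -, hi⟩ := h 0 (mem_support_iff.2 h0)
    exact hi rfl
  · intro h m hm
    by_contra! hm0
    have : m = 0 := Finsupp.ext fun i => hm0 i trivial
    exact mem_support_iff.1 hm (this ▸ h)

instance maxHomIdeal_isMaximal : (maxHomIdeal k V).IsMaximal := by
  rw [maxHomIdeal_eq_ker]
  exact RingHom.ker_isMaximal_of_surjective _ fun c => ⟨C c, constantCoeff_C V c⟩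

lemma le_depthQuot [Finite V] {I : Ideal (MvPolynomial V k)} (hI : I ≤ maxHomIdeal k V) {r : ℕ}
    (h : DepthGE (maxHomIdeal k V) r I) : r ≤ depthQuot k I := by
  have key : ∀ i, Nontrivial ((localCohomology (maxHomIdeal k V) i).obj
      (ModuleCat.of (MvPolynomial V k) (MvPolynomial V k ⧸ I))) ↔
      ¬ Vanishes (maxHomIdeal k V) i (ModuleCat.of _ (MvPolynomial V k ⧸ I)) := fun i => by
    rw [← subsingleton_localCohomology_iff, not_subsingleton_iff_nontrivial]
  refine le_csInf ?_ fun i hi => ?_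
  · obtain ⟨i, hi⟩ := exists_not_vanishes I hI
    exact ⟨i, (key i).2 hi⟩
  · by_contra! hlt
    exact (key i).1 hi (h i hlt)

lemma X_mul_X (u v : V) : (X u * X v : MvPolynomial V k) = monomial (pairExp (u, v)) 1 := by
  rw [X, X, monomial_mul, one_mul]
  rfl

lemma monIdeal_union (U U' : Set (V →₀ ℕ)) :
    monIdeal k (U ∪ U') = monIdeal k U ⊔ monIdeal k U' := by
  rw [monIdeal, Set.image_union, Ideal.span_union]
  rfl

lemma edgeIdeal_pow (G : SimpleGraph V) (t : ℕ) :
    edgeIdeal k G ^ t = monIdeal k (powExps G t) := by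
  apply le_antisymm
  · induction t with
    | zero =>
      rw [powExps_zero, monIdeal_univ]
      exact le_top
    | succ t ih =>
      rw [pow_succ]
      refine (Ideal.mul_mono_left ih).trans ?_
      rw [monIdeal, edgeIdeal, Ideal.span_mul_span', Ideal.span_le]
      rintro _ ⟨_, ⟨a, ha, rfl⟩, _, ⟨u, v, huv, rfl⟩, rfl⟩
      refine Ideal.subset_span ⟨a + pairExp (u, v), mem_powExps_add huv ha, ?_⟩
      simp only [X_mul_X, monomial_mul, one_mul]
  · rw [monIdeal, Ideal.span_le]
    rintro _ ⟨a, ⟨L, rfl, hL, hLa⟩, rfl⟩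
    have key : monomial (pairsExp L) (1 : k) ∈ edgeIdeal k G ^ L.card := by
      clear hLa
      induction L using Multiset.induction with
      | empty => simp
      | cons p L ih =>
        rw [pairsExp_cons, Multiset.card_cons, pow_succ', ← one_mul (1 : k), ← monomial_mul]
        refine Ideal.mul_mem_mul (Ideal.subset_span ⟨p.1, p.2, hL p (by simp), ?_⟩)
          (ih fun q hq => hL q (Multiset.mem_cons_of_mem hq))
        rw [X_mul_X]
    refine Ideal.mem_of_dvd _ ?_ key
    exact monomial_dvd_monomial.2 ⟨Or.inr hLa, dvd_rfl⟩

lemma powExps_one (H : SimpleGraph V) : powExps H 1 = edgeExps H ∅ := by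
  ext a
  constructor
  · exact fun ha => Or.inl (powExps_succ_subset 0 ha)
  · rintro (⟨u, v, huv, hu, hv⟩ | ⟨w, hw, -⟩)
    · refine ⟨{(u, v)}, rfl, fun p hp => ?_, ?_⟩
      · rw [Multiset.mem_singleton.1 hp]
        exact huv
      · simpa [pairsExp] using (pairExp_le_iff huv.ne).2 ⟨hu, hv⟩
    · exact hw.elim

lemma edgeIdeal_pow_sup_edgeIdeal (G H : SimpleGraph V) (t : ℕ) :
    edgeIdeal k G ^ t ⊔ edgeIdeal k H = monIdeal k (powExps G t ∪ edgeExps H ∅) := by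
  rw [← pow_one (edgeIdeal k H), edgeIdeal_pow, edgeIdeal_pow, powExps_one, monIdeal_union]

lemma edgeIdeal_le_maxHomIdeal (G : SimpleGraph V) : edgeIdeal k G ≤ maxHomIdeal k V := by
  rw [edgeIdeal, Ideal.span_le]
  rintro _ ⟨u, v, -, rfl⟩
  exact Ideal.mul_mem_left _ _ (Ideal.subset_span ⟨v, rfl⟩)

/-- The depth bound for a graph in which every nonempty spanning subgraph has a leaf. -/
theorem le_depthQuot_edgeIdeal_pow_sup [Finite V] {G H : SimpleGraph V} (hG : HasLeaves G)
    (hH : H ≤ G) {Y : Finset V} (hY : IsPendantLike G ∅ Y) {t : ℕ} (ht : t ≠ 0) :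
    Y.card + 1 - t ≤ depthQuot k (edgeIdeal k G ^ t ⊔ edgeIdeal k H) := by
  rcases le_or_gt t (Y.card + 1) with h | h
  · apply le_depthQuot
    · exact sup_le ((Ideal.pow_le_self ht).trans (edgeIdeal_le_maxHomIdeal G))
        (edgeIdeal_le_maxHomIdeal H)
    · rw [edgeIdeal_pow_sup_edgeIdeal]
      exact MonDepthGE.powExps_union_edgeExps k hG t H hH ∅ Y hY _ (by omega)
  · omega

end Depth

section Leaves

lemma exists_leaf_of_isAcyclic {V : Type} [Finite V] {G : SimpleGraph V} (hG : G.IsAcyclic)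
    {x y : V} (hxy : G.Adj x y) : ∃ v u, G.Adj v u ∧ ∀ w, G.Adj v w → w = u := by
  have : Nonempty V := ⟨x⟩
  obtain ⟨u, v, p, hp, hmax⟩ :=
    SimpleGraph.Walk.exists_isPath_forall_isPath_length_le_length G
  have hlen : 0 < p.length := by
    have : 1 ≤ p.length := by
      simpa using hmax x y (SimpleGraph.Walk.cons hxy .nil) (by simp [hxy.ne])
    omega
  have hnil : ¬ p.Nil := SimpleGraph.Walk.not_nil_iff_lt_length.2 hlen
  refine ⟨v, p.penultimate, (p.adj_penultimate hnil).symm, fun w hadj => ?_⟩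
  apply hG.eq_penultimate_of_adj_end hp hadj
  by_contra hw
  have := hmax _ _ (p.concat hadj) (hp.concat hw hadj)
  rw [SimpleGraph.Walk.length_concat] at this
  omega

variable {n d : ℕ} {T : SimpleGraph (Fin n)} {h : d ≤ n}

lemma whiskerFirst_inl_inl {i j : Fin n} :
    (whiskerFirst T h).Adj (Sum.inl i) (Sum.inl j) ↔ T.Adj i j := by
  simp only [whiskerFirst, SimpleGraph.fromRel_adj, Sum.inl.injEq, reduceCtorEq, and_false,
    exists_false, or_false]
  constructor
  · rintro ⟨-, ⟨i', j', h', rfl, rfl⟩ | ⟨i', j', h', rfl, rfl⟩⟩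
    · exact h'
    · exact h'.symm
  · exact fun h' => ⟨by simpa using h'.ne, Or.inl ⟨i, j, h', rfl, rfl⟩⟩

lemma whiskerFirst_inr_iff {m : Fin d} {w : Fin n ⊕ Fin d} :
    (whiskerFirst T h).Adj (Sum.inr m) w ↔ w = Sum.inl (Fin.castLE h m) := by
  simp only [whiskerFirst, SimpleGraph.fromRel_adj, reduceCtorEq, false_and, and_false,
    exists_false, false_or, Sum.inr.injEq]
  constructor
  · rintro ⟨-, ⟨m', rfl, rfl⟩⟩
    rfl
  · rintro rfl
    exact ⟨by simp, m, rfl, rfl⟩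

lemma hasLeaves_whiskerFirst (hT : T.IsAcyclic) : HasLeaves (whiskerFirst T h) := by
  intro K hK hne
  by_cases hw : ∃ m w, K.Adj (Sum.inr m) w
  · obtain ⟨m, w, hmw⟩ := hw
    refine ⟨_, w, hmw, fun w' hw' => ?_⟩
    rw [whiskerFirst_inr_iff.1 (hK hmw), whiskerFirst_inr_iff.1 (hK hw')]
  · push Not at hw
    obtain ⟨x, y, hxy⟩ := SimpleGraph.ne_bot_iff_exists_adj.1 hne
    rcases x with x | m
    · rcases y with y | m
      · have hle : K.comap Sum.inl ≤ T := fun i j hij => whiskerFirst_inl_inl.1 (hK hij)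
        obtain ⟨v, u, hvu, hv⟩ := exists_leaf_of_isAcyclic (hT.anti hle) (x := x) (y := y) hxy
        refine ⟨Sum.inl v, Sum.inl u, hvu, ?_⟩
        rintro (w | m) hvw
        · rw [hv w hvw]
        · exact absurd hvw.symm (hw _ _)
      · exact absurd hxy.symm (hw _ _)
    · exact absurd hxy (hw _ _)

lemma isPendantLike_whiskerFirst :
    IsPendantLike (whiskerFirst T h) ∅ (Finset.univ.map Function.Embedding.inr) where
  notMem _ _ := Set.notMem_empty _
  indep y hy z hz := by
    obtain ⟨m, -, rfl⟩ := Finset.mem_map.1 hy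
    obtain ⟨m', -, rfl⟩ := Finset.mem_map.1 hz
    exact fun e => Sum.inr_ne_inl (whiskerFirst_inr_iff.1 e)
  eq_of_adj y hy w w' h1 h2 _ _ := by
    obtain ⟨m, -, rfl⟩ := Finset.mem_map.1 hy
    rw [whiskerFirst_inr_iff.1 h1, whiskerFirst_inr_iff.1 h2]
  eq_of_mem w _ y hy z hz h1 h2 := by
    obtain ⟨m, -, rfl⟩ := Finset.mem_map.1 hy
    obtain ⟨m', -, rfl⟩ := Finset.mem_map.1 hz
    have h3 := (whiskerFirst_inr_iff.1 h1.symm).symm.trans (whiskerFirst_inr_iff.1 h2.symm)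
    rw [Fin.castLE_injective h (Sum.inl_injective h3)]

variable (h) in
/-- The graph formed by the whiskers with index in `W`. -/
def whiskersOn (W : Set (Fin d)) : SimpleGraph (Fin n ⊕ Fin d) :=
  SimpleGraph.fromRel fun u v => ∃ m ∈ W, u = Sum.inl (Fin.castLE h m) ∧ v = Sum.inr m

lemma whiskersOn_le (W : Set (Fin d)) : whiskersOn h W ≤ whiskerFirst T h := by
  intro u v huv
  obtain ⟨-, ⟨m, -, rfl, rfl⟩ | ⟨m, -, rfl, rfl⟩⟩ := (SimpleGraph.fromRel_adj _ _ _).1 huv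
  · exact (whiskerFirst_inr_iff.2 rfl).symm
  · exact whiskerFirst_inr_iff.2 rfl

lemma edgeIdeal_whiskersOn (k : Type) [Field k] (W : Set (Fin d)) :
    edgeIdeal k (whiskersOn h W) = Ideal.span {p : MvPolynomial (Fin n ⊕ Fin d) k |
      ∃ m ∈ W, p = X (Sum.inl (Fin.castLE h m)) * X (Sum.inr m)} := by
  rw [edgeIdeal]
  congr 1
  ext p
  constructor
  · rintro ⟨u, v, huv, rfl⟩
    obtain ⟨-, ⟨m, hm, rfl, rfl⟩ | ⟨m, hm, rfl, rfl⟩⟩ := (SimpleGraph.fromRel_adj _ _ _).1 huv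
    · exact ⟨m, hm, rfl⟩
    · exact ⟨m, hm, mul_comm _ _⟩
  · rintro ⟨m, hm, rfl⟩
    exact ⟨_, _, (SimpleGraph.fromRel_adj _ _ _).2 ⟨Sum.inl_ne_inr, Or.inl ⟨m, hm, rfl, rfl⟩⟩, rfl⟩

end Leaves

end MonomialIdealDepth

/-- If `G` is obtained from a tree `T` on `n` vertices by adding whiskers `{x_i, y_i}` at
`x_1, …, x_d`, then for every `1 ≤ t ≤ d` and every subgraph `H` of `G` whose edges form a
subset `W` of the whisker edges `{x_1 y_1, …, x_d y_d}`,
`depth R/(I(G)^t + I(H)) ≥ d - t + 1`. -/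
theorem depth_power_plus_whiskers_lower_bound (k : Type) [Field k] (n d : ℕ) (hdn : d ≤ n)
    (T : SimpleGraph (Fin n)) (hconn : T.Connected) (hacyc : T.IsAcyclic)
    (W : Set (Fin d)) :
    ∀ t : ℕ, 1 ≤ t → t ≤ d →
      (d : ℤ) - t + 1 ≤
        depthQuot k ((edgeIdeal k (whiskerFirst T hdn)) ^ t ⊔
          Ideal.span {p : MvPolynomial (Fin n ⊕ Fin d) k |
            ∃ m ∈ W, p = X (Sum.inl (Fin.castLE hdn m)) * X (Sum.inr m)}) := by
  intro t ht htd
  have h := MonomialIdealDepth.le_depthQuot_edgeIdeal_pow_sup (k := k)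
    (MonomialIdealDepth.hasLeaves_whiskerFirst (h := hdn) hacyc)
    (MonomialIdealDepth.whiskersOn_le W) MonomialIdealDepth.isPendantLike_whiskerFirst
    (Nat.one_le_iff_ne_zero.1 ht)
  rw [MonomialIdealDepth.edgeIdeal_whiskersOn, Finset.card_map, Finset.card_univ,
    Fintype.card_fin] at h
  omega
end

section
/- Let k be a field, d ≥ 5 an integer, S = k[x_1,…,x_d,y_1,…,y_d], and fix an integer a with 2 ≤ a ≤ d − 1. Let I(G_{d,a}) = x_1(y_1,…,y_d) + (x_i y_j : 2 ≤ i ≤ j ≤ a) + (x_i y_j : a+1 ≤ i ≤ j ≤ d). Then the colon ideal I(G_{d,a})^2 : (x_1 y_d) equals I(G_{d,a}) + (x_{a+1},…,x_d)·(y_1,…,y_d), where (x_{a+1},…,x_d)·(y_1,…,y_d) is the ideal generated by all products x_i y_j with a+1 ≤ i ≤ d and 1 ≤ j ≤ d. -/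
open MvPolynomial

section BipartiteEdgeIdeal

variable {α β : Type*}

/-- The edge ideal of the bipartite graph on `α ⊕ β` whose edges are given by `R`. -/
noncomputable def bipartiteEdgeIdeal (k : Type*) [Field k] (R : α → β → Prop) :
    Ideal (MvPolynomial (α ⊕ β) k) :=
  Ideal.span {p | ∃ i j, R i j ∧ p = X (Sum.inl i) * X (Sum.inr j)}

/-- The exponent vector of the monomial `x_i y_j`. -/
noncomputable def edgeExponent (i : α) (j : β) : α ⊕ β →₀ ℕ :=
  Finsupp.single (Sum.inl i) 1 + Finsupp.single (Sum.inr j) 1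

theorem monomial_edgeExponent (k : Type*) [Field k] (i : α) (j : β) :
    monomial (edgeExponent i j) (1 : k) = X (Sum.inl i) * X (Sum.inr j) := by
  simp [edgeExponent, X, monomial_mul]

theorem edgeExponent_le {i : α} {j : β} {m : α ⊕ β →₀ ℕ} (hi : 1 ≤ m (Sum.inl i))
    (hj : 1 ≤ m (Sum.inr j)) : edgeExponent i j ≤ m := by
  classical
  rintro (u | u)
  · by_cases h : i = u
    · subst h; simpa [edgeExponent] using hi
    · simp [edgeExponent, h]
  · by_cases h : j = u
    · subst h; simpa [edgeExponent] using hj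
    · simp [edgeExponent, h]

theorem bipartiteEdgeIdeal_eq_span_monomial (k : Type*) [Field k] (R : α → β → Prop) :
    bipartiteEdgeIdeal k R = Ideal.span
      ((fun m => monomial m (1 : k)) '' {m | ∃ i j, R i j ∧ m = edgeExponent i j}) := by
  unfold bipartiteEdgeIdeal
  congr 1
  ext p
  constructor
  · rintro ⟨i, j, h, rfl⟩
    exact ⟨_, ⟨i, j, h, rfl⟩, monomial_edgeExponent k i j⟩
  · rintro ⟨_, ⟨i, j, h, rfl⟩, rfl⟩
    exact ⟨i, j, h, monomial_edgeExponent k i j⟩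

theorem bipartiteEdgeIdeal_sq_eq_span_monomial (k : Type*) [Field k] (R : α → β → Prop) :
    bipartiteEdgeIdeal k R ^ 2 = Ideal.span ((fun m => monomial m (1 : k)) ''
      {m | ∃ p q r s, R p q ∧ R r s ∧ m = edgeExponent p q + edgeExponent r s}) := by
  rw [bipartiteEdgeIdeal_eq_span_monomial, pow_two, Ideal.span_mul_span']
  congr 1
  ext f
  constructor
  · rintro ⟨_, ⟨_, ⟨p, q, h, rfl⟩, rfl⟩, _, ⟨_, ⟨r, s, h', rfl⟩, rfl⟩, rfl⟩
    exact ⟨_, ⟨p, q, r, s, h, h', rfl⟩, by simp [monomial_mul]⟩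
  · rintro ⟨_, ⟨p, q, r, s, h, h', rfl⟩, rfl⟩
    exact ⟨_, ⟨_, ⟨p, q, h, rfl⟩, rfl⟩, _, ⟨_, ⟨r, s, h', rfl⟩, rfl⟩, by simp [monomial_mul]⟩

/-- If `x_p x_r` divides `m x_c`, then at least one of `x_p`, `x_r` divides `m`, and both do
unless the other one is `x_c`. -/
theorem one_le_of_ite_add_ite_le {ι : Type*} [DecidableEq ι] {f : ι → ℕ} {p r c : ι}
    (h : ∀ u, (if p = u then 1 else 0) + (if r = u then 1 else 0) ≤
      f u + if c = u then 1 else 0) :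
    (1 ≤ f p ∧ 1 ≤ f r) ∨ (p = c ∧ 1 ≤ f r) ∨ (r = c ∧ 1 ≤ f p) := by
  have hp := h p
  have hr := h r
  grind

/-- The square of a bipartite edge ideal, divided by an edge `x_c y_e`, is again a bipartite
edge ideal: the new edges join the neighbours of `y_e` to the neighbours of `x_c`. -/
theorem colon_bipartiteEdgeIdeal_sq (k : Type*) [Field k] (R : α → β → Prop) {c : α} {e : β}
    (hce : R c e) :
    Submodule.colon (bipartiteEdgeIdeal k R ^ 2)
        (Ideal.span {(X (Sum.inl c) * X (Sum.inr e) : MvPolynomial (α ⊕ β) k)}) =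
      bipartiteEdgeIdeal k (fun i j => R i j ∨ (R i e ∧ R c j)) := by
  classical
  apply le_antisymm
  · intro f hf
    have hf' := Submodule.mem_colon.1 hf _ (Ideal.mem_span_singleton_self _)
    rw [smul_eq_mul, ← monomial_edgeExponent, bipartiteEdgeIdeal_sq_eq_span_monomial,
      mem_ideal_span_monomial_image] at hf'
    rw [bipartiteEdgeIdeal_eq_span_monomial, mem_ideal_span_monomial_image]
    intro m hm
    obtain ⟨_, ⟨p, q, r, s, hpq, hrs, rfl⟩, hle⟩ := hf' (m + edgeExponent c e) (by
      rw [mem_support_iff, coeff_mul_monomial, mul_one]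
      exact mem_support_iff.1 hm)
    have hx := one_le_of_ite_add_ite_le (f := fun u => m (Sum.inl u)) (p := p) (r := r) (c := c)
      fun u => by simpa [edgeExponent, Finsupp.single_apply] using hle (Sum.inl u)
    have hy := one_le_of_ite_add_ite_le (f := fun u => m (Sum.inr u)) (p := q) (r := s) (c := e)
      fun u => by simpa [edgeExponent, Finsupp.single_apply] using hle (Sum.inr u)
    suffices ∃ i j, (R i j ∨ (R i e ∧ R c j)) ∧ 1 ≤ m (Sum.inl i) ∧ 1 ≤ m (Sum.inr j) by
      obtain ⟨i, j, h, hi, hj⟩ := this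
      exact ⟨_, ⟨i, j, h, rfl⟩, edgeExponent_le hi hj⟩
    rcases hx with ⟨hp, hr⟩ | ⟨rfl, hr⟩ | ⟨rfl, hp⟩ <;>
      rcases hy with ⟨hq, hs⟩ | ⟨rfl, hs⟩ | ⟨rfl, hq⟩
    · exact ⟨p, q, .inl hpq, hp, hq⟩
    · exact ⟨r, s, .inl hrs, hr, hs⟩
    · exact ⟨p, q, .inl hpq, hp, hq⟩
    · exact ⟨r, s, .inl hrs, hr, hs⟩
    · exact ⟨r, s, .inl hrs, hr, hs⟩
    · exact ⟨r, q, .inr ⟨hrs, hpq⟩, hr, hq⟩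
    · exact ⟨p, q, .inl hpq, hp, hq⟩
    · exact ⟨p, s, .inr ⟨hpq, hrs⟩, hp, hs⟩
    · exact ⟨p, q, .inl hpq, hp, hq⟩
  · have mem : ∀ {i j}, R i j →
        (X (Sum.inl i) * X (Sum.inr j) : MvPolynomial (α ⊕ β) k) ∈ bipartiteEdgeIdeal k R :=
      fun {i j} h => Ideal.subset_span ⟨i, j, h, rfl⟩
    refine Ideal.span_le.2 ?_
    rintro _ ⟨i, j, h, rfl⟩
    refine Submodule.mem_colon.2 fun g hg => ?_
    obtain ⟨t, rfl⟩ := Ideal.mem_span_singleton'.1 hg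
    rw [smul_eq_mul, pow_two]
    rcases h with h | ⟨hi, hj⟩
    · convert Ideal.mul_mem_left _ t (Ideal.mul_mem_mul (mem h) (mem hce)) using 1
      ring
    · convert Ideal.mul_mem_left _ t (Ideal.mul_mem_mul (mem hi) (mem hj)) using 1
      ring

end BipartiteEdgeIdeal

/-- Here the ideal `I` is the edge ideal
`I(G_{d,a}) = x_1(y_1, …, y_d) + (x_i y_j : 2 ≤ i ≤ j ≤ a) + (x_i y_j : a+1 ≤ i ≤ j ≤ d)`
of the bipartite graph `G_{d,a}`, with `x_i = X (inl i)`, `y_i = X (inr i)` and `1`-based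
indices translated to `0`-based `Fin d` indices.
Then `I(G_{d,a})^2 : (x_1 y_d) = I(G_{d,a}) + (x_{a+1}, …, x_d)·(y_1, …, y_d)`. -/
theorem colon_square_two_drops_graph (k : Type) [Field k] (d a : ℕ)
    (hd : 5 ≤ d) (ha2 : 2 ≤ a) (had : a ≤ d - 1)
    (I : Ideal (MvPolynomial (Fin d ⊕ Fin d) k))
    (hI : I = Ideal.span
      ({p | ∃ i : Fin d, p = X (Sum.inl (⟨0, by omega⟩ : Fin d)) * X (Sum.inr i)} ∪
       {p | ∃ i jm : Fin d, 1 ≤ (i : ℕ) ∧ i ≤ jm ∧ (jm : ℕ) < a ∧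
          p = X (Sum.inl i) * X (Sum.inr jm)} ∪
       {p | ∃ i jm : Fin d, a ≤ (i : ℕ) ∧ i ≤ jm ∧
          p = X (Sum.inl i) * X (Sum.inr jm)})) :
    Submodule.colon (I ^ 2)
        (Ideal.span {(X (Sum.inl (⟨0, by omega⟩ : Fin d)) *
          X (Sum.inr (⟨d - 1, by omega⟩ : Fin d)) : MvPolynomial (Fin d ⊕ Fin d) k)}) =
      I ⊔ Ideal.span {p : MvPolynomial (Fin d ⊕ Fin d) k |
        ∃ i jm : Fin d, a ≤ (i : ℕ) ∧ p = X (Sum.inl i) * X (Sum.inr jm)} := by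
  set c : Fin d := ⟨0, by omega⟩
  set e : Fin d := ⟨d - 1, by omega⟩ with he
  let R : Fin d → Fin d → Prop := fun i j =>
    i = c ∨ (1 ≤ (i : ℕ) ∧ i ≤ j ∧ (j : ℕ) < a) ∨ (a ≤ (i : ℕ) ∧ i ≤ j)
  have hIR : I = bipartiteEdgeIdeal k R := by
    rw [hI, bipartiteEdgeIdeal]
    congr 1
    ext p
    constructor
    · rintro ((⟨j, rfl⟩ | ⟨i, j, h1, h2, h3, rfl⟩) | ⟨i, j, h1, h2, rfl⟩)
      · exact ⟨c, j, .inl rfl, rfl⟩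
      · exact ⟨i, j, .inr (.inl ⟨h1, h2, h3⟩), rfl⟩
      · exact ⟨i, j, .inr (.inr ⟨h1, h2⟩), rfl⟩
    · rintro ⟨i, j, rfl | ⟨h1, h2, h3⟩ | ⟨h1, h2⟩, rfl⟩
      · exact .inl (.inl ⟨j, rfl⟩)
      · exact .inl (.inr ⟨i, j, h1, h2, h3, rfl⟩)
      · exact .inr ⟨i, j, h1, h2, rfl⟩
  rw [hIR, colon_bipartiteEdgeIdeal_sq k R (.inl rfl), bipartiteEdgeIdeal, bipartiteEdgeIdeal,
    ← Submodule.span_union]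
  congr 1
  ext p
  constructor
  · rintro ⟨i, j, h | ⟨rfl | ⟨-, -, h⟩ | ⟨h, -⟩, -⟩, rfl⟩
    · exact .inl ⟨i, j, h, rfl⟩
    · exact .inl ⟨c, j, .inl rfl, rfl⟩
    · simp only [he] at h
      omega
    · exact .inr ⟨i, j, h, rfl⟩
  · rintro (⟨i, j, h, rfl⟩ | ⟨i, j, h, rfl⟩)
    · exact ⟨i, j, .inl h, rfl⟩
    · refine ⟨i, j, .inr ⟨.inr (.inr ⟨h, ?_⟩), .inl rfl⟩, rfl⟩
      rw [Fin.le_def]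
      simp only [he]
      omega
end
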